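/- Fix n ≥ 2. For each composition 𝓘 = (n₁,…,n_k) of n set m₀ = 0, m_i = n₁+⋯+n_i, d_i = ∏_{j=m_{i−1}+1}^{m_i} A_j, and let 𝒲(𝓘) be the set of n-tuples (A₁,…,A_n) of positive reals such that 2·A_{m_{i−1}+1}^{n_i} ≥ d_i·γ_{n_i+1}^{(n_i+1)/2} for each i and Σ_{i=1}^k ( A_{m_{i−1}+1}² − A_{m_{i−1}+1}^{2n_i+2}/(d_i²·γ_{n_i+1}^{n_i+1}) ) ≤ n/4. Let KZS be the set of n-tuples (A₁,…,A_n) of positive reals satisfying ∏_{i=1}^n A_i = 1, A_{i+1}² ≥ (3/4)A_i² for 1 ≤ i ≤ n−1, A_{i+2}² ≥ (2/3)A_i² for 1 ≤ i ≤ n−2, and A₁⋯A_i ≥ 1 for 1 ≤ i ≤ n−1. If KZS ⊆ ⋃_𝓘 𝒲(𝓘), the union over all compositions 𝓘 of n, then every unimodular lattice x in ℝⁿ satisfies sup_{u∈ℝⁿ} inf_{v∈x} |∏_{i=1}^n (u_i − v_i)| ≤ 2^{−n}. -/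

import Mathlib

open scoped BigOperators
open Matrix Topology Filter

noncomputable section

namespace SW

/-! ### Euclidean structure on `Fin n → ℝ` -/

/-- The standard Euclidean inner product on `Fin n → ℝ`. -/
def einner {n : ℕ} (v w : Fin n → ℝ) : ℝ := ∑ i, v i * w i

/-- The Euclidean norm on `Fin n → ℝ`. -/
def enorm {n : ℕ} (v : Fin n → ℝ) : ℝ := Real.sqrt (∑ i, v i ^ 2)

lemma einner_add_left {n : ℕ} (u v w : Fin n → ℝ) :
    einner (u + v) w = einner u w + einner v w := by
  simp [einner, add_mul, Finset.sum_add_distrib]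

lemma einner_neg_left {n : ℕ} (u w : Fin n → ℝ) : einner (-u) w = -einner u w := by
  simp [einner]

lemma einner_smul_left {n : ℕ} (c : ℝ) (u w : Fin n → ℝ) :
    einner (c • u) w = c * einner u w := by
  simp [einner, Finset.mul_sum, mul_assoc]

/-! ### Covolume, rank, lattices, stability -/

/-- `√(det Gram)` of a finite family of vectors: the covolume of the ℤ-span of the family
(in the span of the family) when the family is linearly independent. -/
def gvol {n r : ℕ} (v : Fin r → (Fin n → ℝ)) : ℝ :=
  Real.sqrt (Matrix.det (Matrix.of fun i j => einner (v i) (v j)))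

/-- `c` is the covolume of `Λ` in its real span, as computed from some ℤ-basis of `Λ` which is
linearly independent over `ℝ`. -/
def covolSpec {n : ℕ} (Λ : AddSubgroup (Fin n → ℝ)) (c : ℝ) : Prop :=
  ∃ (r : ℕ) (v : Fin r → (Fin n → ℝ)), LinearIndependent ℝ v ∧
    Λ = AddSubgroup.closure (Set.range v) ∧ c = gvol v

/-- The covolume of a discrete subgroup `Λ ⊆ ℝⁿ` inside its real span (with `covol ⊥ = 1`). -/
def covol {n : ℕ} (Λ : AddSubgroup (Fin n → ℝ)) : ℝ := sInf {c | covolSpec Λ c}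

/-- The rank of a discrete subgroup of `ℝⁿ`: the dimension of its real span. -/
def rk {n : ℕ} (Λ : AddSubgroup (Fin n → ℝ)) : ℕ :=
  Module.finrank ℝ (Submodule.span ℝ (Λ : Set (Fin n → ℝ)))

/-- A lattice in `ℝⁿ`: a discrete subgroup spanning `ℝⁿ` (equivalently, cocompact). -/
def IsLattice {n : ℕ} (L : AddSubgroup (Fin n → ℝ)) : Prop :=
  DiscreteTopology ↥L ∧ Submodule.span ℝ (L : Set (Fin n → ℝ)) = ⊤

/-- A unimodular lattice: a lattice of covolume one. -/
def IsUnimodularLattice {n : ℕ} (L : AddSubgroup (Fin n → ℝ)) : Prop :=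
  IsLattice L ∧ covol L = 1

/-- A stable lattice: a unimodular lattice all of whose subgroups have covolume at least one. -/
def IsStable {n : ℕ} (L : AddSubgroup (Fin n → ℝ)) : Prop :=
  IsUnimodularLattice L ∧ ∀ Λ : AddSubgroup (Fin n → ℝ), Λ ≤ L → 1 ≤ covol Λ

/-! ### Matrices: the diagonal group `A`, `SL_n(ℤ)`, lattices from matrices -/

/-- The group `A` of positive diagonal matrices of determinant one (as a set of matrices). -/
def Apos (n : ℕ) : Set (Matrix (Fin n) (Fin n) ℝ) :=
  {a | ∃ d : Fin n → ℝ, (∀ i, 0 < d i) ∧ (∏ i, d i) = 1 ∧ a = Matrix.diagonal d}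

/-- `SL_n(ℤ)` viewed as a set of real matrices. -/
def Gam (n : ℕ) : Set (Matrix (Fin n) (Fin n) ℝ) :=
  {γ | γ.det = 1 ∧ ∀ i j, ∃ m : ℤ, γ i j = (m : ℝ)}

/-- The lattice `g·ℤⁿ` associated to a matrix `g`. -/
def latticeOf {n : ℕ} (g : Matrix (Fin n) (Fin n) ℝ) : AddSubgroup (Fin n → ℝ) :=
  AddSubgroup.closure (Set.range fun m : Fin n → ℤ => g.mulVec fun i => (m i : ℝ))

/-- The image `g·L` of a lattice under a matrix. -/
def mapLat {n : ℕ} (g : Matrix (Fin n) (Fin n) ℝ) (L : AddSubgroup (Fin n → ℝ)) :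
    AddSubgroup (Fin n → ℝ) :=
  AddSubgroup.map (Matrix.mulVecLin g).toAddMonoidHom L

/-- The full preimage `A·g·Γ` in `SL_n(ℝ)` of the orbit `A·[g] ⊆ ℒ_n`; a point `[h] ∈ ℒ_n`
lies in the closure of `A·[g]` iff `h ∈ closure (AOrbit g)`. -/
def AOrbit {n : ℕ} (g : Matrix (Fin n) (Fin n) ℝ) : Set (Matrix (Fin n) (Fin n) ℝ) :=
  {p | ∃ a ∈ Apos n, ∃ γ ∈ Gam n, p = a * g * γ}

/-- The orbit `A·[g] ⊆ ℒ_n` is bounded (has compact closure). -/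
def HasBoundedAOrbit {n : ℕ} (g : Matrix (Fin n) (Fin n) ℝ) : Prop :=
  ∃ K : Set (Matrix (Fin n) (Fin n) ℝ), IsCompact K ∧
    ∀ a ∈ Apos n, ∃ γ ∈ Gam n, a * g * γ ∈ K

/-! ### `α`, `Min_δ`, `V_δ`, `dim_δ` -/

/-- `α(x) = min { |Λ|^{1/r(Λ)} : Λ a nonzero subgroup of x }`. -/
def alpha {n : ℕ} (x : AddSubgroup (Fin n → ℝ)) : ℝ :=
  sInf {c | ∃ Λ : AddSubgroup (Fin n → ℝ), Λ ≤ x ∧ Λ ≠ ⊥ ∧ c = covol Λ ^ ((rk Λ : ℝ)⁻¹)}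

/-- `α_k(x) = min { |Λ|^{1/k} : Λ a rank-`k` subgroup of x }`. -/
def alphak {n : ℕ} (k : ℕ) (x : AddSubgroup (Fin n → ℝ)) : ℝ :=
  sInf {c | ∃ Λ : AddSubgroup (Fin n → ℝ), Λ ≤ x ∧ rk Λ = k ∧ c = covol Λ ^ ((k : ℝ)⁻¹)}

/-- `Min_δ(x)`: nonzero subgroups nearly attaining `α(x)`. -/
def MinSet {n : ℕ} (δ : ℝ) (x : AddSubgroup (Fin n → ℝ)) : Set (AddSubgroup (Fin n → ℝ)) :=
  {Λ | Λ ≤ x ∧ Λ ≠ ⊥ ∧ covol Λ ^ ((rk Λ : ℝ)⁻¹) < (1 + δ) * alpha x}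

/-- `V_δ(x)`: the span of the subgroups in `Min_δ(x)`. -/
def Vdelta {n : ℕ} (δ : ℝ) (x : AddSubgroup (Fin n → ℝ)) : Submodule ℝ (Fin n → ℝ) :=
  Submodule.span ℝ (⋃ Λ ∈ MinSet δ x, (Λ : Set (Fin n → ℝ)))

/-- `dim_δ(x) = dim V_δ(x)`. -/
def dimdelta {n : ℕ} (δ : ℝ) (x : AddSubgroup (Fin n → ℝ)) : ℕ :=
  Module.finrank ℝ (Vdelta δ x)

/-- `U_k^{x,ε} ⊆ A`: those `a` for which `δ ↦ dim_δ(ax)` equals `k` near `kε`. -/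
def Uset {n : ℕ} (x : AddSubgroup (Fin n → ℝ)) (ε : ℝ) (k : ℕ) :
    Set (Matrix (Fin n) (Fin n) ℝ) :=
  {a | a ∈ Apos n ∧ ∃ s ∈ 𝓝 ((k : ℝ) * ε), ∀ δ ∈ s, dimdelta δ (mapLat a x) = k}

/-- Logarithmic coordinates on the diagonal group. -/
def logCoord {n : ℕ} (a : Matrix (Fin n) (Fin n) ℝ) : Fin n → ℝ := fun i => Real.log (a i i)

/-! ### Covering radius -/

/-- The covering radius `covrad(L) = sup_u inf_{v ∈ L} ‖u - v‖`. -/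
def covrad {n : ℕ} (L : AddSubgroup (Fin n → ℝ)) : ℝ :=
  ⨆ u : Fin n → ℝ, ⨅ v : L, enorm (u - (v : Fin n → ℝ))

/-- `[g]` is a local maximum of `covrad : ℒ_d → ℝ` (phrased via the open quotient
`SL_d(ℝ) → ℒ_d`). -/
def IsLocalMaxCovrad {d : ℕ} (g : Matrix (Fin d) (Fin d) ℝ) : Prop :=
  ∃ W ∈ 𝓝 g, ∀ g' ∈ W, Matrix.det g' = 1 → covrad (latticeOf g') ≤ covrad (latticeOf g)

/-! ### Block upper triangular form -/

/-- Offset of the `i`-th diagonal block. -/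
def off {k : ℕ} (ns : Fin k → ℕ) (i : Fin k) : ℕ :=
  ∑ j ∈ Finset.univ.filter (fun j => j < i), ns j

lemma off_add_lt {k : ℕ} (ns : Fin k → ℕ) (i : Fin k) (a : Fin (ns i)) :
    off ns i + (a : ℕ) < ∑ j, ns j := by
  unfold off
  have hins : i ∉ Finset.univ.filter (fun j => j < i) := by simp
  have h2 : ∑ j ∈ insert i (Finset.univ.filter (fun j => j < i)), ns j ≤ ∑ j, ns j :=
    Finset.sum_le_sum_of_subset (Finset.subset_univ _)
  rw [Finset.sum_insert hins] at h2
  have := a.isLt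
  omega

/-- The position, in `Fin n`, of the `a`-th coordinate of the `i`-th block. -/
def blockEmb {n k : ℕ} (ns : Fin k → ℕ) (hsum : (∑ j, ns j) = n) (i : Fin k)
    (a : Fin (ns i)) : Fin n :=
  ⟨off ns i + (a : ℕ), hsum ▸ off_add_lt ns i a⟩

/-- `g` is block upper triangular with diagonal blocks `G i` (block sizes `ns`). -/
def IsBlockUT {n k : ℕ} (ns : Fin k → ℕ) (hsum : (∑ j, ns j) = n)
    (g : Matrix (Fin n) (Fin n) ℝ) (G : ∀ i, Matrix (Fin (ns i)) (Fin (ns i)) ℝ) : Prop :=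
  (∀ (i : Fin k) (a b : Fin (ns i)),
      g (blockEmb ns hsum i a) (blockEmb ns hsum i b) = G i a b) ∧
  (∀ (i j : Fin k) (a : Fin (ns i)) (b : Fin (ns j)), j < i →
      g (blockEmb ns hsum i a) (blockEmb ns hsum j b) = 0)

/-! ### Mordell constant -/

/-- The symmetric box `[-a₁,a₁] × ⋯ × [-aₙ,aₙ]` is admissible for `L`: its interior contains
no nonzero point of `L`. -/
def IsAdmissibleBox {n : ℕ} (L : AddSubgroup (Fin n → ℝ)) (a : Fin n → ℝ) : Prop :=
  (∀ i, 0 < a i) ∧ ∀ v ∈ L, v ≠ 0 → ∃ i, a i ≤ |v i|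

/-- The Mordell constant `κ(L) = 2⁻ⁿ sup { Vol(B) : B admissible symmetric box for L }`. -/
def mordellConst {n : ℕ} (L : AddSubgroup (Fin n → ℝ)) : ℝ :=
  (1 / 2 ^ n) * sSup {V | ∃ a : Fin n → ℝ, IsAdmissibleBox L a ∧ V = ∏ i, 2 * a i}

/-! ### Hermite constant -/

/-- Length of a shortest nonzero vector of `L`. -/
def shortest {m : ℕ} (L : AddSubgroup (Fin m → ℝ)) : ℝ :=
  sInf {t | ∃ w ∈ L, w ≠ 0 ∧ t = enorm w}

/-- The Hermite constant `γ_m`. -/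
def hermiteConst (m : ℕ) : ℝ :=
  sSup {c | ∃ L : AddSubgroup (Fin m → ℝ), IsUnimodularLattice L ∧ c = shortest L ^ 2}

/-! ### Korkine–Zolotarev reduction -/

/-- `v 0, …, v (n-1)` is a Korkine–Zolotarev reduced basis of `x`: it is a ℤ-basis, and for
each `i` the orthogonal projection of `v i` onto `span(v 0, …, v (i-1))^⊥` is shortest among the
nonzero such projections of vectors of `x` (projection lengths are expressed through Gram
determinants: the projection of `w` has length `gvol (v 0, …, v (i-1), w) / gvol (v 0, …, v (i-1))`). -/
def IsKZBasis {n : ℕ} (x : AddSubgroup (Fin n → ℝ)) (v : ℕ → (Fin n → ℝ)) : Prop :=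
  LinearIndependent ℝ (fun j : Fin n => v (j : ℕ)) ∧
  x = AddSubgroup.closure (v '' Set.Iio n) ∧
  ∀ i < n, ∀ w ∈ x, w ∉ Submodule.span ℝ (v '' Set.Iio i) →
    gvol (Fin.snoc (fun j : Fin i => v (j : ℕ)) (v i)) ≤
      gvol (Fin.snoc (fun j : Fin i => v (j : ℕ)) w)

/-- `A 0, …, A (n-1)` are the diagonal Korkine–Zolotarev coefficients of `x`: the lengths of
the successive orthogonal projections in a KZ reduced basis, i.e.
`A i = gvol (v 0, …, v i) / gvol (v 0, …, v (i-1))`. -/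
def HasKZCoeffs {n : ℕ} (x : AddSubgroup (Fin n → ℝ)) (A : ℕ → ℝ) : Prop :=
  ∃ v : ℕ → (Fin n → ℝ), IsKZBasis x v ∧
    ∀ i < n, A i * gvol (fun j : Fin i => v (j : ℕ)) = gvol (fun j : Fin (i + 1) => v (j : ℕ))

/-! ### Orthogonal complements and projections of lattices -/

/-- The orthogonal complement of a subspace `V ⊆ ℝⁿ`. -/
def orthoC {n : ℕ} (V : Submodule ℝ (Fin n → ℝ)) : Submodule ℝ (Fin n → ℝ) where
  carrier := {w | ∀ v ∈ V, einner w v = 0}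
  zero_mem' := by intro v hv; simp [einner]
  add_mem' := by intro a b ha hb v hv; rw [einner_add_left, ha v hv, hb v hv, add_zero]
  smul_mem' := by intro c w hw v hv; rw [einner_smul_left, hw v hv, mul_zero]

/-- The image `π(x)` of `x` under the orthogonal projection `π : ℝⁿ → V^⊥`:
`p = π(u)` iff `p ⊥ V` and `u - p ∈ V`. -/
def projLat {n : ℕ} (V : Submodule ℝ (Fin n → ℝ)) (x : AddSubgroup (Fin n → ℝ)) :
    AddSubgroup (Fin n → ℝ) where
  carrier := {p | (∀ v ∈ V, einner p v = 0) ∧ ∃ u ∈ x, u - p ∈ V}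
  zero_mem' := ⟨by intro v hv; simp [einner], 0, x.zero_mem, by rw [sub_zero]; exact V.zero_mem⟩
  add_mem' := by
    rintro p q ⟨hp1, u1, hu1, hp2⟩ ⟨hq1, u2, hu2, hq2⟩
    refine ⟨fun v hv => by rw [einner_add_left, hp1 v hv, hq1 v hv, add_zero],
      u1 + u2, x.add_mem hu1 hu2, ?_⟩
    have h : u1 + u2 - (p + q) = u1 - p + (u2 - q) := by abel
    rw [h]; exact V.add_mem hp2 hq2
  neg_mem' := by
    rintro p ⟨hp1, u, hu, hp2⟩
    refine ⟨fun v hv => by rw [einner_neg_left, hp1 v hv, neg_zero],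
      -u, x.neg_mem hu, ?_⟩
    have h : -u - -p = -(u - p) := by abel
    rw [h]; exact V.neg_mem hp2

end SW

namespace SW.Mink

set_option linter.unusedSectionVars false

section gram
variable {m ι κ τ : Type*} [Fintype m] [Fintype ι] [Fintype κ] [Fintype τ]
  [DecidableEq ι] [DecidableEq κ] [DecidableEq m] [DecidableEq τ]

lemma one_le_det_one_add {D : Matrix ι ι ℝ} (hD : D.PosSemidef) : 1 ≤ (1 + D).det := by
  have hH : (1 + D).IsHermitian := (Matrix.isHermitian_one).add hD.1
  rw [hH.det_eq_prod_eigenvalues]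
  have h1 : ∀ i, 1 ≤ hH.eigenvalues i := by
    intro i
    have hn := hH.eigenvectorBasis.orthonormal.1 i
    have := hH.eigenvalues_eq i
    rw [this, add_mulVec, one_mulVec, dotProduct_add]
    have h2 := hD.dotProduct_mulVec_nonneg (WithLp.ofLp (hH.eigenvectorBasis i))
    have h3 : star (WithLp.ofLp (hH.eigenvectorBasis i)) ⬝ᵥ
        (WithLp.ofLp (hH.eigenvectorBasis i)) = 1 := by
      have : ‖hH.eigenvectorBasis i‖ ^ 2 = 1 := by rw [hn]; norm_num
      rw [EuclideanSpace.norm_sq_eq] at this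
      simpa [dotProduct, sq] using this
    rw [h3]
    simpa using h2
  have := Finset.prod_le_prod (s := Finset.univ) (f := fun _ : ι => (1 : ℝ))
    (g := hH.eigenvalues) (fun _ _ => zero_le_one) (fun i _ => h1 i)
  simpa using this

open scoped MatrixOrder in
lemma det_le_det_add {A C : Matrix ι ι ℝ} (hA : A.PosSemidef) (hC : C.PosSemidef) :
    A.det ≤ (A + C).det := by
  by_cases h0 : A.det = 0
  · rw [h0]; exact (hA.add hC).det_nonneg
  obtain ⟨N, rfl⟩ := CStarAlgebra.nonneg_iff_eq_star_mul_self.mp hA.nonneg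
  rw [star_eq_conjTranspose] at *
  have hN : IsUnit N.det := by
    rw [isUnit_iff_ne_zero]; intro h; apply h0; simp [h]
  have hD := hC.conjTranspose_mul_mul_same N⁻¹
  have h1 := one_le_det_one_add hD
  have e : Nᴴ * N + C = Nᴴ * (1 + N⁻¹ᴴ * C * N⁻¹) * N := by
    rw [mul_add, add_mul, mul_one]
    congr 1
    have h2 : N⁻¹ * N = 1 := Matrix.nonsing_inv_mul N hN
    have h3 : Nᴴ * N⁻¹ᴴ = 1 := by rw [← conjTranspose_mul, h2, conjTranspose_one]
    calc C = (Nᴴ * N⁻¹ᴴ) * C * (N⁻¹ * N) := by rw [h2, h3, one_mul, mul_one]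
      _ = _ := by simp only [Matrix.mul_assoc]
  rw [e, det_mul, det_mul, det_mul]
  have h4 : Nᴴ.det = N.det := by simp [conjTranspose_eq_transpose_of_trivial]
  rw [h4]
  nlinarith [mul_self_nonneg N.det]

/-- The Gram determinant of the columns of `M`. -/
def gd (M : Matrix m ι ℝ) : ℝ := (Mᵀ * M).det

lemma posSemidef_tmul (M : Matrix m ι ℝ) : (Mᵀ * M).PosSemidef := by
  simpa [conjTranspose_eq_transpose_of_trivial] using posSemidef_conjTranspose_mul_self M

lemma gd_nonneg (M : Matrix m ι ℝ) : 0 ≤ gd M := (posSemidef_tmul M).det_nonneg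

lemma gd_mul (M : Matrix m ι ℝ) (U : Matrix ι ι ℝ) : gd (M * U) = U.det ^ 2 * gd M := by
  unfold gd
  rw [transpose_mul, Matrix.mul_assoc, ← Matrix.mul_assoc Mᵀ, det_mul, det_mul, det_transpose]
  ring

lemma gd_of_isEmpty [IsEmpty ι] (M : Matrix m ι ℝ) : gd M = 1 := by
  simp [gd]

lemma gd_square (M : Matrix ι ι ℝ) : gd M = M.det ^ 2 := by
  simp [gd, sq]

lemma gd_submatrix_col (M : Matrix m ι ℝ) (e : κ ≃ ι) : gd (M.submatrix id e) = gd M := by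
  unfold gd
  have : (M.submatrix id e)ᵀ * M.submatrix id e = (Mᵀ * M).submatrix e e := by
    ext i j; simp [mul_apply]
  rw [this, det_submatrix_equiv_self]

lemma gd_submatrix_row (M : Matrix m ι ℝ) (e : τ ≃ m) : gd (M.submatrix e id) = gd M := by
  unfold gd
  congr 1
  ext i j
  simp only [mul_apply, transpose_apply, submatrix_apply, id]
  exact e.sum_comp (fun x => M x i * M x j)

lemma gd_ne_zero_iff (M : Matrix m ι ℝ) : gd M ≠ 0 ↔ ∀ x, M *ᵥ x = 0 → x = 0 := by
  unfold gd
  rw [Ne, ← Matrix.exists_mulVec_eq_zero_iff]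
  constructor
  · intro h x hx
    by_contra hx0
    exact h ⟨x, hx0, by rw [← mulVec_mulVec, hx, mulVec_zero]⟩
  · rintro h ⟨x, hx0, hx⟩
    apply hx0
    apply h
    have : (M *ᵥ x) ⬝ᵥ (M *ᵥ x) = 0 := by
      rw [dotProduct_mulVec, ← mulVec_transpose, mulVec_mulVec, hx, zero_dotProduct]
    exact dotProduct_self_eq_zero.1 this

/-- Contraction principle for Gram determinants. -/
lemma gd_mul_le {c : ℝ} (T : Matrix τ m ℝ) (M : Matrix m ι ℝ)
    (hT : ∀ x, (T *ᵥ x) ⬝ᵥ (T *ᵥ x) ≤ c * (x ⬝ᵥ x)) :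
    gd (T * M) ≤ c ^ Fintype.card ι * gd M := by
  have hP : (c • (1 : Matrix m m ℝ) - Tᵀ * T).PosSemidef := by
    refine Matrix.PosSemidef.of_dotProduct_mulVec_nonneg ?_ ?_
    · refine Matrix.IsHermitian.sub ?_ (posSemidef_tmul T).1
      simp [Matrix.IsHermitian, conjTranspose_eq_transpose_of_trivial]
    · intro x
      have := hT x
      simp only [star_trivial, sub_mulVec, smul_mulVec, one_mulVec, dotProduct_sub, dotProduct_smul,
        smul_eq_mul]
      have e : x ⬝ᵥ (Tᵀ * T) *ᵥ x = (T *ᵥ x) ⬝ᵥ (T *ᵥ x) := by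
        rw [← mulVec_mulVec, dotProduct_mulVec, vecMul_transpose]
      rw [e]; linarith
  have h1 := hP.conjTranspose_mul_mul_same M
  have h2 := det_le_det_add (posSemidef_tmul (T * M)) h1
  have e : (T * M)ᵀ * (T * M) + Mᴴ * (c • (1 : Matrix m m ℝ) - Tᵀ * T) * M = c • (Mᵀ * M) := by
    rw [conjTranspose_eq_transpose_of_trivial, transpose_mul, Matrix.mul_sub, Matrix.sub_mul]
    simp only [Matrix.mul_assoc, Matrix.mul_smul, Matrix.smul_mul, Matrix.one_mul]
    abel
  rw [e, det_smul] at h2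
  exact h2

/-- Orthogonal projection of the columns of `C` away from the columns of `A`. -/
def prj (A : Matrix m ι ℝ) : Matrix m m ℝ := 1 - A * (Aᵀ * A)⁻¹ * Aᵀ

lemma prj_transpose (A : Matrix m ι ℝ) : (prj A)ᵀ = prj A := by
  simp [prj, transpose_nonsing_inv, Matrix.mul_assoc]

lemma prj_idem {A : Matrix m ι ℝ} (hA : gd A ≠ 0) : prj A * prj A = prj A := by
  have h : (Aᵀ * A)⁻¹ * (Aᵀ * A) = 1 := Matrix.nonsing_inv_mul _ (isUnit_iff_ne_zero.2 hA)
  have h2 : (A * (Aᵀ * A)⁻¹ * Aᵀ) * (A * (Aᵀ * A)⁻¹ * Aᵀ) = A * (Aᵀ * A)⁻¹ * Aᵀ := by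
    calc _ = A * ((Aᵀ * A)⁻¹ * (Aᵀ * A)) * (Aᵀ * A)⁻¹ * Aᵀ := by simp only [Matrix.mul_assoc]
      _ = _ := by rw [h, Matrix.mul_one]
  unfold prj
  rw [Matrix.sub_mul, Matrix.mul_sub, Matrix.mul_sub, h2]
  simp

lemma prj_contr {A : Matrix m ι ℝ} (hA : gd A ≠ 0) (x : m → ℝ) :
    (prj A *ᵥ x) ⬝ᵥ (prj A *ᵥ x) ≤ 1 * (x ⬝ᵥ x) := by
  have h1 : (prj A *ᵥ x) ⬝ᵥ (prj A *ᵥ x) = x ⬝ᵥ (prj A *ᵥ x) := by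
    conv_lhs => rw [dotProduct_mulVec, ← mulVec_transpose, prj_transpose, mulVec_mulVec, prj_idem hA]
    exact dotProduct_comm _ _
  have h2 : 0 ≤ (x - prj A *ᵥ x) ⬝ᵥ (x - prj A *ᵥ x) := by simpa using dotProduct_star_self_nonneg (x - prj A *ᵥ x)
  rw [sub_dotProduct, dotProduct_sub, dotProduct_sub, dotProduct_comm (prj A *ᵥ x) x, ← h1] at h2
  linarith

lemma gd_fromCols {A : Matrix m ι ℝ} (hA : gd A ≠ 0) (C : Matrix m κ ℝ) :
    gd (fromCols A C) = gd A * gd (prj A * C) := by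
  have hi : Invertible (Aᵀ * A) := Matrix.invertibleOfIsUnitDet _ (isUnit_iff_ne_zero.2 hA)
  have e : (prj A * C)ᵀ * (prj A * C) = Cᵀ * C - Cᵀ * A * ⅟(Aᵀ * A) * (Aᵀ * C) := by
    rw [transpose_mul, prj_transpose, Matrix.mul_assoc, ← Matrix.mul_assoc (prj A), prj_idem hA,
      prj, Matrix.sub_mul, Matrix.mul_sub, invOf_eq_nonsing_inv]
    simp only [Matrix.mul_assoc, Matrix.one_mul]
  unfold gd
  rw [e, ← det_fromBlocks₁₁]
  congr 1
  rw [transpose_fromCols, fromRows_mul_fromCols]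

lemma gd_fromCols_le {A : Matrix m ι ℝ} (hA : gd A ≠ 0) (C : Matrix m κ ℝ) :
    gd (fromCols A C) ≤ gd A * gd C := by
  rw [gd_fromCols hA]
  have := gd_mul_le (prj A) C (prj_contr hA)
  rw [one_pow, one_mul] at this
  exact mul_le_mul_of_nonneg_left this (gd_nonneg _)

lemma gd_submodular {A : Matrix m ι ℝ} {B : Matrix m κ ℝ} {C : Matrix m τ ℝ}
    (hAB : gd (fromCols A B) ≠ 0) :
    gd (fromCols A (fromCols B C)) * gd A ≤ gd (fromCols A B) * gd (fromCols A C) := by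
  have hA : gd A ≠ 0 := by
    rw [gd_ne_zero_iff] at hAB ⊢
    intro x hx
    have := hAB (Sum.elim x 0) (by rw [fromCols_mulVec]; simp [hx])
    ext i; simpa using congrFun this (Sum.inl i)
  have hB : gd (prj A * B) ≠ 0 := by
    intro h; rw [gd_fromCols hA, h] at hAB; simp at hAB
  rw [gd_fromCols hA, gd_fromCols hA, gd_fromCols hA, mul_fromCols]
  have := gd_fromCols_le hB (prj A * C)
  nlinarith [mul_nonneg (gd_nonneg A) (gd_nonneg A), mul_le_mul_of_nonneg_left this (mul_nonneg (gd_nonneg A) (gd_nonneg A))]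

end gram

section minors
variable {m ι κ τ : Type*} [Fintype m] [Fintype ι] [Fintype κ] [Fintype τ]
  [DecidableEq ι] [DecidableEq κ] [DecidableEq m] [DecidableEq τ]

/-- Minors of `W` indexed by arbitrary maps of column indices to row indices. -/
def minor (W : Matrix m ι ℝ) (I : ι → m) : ℝ := (W.submatrix I id).det

lemma gd_eq_sum_prod_mul_minor (W : Matrix m ι ℝ) :
    gd W = ∑ I : ι → m, (∏ a, W (I a) a) * minor W I := by
  have h : (Wᵀ * W) = fun a => ∑ i, W i a • W i := by
    ext a b; simp [mul_apply, Finset.sum_apply]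
  unfold gd
  rw [h]
  change (detRowAlternating (R := ℝ) (n := ι)).toMultilinearMap _ = _
  rw [MultilinearMap.map_sum]
  refine Finset.sum_congr rfl fun I _ => ?_
  rw [MultilinearMap.map_smul_univ]
  rfl

lemma minor_comp_perm (W : Matrix m ι ℝ) (I : ι → m) (σ : Equiv.Perm ι) :
    minor W (I ∘ σ) = Equiv.Perm.sign σ * minor W I := by
  unfold minor
  rw [← det_permute σ (W.submatrix I id)]; rfl

/-- Cauchy–Binet in symmetrized form. -/
lemma factorial_mul_gd (W : Matrix m ι ℝ) :
    (Fintype.card ι).factorial * gd W = ∑ I : ι → m, minor W I ^ 2 := by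
  have h1 : ∀ σ : Equiv.Perm ι, gd W =
      ∑ I : ι → m, (Equiv.Perm.sign σ * ∏ a, W (I (σ a)) a) * minor W I := by
    intro σ
    rw [gd_eq_sum_prod_mul_minor, ← (Equiv.arrowCongr σ.symm (Equiv.refl m)).sum_comp]
    refine Finset.sum_congr rfl fun I _ => ?_
    have : (Equiv.arrowCongr σ.symm (Equiv.refl m)) I = I ∘ σ := by
      ext a; simp [Equiv.arrowCongr]
    rw [this, minor_comp_perm]; simp only [Function.comp]; ring
  have h2 : ∑ σ : Equiv.Perm ι, gd W = (Fintype.card ι).factorial * gd W := by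
    rw [Finset.sum_const, Finset.card_univ, Fintype.card_perm]; simp
  rw [← h2, Finset.sum_congr rfl fun σ _ => h1 σ, Finset.sum_comm]
  refine Finset.sum_congr rfl fun I _ => ?_
  rw [← Finset.sum_mul, sq]
  congr 1
  unfold minor
  rw [det_apply']; rfl

/-- The matrix `diag(e^t)`. -/
def ed (t : m → ℝ) : Matrix m m ℝ := diagonal fun i => Real.exp (t i)

lemma ed_add (t s : m → ℝ) : ed (t + s) = ed t * ed s := by
  simp [ed, diagonal_mul_diagonal, Real.exp_add]

lemma det_ed (t : m → ℝ) : (ed t).det = Real.exp (∑ i, t i) := by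
  simp [ed, det_diagonal, Real.exp_sum]

lemma minor_ed (t : m → ℝ) (W : Matrix m ι ℝ) (I : ι → m) :
    minor (ed t * W) I = Real.exp (∑ a, t (I a)) * minor W I := by
  unfold minor
  have : (ed t * W).submatrix I id = diagonal (fun a => Real.exp (t (I a))) * W.submatrix I id := by
    ext a b; simp [ed]
  rw [this, det_mul, det_diagonal, Real.exp_sum]

lemma ed_mulVec_le {t : m → ℝ} {c : ℝ} (h : ∀ i, t i ≤ c) (x : m → ℝ) :
    (ed t *ᵥ x) ⬝ᵥ (ed t *ᵥ x) ≤ Real.exp (2 * c) * (x ⬝ᵥ x) := by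
  simp only [ed, mulVec_diagonal, dotProduct, Finset.mul_sum]
  refine Finset.sum_le_sum fun i _ => ?_
  have h1 : Real.exp (t i) ^ 2 ≤ Real.exp (2 * c) := by
    rw [← Real.exp_nat_mul]; apply Real.exp_le_exp.2; push_cast; linarith [h i]
  nlinarith [mul_self_nonneg (x i)]

lemma gd_ed_le {t : m → ℝ} {c : ℝ} (h : ∀ i, t i ≤ c) (W : Matrix m ι ℝ) :
    gd (ed t * W) ≤ Real.exp (2 * c * Fintype.card ι) * gd W := by
  refine (gd_mul_le _ W (ed_mulVec_le h)).trans_eq ?_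
  rw [← Real.exp_nat_mul]; ring_nf

/-- Block triangular estimate. -/
lemma gd_fromBlocks_ge {P : Matrix m ι ℝ} (hP : gd P ≠ 0) (Q : Matrix m κ ℝ) (R : Matrix τ κ ℝ) :
    gd P * gd R ≤ gd (fromBlocks P Q 0 R) := by
  have e0 : (fromBlocks P Q 0 R) = fromCols (fromRows P (0 : Matrix τ ι ℝ)) (fromRows Q R) := by
    ext i j; rcases i with i | i <;> rcases j with j | j <;> rfl
  have hg : (fromRows P (0 : Matrix τ ι ℝ))ᵀ * (fromRows P (0 : Matrix τ ι ℝ)) = Pᵀ * P := by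
    rw [transpose_fromRows, fromCols_mul_fromRows]; simp
  have hgd : gd (fromRows P (0 : Matrix τ ι ℝ)) = gd P := by unfold gd; rw [hg]
  rw [e0, gd_fromCols (by rw [hgd]; exact hP), hgd]
  refine mul_le_mul_of_nonneg_left ?_ (gd_nonneg P)
  have h2 : prj (fromRows P (0 : Matrix τ ι ℝ)) * fromRows Q R = fromRows (prj P * Q) R := by
    unfold prj
    rw [hg, Matrix.sub_mul, Matrix.sub_mul, Matrix.one_mul, Matrix.one_mul, transpose_fromRows,
      Matrix.mul_assoc, fromCols_mul_fromRows, fromRows_mul, fromRows_mul]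
    ext i j; rcases i with i | i <;> simp [Matrix.mul_assoc]
  rw [h2]
  have h3 : gd (fromRows (prj P * Q) R) = (Rᵀ * R + (prj P * Q)ᵀ * (prj P * Q)).det := by
    unfold gd; rw [transpose_fromRows, fromCols_mul_fromRows, add_comm]
  rw [h3]
  exact det_le_det_add (posSemidef_tmul R) (posSemidef_tmul _)

/-! ### Integer matrices -/

/-- An integer matrix viewed as a real matrix. -/
def zr (M : Matrix m ι ℤ) : Matrix m ι ℝ := M.map (Int.cast : ℤ → ℝ)

lemma zr_mul (M : Matrix m ι ℤ) (N : Matrix ι κ ℤ) : zr (M * N) = zr M * zr N :=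
  Matrix.map_mul (f := Int.castRingHom ℝ)

lemma zr_mulVec (M : Matrix m ι ℤ) (x : ι → ℤ) :
    zr M *ᵥ (fun i => (x i : ℝ)) = fun i => (((M *ᵥ x) i : ℤ) : ℝ) := by
  ext i; simp [zr, mulVec, dotProduct]

lemma zr_det (M : Matrix ι ι ℤ) : (zr M).det = (M.det : ℝ) :=
  ((Int.castRingHom ℝ).map_det M).symm

lemma zr_fromCols (M : Matrix m ι ℤ) (N : Matrix m κ ℤ) :
    zr (fromCols M N) = fromCols (zr M) (zr N) := by
  ext i j; rcases j with j | j <;> rfl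

/-- Columns are linearly independent over `ℤ`. -/
def ZInj (M : Matrix m ι ℤ) : Prop := ∀ x : ι → ℤ, M *ᵥ x = 0 → x = 0

lemma ZInj.gd_ne_zero {M : Matrix m ι ℤ} (h : ZInj M) : gd (zr M) ≠ 0 := by
  intro h0
  have h1 : (Mᵀ * M).det = 0 := by
    have : gd (zr M) = (((Mᵀ * M).det : ℤ) : ℝ) := by
      unfold gd; rw [← zr_det, zr_mul]; rfl
    rw [this] at h0; exact_mod_cast h0
  obtain ⟨x, hx0, hx⟩ := Matrix.exists_mulVec_eq_zero_iff.2 h1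
  apply hx0; apply h
  have : (M *ᵥ x) ⬝ᵥ (M *ᵥ x) = 0 := by
    rw [dotProduct_mulVec, ← mulVec_transpose, mulVec_mulVec, hx, zero_dotProduct]
  exact dotProduct_self_eq_zero.1 this

lemma gd_mul_left_ne_zero {g : Matrix m m ℝ} (hg : g.det ≠ 0) {M : Matrix m ι ℝ} :
    gd (g * M) ≠ 0 ↔ gd M ≠ 0 := by
  have hinj : ∀ x, g *ᵥ x = 0 → x = 0 := by
    intro x hx
    by_contra h; exact hg (Matrix.exists_mulVec_eq_zero_iff.1 ⟨x, h, hx⟩)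
  rw [gd_ne_zero_iff, gd_ne_zero_iff]
  refine ⟨fun h x hx => h x (by rw [← mulVec_mulVec, hx, mulVec_zero]), fun h x hx => h x ?_⟩
  rw [← mulVec_mulVec] at hx
  exact hinj _ hx

lemma gd_index_le {g : Matrix m τ ℝ} {W : Matrix τ ι ℤ} {X : Matrix ι ι ℤ}
    (h : gd (g * zr (W * X)) ≠ 0) : gd (g * zr W) ≤ gd (g * zr (W * X)) := by
  rw [zr_mul, ← Matrix.mul_assoc, gd_mul, zr_det] at h ⊢
  have h1 : X.det ≠ 0 := by intro h1; simp [h1] at h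
  have h2 : (1 : ℝ) ≤ (X.det : ℝ) ^ 2 := by
    have h3 : (1 : ℤ) ≤ X.det ^ 2 := by
      have := sq_pos_of_ne_zero h1; linarith
    exact_mod_cast h3
  nlinarith [gd_nonneg (g * zr W)]

/-- Saturated (primitive) sublattice. -/
def IsSat (P : Submodule ℤ (m → ℤ)) : Prop := ∀ (c : ℤ) (x : m → ℤ), c ≠ 0 → c • x ∈ P → x ∈ P

lemma of_coe_mulVec {P : Submodule ℤ (m → ℤ)} (v : ι → P) (y : ι → ℤ) :
    (Matrix.of fun i s => (v s : m → ℤ) i) *ᵥ y = ((∑ s, y s • v s : P) : m → ℤ) := by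
  rw [AddSubmonoidClass.coe_finsetSum]
  ext i
  rw [Finset.sum_apply]
  exact Finset.sum_congr rfl fun s _ => mul_comm _ _

/-- Adapted bases. -/
lemma exists_adapted_basis {P Q : Submodule ℤ (m → ℤ)} (hPQ : P ≤ Q)
    (hs : ∀ (c : ℤ) (x : m → ℤ), c ≠ 0 → x ∈ Q → c • x ∈ P → x ∈ P) :
    ∃ (p q : ℕ) (a : Matrix m (Fin p) ℤ) (b : Matrix m (Fin q) ℤ),
      ZInj (fromCols a b) ∧ (∀ x, x ∈ P ↔ ∃ y, a *ᵥ y = x) ∧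
      (∀ x, x ∈ Q ↔ ∃ y, fromCols a b *ᵥ y = x) := by
  classical
  let P' : Submodule ℤ Q := P.comap Q.subtype
  have : Module.IsTorsionFree ℤ (Q ⧸ P') := by
    refine Module.IsTorsionFree.of_smul_eq_zero fun c x h => ?_
    obtain ⟨x, rfl⟩ := Submodule.Quotient.mk_surjective P' x
    by_cases hc : c = 0
    · exact Or.inl hc
    · right
      rw [← Submodule.Quotient.mk_smul, Submodule.Quotient.mk_eq_zero] at h
      rw [Submodule.Quotient.mk_eq_zero]
      exact hs c x hc x.2 h
  let bP := Module.finBasis ℤ P'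
  let bQ := Module.finBasis ℤ (Q ⧸ P')
  obtain ⟨B, hB⟩ : ∃ B : Module.Basis (Fin _ ⊕ Fin _) ℤ Q, ∀ s, B (Sum.inl s) = (bP s : Q) :=
    ⟨Module.Basis.sumQuot bP bQ, fun s => Module.Basis.sumQuot_inl bP bQ s⟩
  have key : ∀ y, fromCols (Matrix.of fun i s => (B (Sum.inl s) : m → ℤ) i)
      (Matrix.of fun i s => (B (Sum.inr s) : m → ℤ) i) *ᵥ y = ((∑ s, y s • B s : Q) : m → ℤ) := by
    intro y
    rw [← of_coe_mulVec]
    congr 1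
    ext i s; rcases s with s | s <;> rfl
  have keyP : ∀ y, (Matrix.of fun i s => (B (Sum.inl s) : m → ℤ) i) *ᵥ y =
      ((∑ s, y s • bP s : P') : Q) := by
    intro y
    rw [of_coe_mulVec (fun s => B (Sum.inl s))]
    congr 1
    simp only [hB]
    rw [AddSubmonoidClass.coe_finsetSum]; rfl
  refine ⟨_, _, Matrix.of fun i s => (B (Sum.inl s) : m → ℤ) i,
    Matrix.of fun i s => (B (Sum.inr s) : m → ℤ) i, ?_, ?_, ?_⟩
  rotate_left 1
  · intro x
    constructor
    · intro hx
      exact ⟨bP.repr ⟨⟨x, hPQ hx⟩, hx⟩, by rw [keyP, bP.sum_repr]⟩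
    · rintro ⟨y, rfl⟩
      rw [keyP]
      exact (∑ s, y s • bP s : P').2
  · intro x
    constructor
    · intro hx
      exact ⟨B.repr ⟨x, hx⟩, by rw [key, B.sum_repr]⟩
    · rintro ⟨y, rfl⟩
      rw [key]
      exact (∑ s, y s • B s : Q).2
  · intro x hx
    rw [key] at hx
    have h1 : ∑ s, x s • B s = 0 := Subtype.ext hx
    ext s
    exact Fintype.linearIndependent_iff.1 B.linearIndependent x h1 s

end minors

section red
variable {F : Type*} [NormedAddCommGroup F] [NormedSpace ℝ F] [FiniteDimensional ℝ F]

/-- Finitely many points in each ball. -/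
def FinBalls (Λ : AddSubgroup F) : Prop := ∀ R : ℝ, {z | z ∈ Λ ∧ ‖z‖ ≤ R}.Finite

lemma FinBalls.exists_shortest {Λ : AddSubgroup F} (h : FinBalls Λ) (h0 : ∃ z ∈ Λ, z ≠ 0) :
    ∃ w ∈ Λ, w ≠ 0 ∧ ∀ z ∈ Λ, z ≠ 0 → ‖w‖ ≤ ‖z‖ := by
  obtain ⟨z0, hz0, hz0'⟩ := h0
  have hf : {z | (z ∈ Λ ∧ ‖z‖ ≤ ‖z0‖) ∧ z ≠ 0}.Finite := (h ‖z0‖).subset fun z hz => hz.1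
  obtain ⟨w, hw, hmin⟩ := hf.exists_minimalFor (fun z => ‖z‖) _ ⟨z0, ⟨hz0, le_rfl⟩, hz0'⟩
  refine ⟨w, hw.1.1, hw.2, fun z hz hz' => ?_⟩
  by_contra hlt
  push Not at hlt
  exact hlt.not_ge (hmin (j := z) ⟨⟨hz, hlt.le.trans hw.1.2⟩, hz'⟩ hlt.le)

/-- The reduced-basis data attached to a family of supporting functionals `f`. -/
structure IsRed (f : F → F →ₗ[ℝ] ℝ) (Λ : AddSubgroup F) {k : ℕ} (w v : Fin k → F)
    (u : Matrix (Fin k) (Fin k) ℝ) : Prop where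
  gen : AddSubgroup.closure (Set.range w) = Λ
  ne : ∀ i, v i ≠ 0
  mem : ∀ i, v i ∈ Submodule.span ℝ (Λ : Set F)
  eq : ∀ j, w j = ∑ i, u i j • v i
  diag : ∀ i, u i i = 1
  low : ∀ i j, j < i → u i j = 0
  half : ∀ i j, i < j → |u i j| ≤ 1 / 2
  orth : ∀ i j, i < j → f (v i) (v j) = 0
  min : ∀ (j : Fin k) (x : Fin k → ℤ), (∃ i, j ≤ i ∧ x i ≠ 0) →
    ‖v j‖ ≤ ‖∑ i, if j ≤ i then (∑ l, u i l * x l) • v i else 0‖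

/-- Projection along `w` defined by the functional `φ`. -/
def prl (φ : F →ₗ[ℝ] ℝ) (w : F) : F →ₗ[ℝ] F := LinearMap.id - φ.smulRight w

lemma prl_apply (φ : F →ₗ[ℝ] ℝ) (w z : F) : prl φ w z = z - φ z • w := rfl

theorem exists_isRed (f : F → F →ₗ[ℝ] ℝ) (hf1 : ∀ w, w ≠ 0 → f w w = 1)
    (d : ℕ) : ∀ Λ : AddSubgroup F, FinBalls Λ →
      Module.finrank ℝ (Submodule.span ℝ (Λ : Set F)) ≤ d →
      ∃ (k : ℕ) (w v : Fin k → F) (u : Matrix (Fin k) (Fin k) ℝ), IsRed f Λ w v u := by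
  induction d with
  | zero =>
    intro Λ _ hd
    refine ⟨0, Fin.elim0, Fin.elim0, 0, ?_, by simp, by simp, by simp, by simp, by simp, by simp,
      by simp, by simp⟩
    have h0 : Submodule.span ℝ (Λ : Set F) = ⊥ := by
      rw [← Submodule.finrank_eq_zero (R := ℝ)]; omega
    rw [Submodule.span_eq_bot] at h0
    simp only [Set.range_eq_empty, AddSubgroup.closure_empty]
    exact ((AddSubgroup.eq_bot_iff_forall Λ).2 h0).symm
  | succ d ih =>
    intro Λ hΛ hd
    by_cases hbot : ∃ z ∈ Λ, z ≠ 0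
    swap
    · push Not at hbot
      refine ⟨0, Fin.elim0, Fin.elim0, 0, ?_, by simp, by simp, by simp, by simp, by simp, by simp,
        by simp, by simp⟩
      simp only [Set.range_eq_empty, AddSubgroup.closure_empty]
      exact ((AddSubgroup.eq_bot_iff_forall Λ).2 hbot).symm
    obtain ⟨w1, hw1, hw1', hmin⟩ := hΛ.exists_shortest hbot
    set φ := f w1 with hφ
    have hφ1 : φ w1 = 1 := hf1 _ hw1'
    set π := prl φ w1 with hπ
    have hπw : π w1 = 0 := by rw [hπ, prl_apply, hφ1, one_smul, sub_self]
    have hφπ : ∀ z, φ (π z) = 0 := by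
      intro z; rw [hπ, prl_apply, map_sub, map_smul, hφ1]; simp
    set Λ' := Λ.map π.toAddMonoidHom with hΛ'
    have hlift : ∀ p ∈ Λ', ∃ z ∈ Λ, ∃ c : ℝ, |c| ≤ 1 / 2 ∧ z = c • w1 + p := by
      rintro p ⟨z, hz, rfl⟩
      refine ⟨z - round (φ z) • w1, Λ.sub_mem hz (Λ.zsmul_mem hw1 _), φ z - round (φ z),
        abs_sub_round _, ?_⟩
      change _ = _ + π z
      rw [hπ, prl_apply, sub_smul, ← Int.cast_smul_eq_zsmul ℝ]; abel
    have hΛ'ker : ∀ p ∈ Λ', φ p = 0 := by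
      rintro p ⟨z, _, rfl⟩; exact hφπ z
    have hker : ∀ p, φ p = 0 → π p = p := by
      intro p hp; rw [hπ, prl_apply, hp, zero_smul, sub_zero]
    have hfin' : FinBalls Λ' := by
      intro R
      refine ((hΛ (1 / 2 * ‖w1‖ + R)).image π).subset ?_
      rintro p ⟨hp, hpR⟩
      obtain ⟨z, hz, c, hc, rfl⟩ := hlift p hp
      refine ⟨_, ⟨hz, ?_⟩, ?_⟩
      · refine (norm_add_le _ _).trans (add_le_add ?_ hpR)
        rw [norm_smul, Real.norm_eq_abs]; gcongr
      · rw [map_add, map_smul, hπw, smul_zero, zero_add, hker _ (hΛ'ker p hp)]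
    have hspan : Submodule.span ℝ (Λ' : Set F) = (Submodule.span ℝ (Λ : Set F)).map π := by
      rw [Submodule.map_span]; rfl
    have hrank : Module.finrank ℝ (Submodule.span ℝ (Λ' : Set F)) ≤ d := by
      rw [hspan]
      set S := Submodule.span ℝ (Λ : Set F) with hS
      have h1 := LinearMap.finrank_range_add_finrank_ker (π.domRestrict S)
      have h2 : 0 < Module.finrank ℝ (LinearMap.ker (π.domRestrict S)) := by
        rw [Module.finrank_pos_iff_exists_ne_zero]
        refine ⟨⟨⟨w1, Submodule.subset_span hw1⟩, ?_⟩, ?_⟩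
        · simpa using hπw
        · intro h; apply hw1'
          exact congrArg (fun z : LinearMap.ker (π.domRestrict S) => ((z : S) : F)) h
      rw [LinearMap.range_domRestrict] at h1
      omega
    have hsub : Submodule.span ℝ (Λ' : Set F) ≤ Submodule.span ℝ (Λ : Set F) := by
      rw [Submodule.span_le]
      rintro p ⟨z, hz, rfl⟩
      exact Submodule.sub_mem _ (Submodule.subset_span hz)
        (Submodule.smul_mem _ _ (Submodule.subset_span hw1))
    have hspanker : ∀ p ∈ Submodule.span ℝ (Λ' : Set F), φ p = 0 := by
      rw [hspan]; rintro p ⟨z, _, rfl⟩; exact hφπ z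
    obtain ⟨k, w', v', u', R⟩ := ih Λ' hfin' hrank
    have hw'mem : ∀ j, w' j ∈ Λ' := fun j => by
      rw [← R.gen]; exact AddSubgroup.subset_closure ⟨j, rfl⟩
    choose z hz c hc hzc using fun j => hlift (w' j) (hw'mem j)
    have hπz : ∀ j, π (z j) = w' j := by
      intro j
      rw [hzc, map_add, map_smul, hπw, smul_zero, zero_add, hker _ (hΛ'ker _ (hw'mem j))]
    set u : Matrix (Fin (k + 1)) (Fin (k + 1)) ℝ :=
      Matrix.of (Fin.cons (Fin.cons 1 c) fun i => Fin.cons 0 (u' i)) with hu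
    have u00 : u 0 0 = 1 := rfl
    have u0s : ∀ j, u 0 (Fin.succ j) = c j := fun j => rfl
    have us0 : ∀ i, u (Fin.succ i) 0 = 0 := fun i => rfl
    have uss : ∀ i j, u (Fin.succ i) (Fin.succ j) = u' i j := fun i j => rfl
    have heq : ∀ j, (Fin.cons w1 z : Fin (k + 1) → F) j =
        ∑ i, u i j • (Fin.cons w1 v' : Fin (k + 1) → F) i := by
      intro j
      rw [Fin.sum_univ_succ]
      refine Fin.cases ?_ (fun j => ?_) j
      · simp [u00, us0]
      · simp only [Fin.cons_succ, Fin.cons_zero, u0s, uss]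
        rw [hzc, R.eq j]
    have hgen : AddSubgroup.closure (Set.range (Fin.cons w1 z : Fin (k + 1) → F)) = Λ := by
      apply le_antisymm
      · rw [AddSubgroup.closure_le]
        rintro _ ⟨j, rfl⟩
        refine Fin.cases ?_ (fun j => ?_) j
        · exact hw1
        · exact hz j
      · intro y hy
        set C := AddSubgroup.closure (Set.range (Fin.cons w1 z : Fin (k + 1) → F)) with hC
        have hCle : C ≤ Λ := by
          rw [AddSubgroup.closure_le]
          rintro _ ⟨j, rfl⟩
          refine Fin.cases ?_ (fun j => ?_) j
          · exact hw1
          · exact hz j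
        have h1 : Λ' ≤ C.map π.toAddMonoidHom := by
          rw [← R.gen, AddSubgroup.closure_le]
          rintro _ ⟨j, rfl⟩
          exact ⟨z j, AddSubgroup.subset_closure ⟨Fin.succ j, rfl⟩, hπz j⟩
        obtain ⟨y', hy', hyy⟩ := h1 (show π y ∈ Λ' from ⟨y, hy, rfl⟩)
        have hyy' : π y' = π y := hyy
        have h2 : y - y' ∈ Λ := Λ.sub_mem hy (hCle hy')
        have h3 : y - y' = φ (y - y') • w1 := by
          have : π (y - y') = 0 := by rw [map_sub, hyy', sub_self]
          rw [hπ, prl_apply, sub_eq_zero] at this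
          exact this
        have h4 : φ (y - y') = round (φ (y - y')) := by
          by_contra hne
          have h5 : (φ (y - y') - round (φ (y - y'))) • w1 ∈ Λ := by
            rw [sub_smul, ← h3, Int.cast_smul_eq_zsmul]
            exact Λ.sub_mem h2 (Λ.zsmul_mem hw1 _)
          have h6 := hmin _ h5 (smul_ne_zero (sub_ne_zero.2 hne) hw1')
          rw [norm_smul, Real.norm_eq_abs] at h6
          have h7 := abs_sub_round (φ (y - y'))
          have h8 : 0 < ‖w1‖ := norm_pos_iff.2 hw1'
          nlinarith
        have h9 : y - y' ∈ C := by
          rw [h3, h4, Int.cast_smul_eq_zsmul]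
          exact C.zsmul_mem (AddSubgroup.subset_closure ⟨0, rfl⟩) _
        have := C.add_mem h9 hy'
        rwa [sub_add_cancel] at this
    have hshift : ∀ (x : Fin (k + 1) → ℤ) (i : Fin k),
        ∑ l, u (Fin.succ i) l * (x l : ℝ) = ∑ l, u' i l * (x (Fin.succ l) : ℝ) := by
      intro x i
      rw [Fin.sum_univ_succ, us0, zero_mul, zero_add]; rfl
    refine ⟨k + 1, Fin.cons w1 z, Fin.cons w1 v', u,
      ⟨hgen, ?_, ?_, heq, ?_, ?_, ?_, ?_, ?_⟩⟩
    · intro i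
      refine Fin.cases ?_ (fun i => ?_) i
      · exact hw1'
      · exact R.ne i
    · intro i
      refine Fin.cases ?_ (fun i => ?_) i
      · exact Submodule.subset_span hw1
      · exact hsub (R.mem i)
    · intro i
      refine Fin.cases ?_ (fun i => ?_) i
      · exact u00
      · exact R.diag i
    · intro i j
      refine Fin.cases ?_ (fun i => ?_) i
      · intro h; exact absurd h (Fin.not_lt_zero j)
      · refine Fin.cases ?_ (fun j => ?_) j
        · intro _; exact us0 i
        · intro h; exact R.low i j (Fin.succ_lt_succ_iff.1 h)
    · intro i j
      refine Fin.cases ?_ (fun j => ?_) j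
      · intro h; exact absurd h (Fin.not_lt_zero i)
      · refine Fin.cases ?_ (fun i => ?_) i
        · intro _; exact hc j
        · intro h; exact R.half i j (Fin.succ_lt_succ_iff.1 h)
    · intro i j
      refine Fin.cases ?_ (fun j => ?_) j
      · intro h; exact absurd h (Fin.not_lt_zero i)
      · refine Fin.cases ?_ (fun i => ?_) i
        · intro _; exact hspanker _ (R.mem j)
        · intro h; exact R.orth i j (Fin.succ_lt_succ_iff.1 h)
    · intro j x
      refine Fin.cases ?_ (fun j => ?_) j
      · rintro ⟨i, _, hi⟩
        have e : (∑ i, if (0 : Fin (k + 1)) ≤ i then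
            (∑ l, u i l * (x l : ℝ)) • (Fin.cons w1 v' : Fin (k + 1) → F) i else 0) =
            ∑ l, x l • (Fin.cons w1 z : Fin (k + 1) → F) l := by
          simp only [Fin.zero_le, if_true, Finset.sum_smul]
          rw [Finset.sum_comm]
          refine Finset.sum_congr rfl fun l _ => ?_
          rw [heq l, Finset.smul_sum]
          refine Finset.sum_congr rfl fun i _ => ?_
          rw [← Int.cast_smul_eq_zsmul ℝ, smul_smul, mul_comm]
        rw [e]
        apply hmin
        · have hmemΛ : ∀ l, (Fin.cons w1 z : Fin (k + 1) → F) l ∈ Λ := fun l => by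
            refine Fin.cases ?_ (fun l => ?_) l
            · exact hw1
            · exact hz l
          exact AddSubgroup.sum_mem _ fun l _ => AddSubgroup.zsmul_mem _ (hmemΛ l) _
        · intro h0
          by_cases hx : ∃ l, x (Fin.succ l) ≠ 0
          · obtain ⟨l, hl⟩ := hx
            have hk : 0 < k := l.pos
            have h2 := R.min ⟨0, hk⟩ (fun l => x (Fin.succ l)) ⟨l, Nat.zero_le _, hl⟩
            have h3 : π (∑ l, x l • (Fin.cons w1 z : Fin (k + 1) → F) l) =
                ∑ i, (∑ l, u' i l * (x (Fin.succ l) : ℝ)) • v' i := by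
              rw [Fin.sum_univ_succ, map_add, map_zsmul, map_sum]
              simp only [Fin.cons_zero, Fin.cons_succ, hπw, smul_zero, zero_add, map_zsmul, hπz,
                Finset.sum_smul]
              rw [Finset.sum_comm]
              refine Finset.sum_congr rfl fun l _ => ?_
              rw [R.eq l, Finset.smul_sum]
              refine Finset.sum_congr rfl fun i _ => ?_
              rw [← Int.cast_smul_eq_zsmul ℝ, smul_smul, mul_comm]
            rw [h0, map_zero] at h3
            have h4 : ∀ i : Fin k, (⟨0, hk⟩ : Fin k) ≤ i := fun i => Nat.zero_le _
            simp only [h4, if_true] at h2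
            rw [← h3, norm_zero] at h2
            exact R.ne _ (norm_le_zero_iff.1 h2)
          · push Not at hx
            rw [Fin.sum_univ_succ] at h0
            simp only [hx, zero_smul, Finset.sum_const_zero, add_zero, Fin.cons_zero] at h0
            have hx0 : x 0 ≠ 0 := by
              revert hi
              refine Fin.cases ?_ (fun i => ?_) i
              · exact id
              · intro h; exact absurd (hx i) h
            rw [← Int.cast_smul_eq_zsmul ℝ] at h0
            exact (smul_ne_zero (Int.cast_ne_zero.2 hx0) hw1') h0
      · rintro ⟨i, hji, hi⟩
        have hi' : ∃ i', j ≤ i' ∧ x (Fin.succ i') ≠ 0 := by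
          revert hji hi
          refine Fin.cases ?_ (fun i => ?_) i
          · intro h; exact absurd h (by simp)
          · intro h h'; exact ⟨i, Fin.succ_le_succ_iff.1 h, h'⟩
        have := R.min j (fun l => x (Fin.succ l)) hi'
        rw [Fin.sum_univ_succ]
        simp only [Fin.cons_succ, hshift, Fin.succ_le_succ_iff]
        rw [if_neg (by simp), zero_add]
        exact this

end red

variable {m : Type*} [Fintype m] [DecidableEq m]

lemma zr_one {κ : Type*} [Fintype κ] [DecidableEq κ] : zr (1 : Matrix κ κ ℤ) = 1 := by
  ext i j; simp [zr, Matrix.one_apply]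

section
variable {F : Type*} [NormedAddCommGroup F] [NormedSpace ℝ F] [FiniteDimensional ℝ F]

/-- The lattice generated by the columns of `Y`, transported along `L`. -/
def colLat {k : ℕ} (L : F ≃ₗ[ℝ] (m → ℝ)) (Y : Matrix m (Fin k) ℝ) : AddSubgroup F :=
  ((L.symm.toLinearMap ∘ₗ Y.mulVecLin).toAddMonoidHom.comp
    ((Int.castAddHom ℝ).compLeft (Fin k))).range

lemma mem_colLat {k : ℕ} (L : F ≃ₗ[ℝ] (m → ℝ)) (Y : Matrix m (Fin k) ℝ) (z : F) :
    z ∈ colLat L Y ↔ ∃ x : Fin k → ℤ, L z = Y *ᵥ (fun i => (x i : ℝ)) := by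
  constructor
  · rintro ⟨x, rfl⟩
    refine ⟨x, ?_⟩
    change L (L.symm (Y *ᵥ _)) = _
    rw [L.apply_symm_apply]; rfl
  · rintro ⟨x, hx⟩
    refine ⟨x, ?_⟩
    change L.symm (Y *ᵥ fun i => (x i : ℝ)) = z
    rw [← hx, L.symm_apply_apply]

lemma finBalls_colLat {k : ℕ} (L : F ≃ₗ[ℝ] (m → ℝ)) (Y : Matrix m (Fin k) ℝ) (h : gd Y ≠ 0) :
    FinBalls (colLat L Y) := by
  intro R
  have hinj : LinearMap.ker (L.symm.toLinearMap ∘ₗ Y.mulVecLin) = ⊥ := by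
    rw [LinearMap.ker_eq_bot']
    intro x hx
    apply (gd_ne_zero_iff Y).1 h
    simpa using hx
  obtain ⟨K, hK, hA⟩ := LinearMap.exists_antilipschitzWith _ hinj
  have hfin : (Set.Icc (fun _ => -⌈(K : ℝ) * R⌉) (fun _ => ⌈(K : ℝ) * R⌉) :
      Set (Fin k → ℤ)).Finite := Set.finite_Icc _ _
  refine (hfin.image (fun x => L.symm (Y *ᵥ fun i => (x i : ℝ)))).subset ?_
  rintro z ⟨hz, hzR⟩
  obtain ⟨x, hx⟩ := (mem_colLat L Y z).1 hz
  have hz' : L.symm (Y *ᵥ fun i => (x i : ℝ)) = z := by rw [← hx, L.symm_apply_apply]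
  refine ⟨x, ?_, hz'⟩
  have h1 : ‖(fun i => (x i : ℝ))‖ ≤ K * R := by
    have := hA.le_mul_dist (fun i => (x i : ℝ)) 0
    rw [dist_zero_right, map_zero, dist_zero_right] at this
    refine this.trans ?_
    gcongr
    change ‖L.symm (Y *ᵥ fun i => (x i : ℝ))‖ ≤ R
    rw [hz']; exact hzR
  have h2 : ∀ i, |(x i : ℝ)| ≤ K * R := fun i => (norm_le_pi_norm (fun i => (x i : ℝ)) i).trans h1
  constructor
  · intro i
    have := (abs_le.1 ((h2 i).trans (Int.le_ceil _))).1
    exact_mod_cast this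
  · intro i
    have := (abs_le.1 ((h2 i).trans (Int.le_ceil _))).2
    exact_mod_cast this

lemma IsRed.sum_eq {f : F → F →ₗ[ℝ] ℝ} {Λ : AddSubgroup F} {k : ℕ} {w v : Fin k → F}
    {u : Matrix (Fin k) (Fin k) ℝ} (R : IsRed f Λ w v u) (x : Fin k → ℤ) :
    ∑ l, (x l : ℝ) • w l = ∑ i, (∑ l, u i l * (x l : ℝ)) • v i := by
  simp only [Finset.sum_smul]
  rw [Finset.sum_comm]
  refine Finset.sum_congr rfl fun l _ => ?_
  rw [R.eq l, Finset.smul_sum]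
  refine Finset.sum_congr rfl fun i _ => ?_
  rw [smul_smul, mul_comm]

theorem exists_red_matrix {k : ℕ} (L : F ≃ₗ[ℝ] (m → ℝ)) (Y : Matrix m (Fin k) ℝ) (h : gd Y ≠ 0)
    (f : F → F →ₗ[ℝ] ℝ) (hf1 : ∀ w, w ≠ 0 → f w w = 1) :
    ∃ (U U' : Matrix (Fin k) (Fin k) ℤ) (w v : Fin k → F) (u : Matrix (Fin k) (Fin k) ℝ),
      U * U' = 1 ∧ U' * U = 1 ∧ Y * zr U = Matrix.of (fun i j => L (v j) i) * u ∧
      IsRed f (colLat L Y) w v u := by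
  obtain ⟨k', w, v, u, R⟩ := exists_isRed f hf1 _ (colLat L Y) (finBalls_colLat L Y h) le_rfl
  have hw : ∀ j, w j ∈ colLat L Y := fun j => by
    rw [← R.gen]; exact AddSubgroup.subset_closure ⟨j, rfl⟩
  choose x hx using fun j => (mem_colLat L Y (w j)).1 (hw j)
  set U : Matrix (Fin k) (Fin k') ℤ := Matrix.of fun i j => x j i with hU
  set W : Matrix m (Fin k') ℝ := Matrix.of fun i j => L (w j) i with hW
  have hWU : Y * zr U = W := by
    ext i j
    rw [hW, Matrix.of_apply, hx j]; rfl
  have hWx : ∀ y : Fin k' → ℝ, W *ᵥ y = L (∑ l, y l • w l) := by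
    intro y
    ext i
    simp [Matrix.mulVec, dotProduct, hW, mul_comm]
  have hYw : ∀ a : Fin k, ∃ y : Fin k' → ℤ, Y *ᵥ (Pi.single a 1) = W *ᵥ (fun i => (y i : ℝ)) := by
    intro a
    have h1 : L.symm (Y *ᵥ (Pi.single a 1)) ∈ AddSubgroup.closure (Set.range w) := by
      rw [R.gen, mem_colLat]
      refine ⟨Pi.single a 1, ?_⟩
      rw [L.apply_symm_apply]
      congr 1
      ext i
      by_cases hi : i = a
      · subst hi; simp
      · simp [hi]
    rw [← Submodule.span_int_eq_addSubgroupClosure] at h1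
    obtain ⟨y, hy⟩ := (Submodule.mem_span_range_iff_exists_fun ℤ).1 h1
    refine ⟨y, ?_⟩
    rw [hWx]
    simp only [Int.cast_smul_eq_zsmul]
    rw [hy, L.apply_symm_apply]
  choose y hy using hYw
  set U' : Matrix (Fin k') (Fin k) ℤ := Matrix.of fun i j => y j i with hU'
  have hYU : W * zr U' = Y := by
    ext i j
    have := congrFun (hy j) i
    rw [Matrix.mulVec_single_one] at this
    exact this.symm
  have hWinj : ∀ y : Fin k' → ℤ, W *ᵥ (fun i => (y i : ℝ)) = 0 → y = 0 := by
    intro y hy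
    by_contra hne
    obtain ⟨l, hl⟩ := Function.ne_iff.1 hne
    have hk : 0 < k' := l.pos
    have h2 := R.min ⟨0, hk⟩ y ⟨l, Nat.zero_le _, hl⟩
    have h4 : ∀ i : Fin k', (⟨0, hk⟩ : Fin k') ≤ i := fun i => Nat.zero_le _
    simp only [h4, if_true] at h2
    rw [hWx, L.map_eq_zero_iff, R.sum_eq] at hy
    rw [hy, norm_zero] at h2
    exact R.ne _ (norm_le_zero_iff.1 h2)
  have hUU' : U * U' = 1 := by
    have h1 : Y * zr (U * U' - 1) = 0 := by
      have : zr (U * U' - 1) = zr U * zr U' - 1 := by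
        rw [← zr_mul, ← zr_one]; ext i j; simp [zr, Matrix.sub_apply, Matrix.one_apply]
      rw [this, Matrix.mul_sub, ← Matrix.mul_assoc, hWU, hYU, Matrix.mul_one, sub_self]
    have h2 : zr (U * U' - 1) = 0 := by
      ext i j
      have := (gd_ne_zero_iff Y).1 h (fun i => zr (U * U' - 1) i j)
        (by ext i'; exact congrFun (congrFun h1 i') j)
      exact congrFun this i
    rw [← sub_eq_zero]
    ext i j
    have := congrFun (congrFun h2 i) j
    simpa only [zr, Matrix.map_apply, Int.cast_eq_zero, Matrix.zero_apply] using this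
  have hU'U : U' * U = 1 := by
    have h1 : W * zr (U' * U - 1) = 0 := by
      have : zr (U' * U - 1) = zr U' * zr U - 1 := by
        rw [← zr_mul, ← zr_one]; ext i j; simp [zr, Matrix.sub_apply, Matrix.one_apply]
      rw [this, Matrix.mul_sub, ← Matrix.mul_assoc, hYU, hWU, Matrix.mul_one, sub_self]
    rw [← sub_eq_zero]
    ext i j
    have := hWinj (fun i => (U' * U - 1 : Matrix (Fin k') (Fin k') ℤ) i j) (by ext i'; exact congrFun (congrFun h1 i') j)
    exact congrFun this i
  have hk : k' = k := by
    have := Matrix.square_of_invertible U U' hUU' hU'U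
    simpa using this.symm
  subst hk
  refine ⟨U, U', w, v, u, hUU', hU'U, ?_, R⟩
  rw [hWU]
  ext i j
  rw [hW, Matrix.of_apply, R.eq j]
  simp [Matrix.mul_apply, mul_comm]

end

lemma two_thirds_le_of_reduced {y z a b c : ℝ} (ha : |a| ≤ 1 / 2) (hb : |b| ≤ 1 / 2) (hc : |c| ≤ 1 / 2)
    (h1 : 1 ≤ a ^ 2 + y) (h2 : y ≤ c ^ 2 * y + z)
    (h3 : ∀ p q : ℤ, 1 ≤ (p + a * q + b) ^ 2 + (q + c) ^ 2 * y + z) : 2 / 3 ≤ z := by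
  by_contra hz
  push Not at hz
  have hfirst := h3 0 0
  obtain ⟨q, hq, hqc⟩ : ∃ q : ℤ, |(q : ℝ)| = 1 ∧ (q + c) ^ 2 = (1 - |c|) ^ 2 := by
    rcases le_total 0 c with h | h
    · exact ⟨-1, by simp, by rw [abs_of_nonneg h]; push_cast; ring⟩
    · exact ⟨1, by simp, by rw [abs_of_nonpos h]; push_cast; ring⟩
  obtain ⟨p, hp⟩ : ∃ p : ℤ, |p + a * q + b| ≤ 1 - |a| - |b| := by
    have haq : |a * q| = |a| := by rw [abs_mul, hq, mul_one]
    rw [← haq] at ha ⊢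
    generalize a * (q : ℝ) = e at ha
    rcases le_total 0 e with he | he <;> rcases le_total 0 b with hb' | hb' <;>
      simp only [abs_of_nonneg, abs_of_nonpos, he, hb'] at ha hb ⊢
    · exact ⟨-1, by rw [abs_le]; push_cast; constructor <;> linarith⟩
    · exact ⟨0, by rw [abs_le]; push_cast; constructor <;> linarith⟩
    · exact ⟨0, by rw [abs_le]; push_cast; constructor <;> linarith⟩
    · exact ⟨1, by rw [abs_le]; push_cast; constructor <;> linarith⟩
  have hsec := h3 p q
  rw [hqc] at hsec
  have hD0 : 0 ≤ 1 - |a| - |b| := by linarith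
  have hD : (p + a * q + b) ^ 2 ≤ (1 - |a| - |b|) ^ 2 := by
    rw [← sq_abs]; gcongr
  push_cast at hfirst
  rw [← sq_abs a] at h1
  rw [← sq_abs c] at h2
  have hfirst' : 1 ≤ |b| ^ 2 + |c| ^ 2 * y + z := by
    rw [sq_abs, sq_abs]; nlinarith
  have ha0 := abs_nonneg a
  have hb0 := abs_nonneg b
  have hc0 := abs_nonneg c
  generalize |a| = a at *
  generalize |b| = b at *
  generalize |c| = c at *
  clear hp hq hqc h3 hfirst
  have ha2 : a ^ 2 ≤ (1 / 2) ^ 2 := by gcongr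
  have hy : 3 / 4 ≤ y := by linarith
  have hc2 : c ^ 2 ≤ (1 / 2) ^ 2 := by gcongr
  have hy2 : y ≤ 8 / 9 := by
    have := mul_le_mul_of_nonneg_left hc2 (by linarith : 0 ≤ y)
    linarith
  have hc3 : 1 / 3 ≤ c := by
    by_contra h
    push Not at h
    have h9 : c ^ 2 ≤ (1 / 3) ^ 2 := by gcongr
    have := mul_le_mul_of_nonneg_left h9 (by linarith : 0 ≤ y)
    linarith
  have ha3 : 1 / 3 ≤ a := by
    by_contra h
    push Not at h
    have : a ^ 2 < (1 / 3) ^ 2 := by gcongr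
    linarith
  have hb3 : 1 / 3 ≤ b := by
    by_contra h
    push Not at h
    have : b ^ 2 < (1 / 3) ^ 2 := by gcongr
    have := mul_le_mul_of_nonneg_left hc2 (by linarith : 0 ≤ y)
    linarith
  have ha4 : a ≥ (a ^ 2 + 1 / 6) * (6 / 5) := by
    nlinarith [mul_nonneg (sub_nonneg.2 ha) (sub_nonneg.2 ha3)]
  have hb4 : b ≥ (b ^ 2 + 1 / 6) * (6 / 5) := by
    nlinarith [mul_nonneg (sub_nonneg.2 hb) (sub_nonneg.2 hb3)]
  have hD2 : (1 - a - b) ^ 2 ≤ (1 - a - b) / 3 := by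
    rw [sq, div_eq_mul_inv]
    exact mul_le_mul_of_nonneg_left (by linarith) hD0
  have hcc : (2 * c - 1) * (3 * c - 1) ≤ 0 :=
    mul_nonpos_of_nonpos_of_nonneg (by linarith) (by linarith)
  have hP : (1 - c) ^ 2 + 2 / 5 * (1 + c ^ 2) ≤ 1 - c ^ 2 := by linarith
  have hyP := mul_le_mul_of_nonneg_left hP (by linarith : 0 ≤ y)
  linarith

variable {m : Type*} [Fintype m] [DecidableEq m]

lemma exists_coord_norm {w : m → ℝ} (hw : w ≠ 0) : ∃ i, |w i| = ‖w‖ := by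
  obtain ⟨i0, _⟩ := Function.ne_iff.1 hw
  have : Nonempty m := ⟨i0⟩
  obtain ⟨i, hi⟩ := Finite.exists_max fun i => |w i|
  refine ⟨i, le_antisymm (norm_le_pi_norm w i) ?_⟩
  exact (pi_norm_le_iff_of_nonneg (abs_nonneg _)).2 hi

lemma exists_sup_functional : ∃ f : (m → ℝ) → (m → ℝ) →ₗ[ℝ] ℝ, ∀ w, w ≠ 0 →
    f w w = 1 ∧ ∃ i, |w i| = ‖w‖ ∧ ∀ z, f w z = 0 → z i = 0 := by
  have : ∀ w : m → ℝ, ∃ φ : (m → ℝ) →ₗ[ℝ] ℝ, w ≠ 0 →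
      φ w = 1 ∧ ∃ i, |w i| = ‖w‖ ∧ ∀ z, φ z = 0 → z i = 0 := by
    intro w
    by_cases hw : w = 0
    · exact ⟨0, fun h => absurd hw h⟩
    obtain ⟨i, hi⟩ := exists_coord_norm hw
    have hwi : w i ≠ 0 := by
      rw [← abs_pos, hi]; exact norm_pos_iff.2 hw
    refine ⟨(w i)⁻¹ • LinearMap.proj i, fun _ => ⟨?_, i, hi, fun z hz => ?_⟩⟩
    · simp [hwi]
    · simpa [hwi] using hz
  choose f hf using this
  exact ⟨f, fun w hw => hf w hw⟩

/-- Data of a sup-norm reduced basis. -/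
structure IsSupRed {k : ℕ} (V : Matrix m (Fin k) ℝ) (u : Matrix (Fin k) (Fin k) ℝ)
    (σ : Fin k → m) : Prop where
  diag : ∀ i, u i i = 1
  low : ∀ i j, j < i → u i j = 0
  half : ∀ i j, i < j → |u i j| ≤ 1 / 2
  piv : ∀ i j, i < j → V (σ i) j = 0
  max : ∀ i j, |V i j| ≤ |V (σ j) j|
  ne : ∀ j, V (σ j) j ≠ 0
  min : ∀ (x : Fin k → ℤ) (j : Fin k), (∃ i, x i ≠ 0) → (j : ℕ) = 0 → ∃ i,
    |V (σ j) j| ≤ |((V * u) *ᵥ fun i => (x i : ℝ)) i|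
  step : ∀ i j : Fin k, (j : ℕ) = i + 1 → |V (σ i) i| ≤ 2 * |V (σ j) j|

theorem exists_sup_red {k : ℕ} (Y : Matrix m (Fin k) ℝ) (h : gd Y ≠ 0) :
    ∃ (U U' : Matrix (Fin k) (Fin k) ℤ) (V : Matrix m (Fin k) ℝ) (u : Matrix (Fin k) (Fin k) ℝ)
      (σ : Fin k → m), U * U' = 1 ∧ U' * U = 1 ∧ Y * zr U = V * u ∧ IsSupRed V u σ := by
  obtain ⟨f, hf⟩ := exists_sup_functional (m := m)
  obtain ⟨U, U', w, v, u, h1, h2, h3, R⟩ :=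
    exists_red_matrix (LinearEquiv.refl ℝ (m → ℝ)) Y h f fun w hw => (hf w hw).1
  choose σ hσ hσ0 using fun j => (hf (v j) (R.ne j)).2
  set V : Matrix m (Fin k) ℝ := Matrix.of fun i j => v j i with hV
  refine ⟨U, U', V, u, σ, h1, h2, h3, ⟨R.diag, R.low, R.half, ?_, ?_, ?_, ?_, ?_⟩⟩
  · intro i j hij; exact hσ0 i _ (R.orth i j hij)
  · intro i j
    change |v j i| ≤ |v j (σ j)|
    rw [hσ j]; exact norm_le_pi_norm (v j) i
  · intro j
    change v j (σ j) ≠ 0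
    rw [← abs_pos, hσ j]; exact norm_pos_iff.2 (R.ne j)
  · rintro x j ⟨i, hi⟩ hj0
    have h4 : ∀ i : Fin k, j ≤ i := fun i => by rw [Fin.le_def, hj0]; exact Nat.zero_le _
    have h5 := R.min j x ⟨i, h4 i, hi⟩
    simp only [h4, if_true] at h5
    have h6 : ∑ i, (∑ l, u i l * (x l : ℝ)) • v i = (V * u) *ᵥ fun i => (x i : ℝ) := by
      rw [← Matrix.mulVec_mulVec]
      ext i
      simp [Matrix.mulVec, dotProduct, hV, mul_comm]
    rw [h6] at h5
    have h7 : ((V * u) *ᵥ fun i => (x i : ℝ)) ≠ 0 := by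
      intro h0
      rw [h0, norm_zero] at h5
      exact R.ne _ (norm_le_zero_iff.1 h5)
    obtain ⟨i', hi'⟩ := exists_coord_norm h7
    refine ⟨i', ?_⟩
    rw [hi']
    change |v j (σ j)| ≤ _
    rw [hσ j]; exact h5
  · intro i j hij
    have hlt : i < j := by rw [Fin.lt_def]; omega
    have h5 := R.min i (Pi.single j 1) ⟨j, hlt.le, by simp⟩
    have h6 : (∑ i', if i ≤ i' then (∑ l, u i' l * ((Pi.single j 1 : Fin k → ℤ) l : ℝ)) • v i'
        else 0) = u i j • v i + v j := by
      have h7 : ∀ i', ∑ l, u i' l * ((Pi.single j 1 : Fin k → ℤ) l : ℝ) = u i' j := by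
        intro i'
        rw [Finset.sum_eq_single j]
        · simp
        · intro b _ hb; simp [hb]
        · simp
      simp only [h7]
      rw [Finset.sum_eq_add i j hlt.ne]
      · simp [hlt.le, R.diag]
      · rintro c - ⟨hc1, hc2⟩
        split_ifs with hc
        · have h8 : j < c := by
            rw [Fin.le_def] at hc; rw [Fin.lt_def]
            have : (c : ℕ) ≠ i := fun h => hc1 (Fin.ext h)
            have : (c : ℕ) ≠ j := fun h => hc2 (Fin.ext h)
            omega
          rw [R.low _ _ h8, zero_smul]
        · rfl
      · simp
      · simp
    rw [h6] at h5
    change |v i (σ i)| ≤ 2 * |v j (σ j)|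
    rw [hσ i, hσ j]
    have h9 := norm_add_le (u i j • v i) (v j)
    rw [norm_smul, Real.norm_eq_abs] at h9
    have h10 := R.half i j hlt
    have := mul_le_mul_of_nonneg_right h10 (norm_nonneg (v i))
    linarith

/-- An upper triangular matrix reduced in the sense of Korkine and Zolotarev. -/
structure IsKZ {k : ℕ} (A : Fin k → ℝ) (R : Matrix (Fin k) (Fin k) ℝ) : Prop where
  nonneg : ∀ i, 0 ≤ A i
  diag : ∀ i, R i i = A i
  low : ∀ i j, j < i → R i j = 0
  half : ∀ i j, i < j → |R i j| ≤ A i / 2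
  min : ∀ (j : Fin k) (x : Fin k → ℤ), (∃ i, j ≤ i ∧ x i ≠ 0) →
    A j ^ 2 ≤ ∑ i, if j ≤ i then (R *ᵥ fun i => (x i : ℝ)) i ^ 2 else 0

theorem exists_kz {k : ℕ} (Y : Matrix m (Fin k) ℝ) (h : gd Y ≠ 0) :
    ∃ (U U' : Matrix (Fin k) (Fin k) ℤ) (Q : Matrix m (Fin k) ℝ) (A : Fin k → ℝ)
      (R : Matrix (Fin k) (Fin k) ℝ),
      U * U' = 1 ∧ U' * U = 1 ∧ Qᵀ * Q = 1 ∧ Y * zr U = Q * R ∧ (∀ i, 0 < A i) ∧ IsKZ A R := by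
  set f : EuclideanSpace ℝ m → EuclideanSpace ℝ m →ₗ[ℝ] ℝ :=
    fun w => (‖w‖ ^ 2)⁻¹ • innerₛₗ ℝ w with hf
  have hf1 : ∀ w, w ≠ 0 → f w w = 1 := by
    intro w hw
    simp only [hf, LinearMap.smul_apply, innerₛₗ_apply_apply, smul_eq_mul]
    rw [real_inner_self_eq_norm_sq]
    exact inv_mul_cancel₀ (pow_ne_zero 2 (norm_ne_zero_iff.2 hw))
  obtain ⟨U, U', w, v, u, h1, h2, h3, R⟩ :=
    exists_red_matrix (WithLp.linearEquiv 2 ℝ (m → ℝ)) Y h f hf1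
  have hlt : ∀ i j, i < j → inner ℝ (v i) (v j) = 0 := by
    intro i j hij
    have := R.orth i j hij
    simp only [hf, LinearMap.smul_apply, innerₛₗ_apply_apply, smul_eq_mul] at this
    rcases mul_eq_zero.1 this with h | h
    · exact absurd h (inv_ne_zero (pow_ne_zero 2 (norm_ne_zero_iff.2 (R.ne i))))
    · exact h
  have hne : ∀ i j, i ≠ j → inner ℝ (v i) (v j) = 0 := by
    intro i j hij
    rcases lt_or_gt_of_ne hij with h | h
    · exact hlt i j h
    · rw [real_inner_comm]; exact hlt j i h
  have hpos : ∀ i, 0 < ‖v i‖ := fun i => norm_pos_iff.2 (R.ne i)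
  have hpyth : ∀ c : Fin k → ℝ, ‖∑ i, c i • v i‖ ^ 2 = ∑ i, (c i * ‖v i‖) ^ 2 := by
    intro c
    rw [← real_inner_self_eq_norm_sq, sum_inner]
    refine Finset.sum_congr rfl fun i _ => ?_
    rw [inner_sum, Finset.sum_eq_single i]
    · rw [real_inner_smul_left, real_inner_smul_right, real_inner_self_eq_norm_sq]; ring
    · intro b _ hb
      rw [real_inner_smul_left, real_inner_smul_right, hne _ _ hb.symm]; simp
    · simp
  refine ⟨U, U', Matrix.of fun i j => ‖v j‖⁻¹ * v j i, fun i => ‖v i‖,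
    Matrix.of fun i j => ‖v i‖ * u i j, h1, h2, ?_, ?_, hpos, ⟨fun i => (hpos i).le, ?_, ?_, ?_, ?_⟩⟩
  · ext i j
    have hin : ∑ a, v i a * v j a = inner ℝ (v i) (v j) := by
      rw [PiLp.inner_apply]
      simp [mul_comm]
    simp only [Matrix.mul_apply, Matrix.transpose_apply, Matrix.of_apply]
    have : ∑ a, ‖v i‖⁻¹ * v i a * (‖v j‖⁻¹ * v j a) = ‖v i‖⁻¹ * ‖v j‖⁻¹ * inner ℝ (v i) (v j) := by
      rw [← hin, Finset.mul_sum]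
      exact Finset.sum_congr rfl fun a _ => by ring
    rw [this]
    by_cases hij : i = j
    · subst hij
      rw [real_inner_self_eq_norm_sq, Matrix.one_apply_eq]
      have := (hpos i).ne'
      field_simp
    · rw [hne _ _ hij, Matrix.one_apply_ne hij, mul_zero]
  · rw [h3]
    ext i j
    simp only [Matrix.mul_apply, Matrix.of_apply]
    refine Finset.sum_congr rfl fun l _ => ?_
    have := (hpos l).ne'
    change v l i * u l j = _
    field_simp
  · intro i; simp [R.diag]
  · intro i j hij; simp [R.low i j hij]
  · intro i j hij
    rw [Matrix.of_apply, abs_mul, abs_of_pos (hpos i)]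
    have := mul_le_mul_of_nonneg_left (R.half i j hij) (hpos i).le
    linarith
  · intro j x hx
    have h5 := R.min j x hx
    have h6 := pow_le_pow_left₀ (norm_nonneg _) h5 2
    have h7 : (∑ i, if j ≤ i then (∑ l, u i l * (x l : ℝ)) • v i else 0) =
        ∑ i, (if j ≤ i then (∑ l, u i l * (x l : ℝ)) else 0) • v i := by
      refine Finset.sum_congr rfl fun i _ => ?_
      split_ifs <;> simp
    rw [h7, hpyth] at h6
    refine h6.trans (le_of_eq (Finset.sum_congr rfl fun i _ => ?_))
    split_ifs
    · congr 1
      simp only [Matrix.mulVec, dotProduct, Matrix.of_apply]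
      rw [Finset.sum_mul]
      exact Finset.sum_congr rfl fun l _ => by ring
    · simp

variable {k : ℕ} {A : Fin k → ℝ} {R : Matrix (Fin k) (Fin k) ℝ}

lemma IsKZ.three_quarters (h : IsKZ A R) {i j : Fin k} (hij : (j : ℕ) = i + 1) :
    3 / 4 * A i ^ 2 ≤ A j ^ 2 := by
  have hlt : i < j := by rw [Fin.lt_def]; omega
  have h5 := h.min i (Pi.single j 1) ⟨j, hlt.le, by simp⟩
  have hv : ∀ l, (R *ᵥ fun i => ((Pi.single j 1 : Fin k → ℤ) i : ℝ)) l = R l j := by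
    intro l
    simp only [Matrix.mulVec, dotProduct]
    rw [Finset.sum_eq_single j]
    · simp
    · intro b _ hb; simp [hb]
    · simp
  simp only [hv] at h5
  rw [Finset.sum_eq_add i j hlt.ne] at h5
  · simp only [le_refl, if_true, hlt.le, h.diag] at h5
    have h6 := h.half i j hlt
    have h7 : R i j ^ 2 ≤ (A i / 2) ^ 2 := by rw [← sq_abs]; gcongr
    linarith
  · rintro c - ⟨hc1, hc2⟩
    split_ifs with hc
    · have h8 : j < c := by
        rw [Fin.le_def] at hc; rw [Fin.lt_def]
        have : (c : ℕ) ≠ i := fun h => hc1 (Fin.ext h)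
        have : (c : ℕ) ≠ j := fun h => hc2 (Fin.ext h)
        omega
      rw [h.low _ _ h8]; simp
    · rfl
  · simp
  · simp

lemma IsKZ.two_thirds (h : IsKZ A R) {i j l : Fin k} (hi : 0 < A i) (hj : 0 < A j)
    (hij : (j : ℕ) = i + 1) (hil : (l : ℕ) = i + 2) :
    2 / 3 * A i ^ 2 ≤ A l ^ 2 := by
  have hlij : i < j := by rw [Fin.lt_def]; omega
  have hljl : j < l := by rw [Fin.lt_def]; omega
  have hlil : i < l := hlij.trans hljl
  have hcomb : ∀ p q r : ℤ, ∀ s : Fin k,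
      (R *ᵥ fun t => ((Pi.single i p + Pi.single j q + Pi.single l r : Fin k → ℤ) t : ℝ)) s =
      R s i * p + R s j * q + R s l * r := by
    intro p q r s
    have : (fun t => ((Pi.single i p + Pi.single j q + Pi.single l r : Fin k → ℤ) t : ℝ)) =
        Pi.single i (p : ℝ) + Pi.single j (q : ℝ) + Pi.single l (r : ℝ) := by
      ext t
      simp only [Pi.add_apply, Int.cast_add]
      congr 1
      · congr 1
        · by_cases ht : t = i
          · subst ht; simp
          · simp [ht]
        · by_cases ht : t = j
          · subst ht; simp
          · simp [ht]
      · by_cases ht : t = l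
        · subst ht; simp
        · simp [ht]
    rw [this, Matrix.mulVec_add, Matrix.mulVec_add]
    simp
  have hx : ∀ p q r : ℤ, (Pi.single i p + Pi.single j q + Pi.single l r : Fin k → ℤ) l = r := by
    intro p q r; simp [hljl.ne', hlil.ne']
  have hxj : ∀ p q r : ℤ, (Pi.single i p + Pi.single j q + Pi.single l r : Fin k → ℤ) j = q := by
    intro p q r; simp [hljl.ne, hlij.ne']
  have hsum : ∀ F : Fin k → ℝ, (∀ s, l < s → F s = 0) →
      (∑ s, if i ≤ s then F s else 0) = F i + F j + F l := by
    intro F hF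
    have hval : ∀ s : Fin k, (if i ≤ s then F s else 0) =
        (if s = i then F i else 0) + (if s = j then F j else 0) + (if s = l then F l else 0) := by
      intro s
      by_cases h1 : s = i
      · subst h1; simp [hlij.ne, hlil.ne]
      by_cases h2 : s = j
      · subst h2; simp [hlij.le, hlij.ne', hljl.ne]
      by_cases h3 : s = l
      · subst h3; simp [hlil.le, hlil.ne', hljl.ne']
      simp only [h1, h2, h3, if_false, add_zero]
      split_ifs with h4
      · apply hF
        rw [Fin.le_def] at h4; rw [Fin.lt_def]
        have : (s : ℕ) ≠ i := fun h => h1 (Fin.ext h)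
        have : (s : ℕ) ≠ j := fun h => h2 (Fin.ext h)
        have : (s : ℕ) ≠ l := fun h => h3 (Fin.ext h)
        omega
      · rfl
    simp [hval, Finset.sum_add_distrib]
  have hz : ∀ p q r : ℤ, ∀ s, l < s → (R s i * p + R s j * q + R s l * r) ^ 2 = 0 := by
    intro p q r s hs
    rw [h.low s i (hlil.trans hs), h.low s j (hljl.trans hs), h.low s l hs]; simp
  have hA := hi.ne'
  have hB := hj.ne'
  have key : 2 / 3 ≤ A l ^ 2 / A i ^ 2 := by
    refine two_thirds_le_of_reduced (y := A j ^ 2 / A i ^ 2) (a := R i j / A i) (b := R i l / A i)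
      (c := R j l / A j) ?_ ?_ ?_ ?_ ?_ ?_
    · rw [abs_div, abs_of_pos hi, div_le_iff₀ hi]; linarith [h.half i j hlij]
    · rw [abs_div, abs_of_pos hi, div_le_iff₀ hi]; linarith [h.half i l hlil]
    · rw [abs_div, abs_of_pos hj, div_le_iff₀ hj]; linarith [h.half j l hljl]
    · have h5 := h.min i (Pi.single i 0 + Pi.single j 1 + Pi.single l 0) ⟨j, hlij.le, by
        rw [hxj]; exact one_ne_zero⟩
      simp only [hcomb] at h5
      rw [hsum (fun s => _) (hz 0 1 0), h.diag, h.diag, h.low j i hlij, h.low l i hlil,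
        h.low l j hljl] at h5
      have : (1 : ℝ) = A i ^ 2 / A i ^ 2 := by field_simp
      rw [this, div_pow, ← add_div]
      gcongr
      push_cast at h5
      linarith
    · have h5 := h.min j (Pi.single i 0 + Pi.single j 0 + Pi.single l 1) ⟨l, hljl.le, by
        rw [hx]; exact one_ne_zero⟩
      simp only [hcomb] at h5
      have h6 : (∑ s, if j ≤ s then (R s i * (0 : ℤ) + R s j * (0 : ℤ) + R s l * (1 : ℤ)) ^ 2 else 0) ≤
          R j l ^ 2 + A l ^ 2 := by
        have h7 : ∀ s : Fin k, (if j ≤ s then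
            (R s i * (0 : ℤ) + R s j * (0 : ℤ) + R s l * (1 : ℤ)) ^ 2 else 0) =
            (if s = j then R j l ^ 2 else 0) + (if s = l then A l ^ 2 else 0) := by
          intro s
          by_cases h2 : s = j
          · subst h2; simp [hljl.ne]
          by_cases h3 : s = l
          · subst h3; simp [hljl.le, hljl.ne', h.diag]
          simp only [h2, h3, if_false, add_zero]
          split_ifs with h4
          · have h8 : l < s := by
              rw [Fin.le_def] at h4; rw [Fin.lt_def]
              have : (s : ℕ) ≠ j := fun h => h2 (Fin.ext h)
              have : (s : ℕ) ≠ l := fun h => h3 (Fin.ext h)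
              omega
            rw [h.low s l h8]; simp
          · rfl
        simp_rw [h7]
        simp [Finset.sum_add_distrib]
      have h8 := h5.trans h6
      rw [div_pow, show R j l ^ 2 / A j ^ 2 * (A j ^ 2 / A i ^ 2) = R j l ^ 2 / A i ^ 2 by
        field_simp, ← add_div]
      gcongr
    · intro p q
      have h5 := h.min i (Pi.single i p + Pi.single j q + Pi.single l 1) ⟨l, hlil.le, by
        rw [hx]; exact one_ne_zero⟩
      simp only [hcomb] at h5
      rw [hsum (fun s => _) (hz p q 1), h.diag, h.diag, h.diag, h.low j i hlij, h.low l i hlil,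
        h.low l j hljl] at h5
      push_cast at h5
      have e : (p + R i j / A i * q + R i l / A i) ^ 2 +
          (q + R j l / A j) ^ 2 * (A j ^ 2 / A i ^ 2) + A l ^ 2 / A i ^ 2 =
          ((A i * p + R i j * q + R i l) ^ 2 + (A j * q + R j l) ^ 2 + A l ^ 2) / A i ^ 2 := by
        field_simp
      rw [e, le_div_iff₀ (by positivity)]
      linarith
  rwa [le_div_iff₀ (by positivity)] at key

section topology
variable {E : Type*} [NormedAddCommGroup E] [NormedSpace ℝ E] [FiniteDimensional ℝ E]

open MeasureTheory in
lemma exists_smooth_of_lipschitz {g : E → ℝ} {K : NNReal} (hg : LipschitzWith K g)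
    (hb : ∀ x y, |g x - g y| ≤ 1) {r : ℝ} (hr : 0 < r) :
    ∃ l : E → ℝ, ContDiff ℝ 1 l ∧ (∀ x, ‖fderiv ℝ l x‖ ≤ K) ∧ (∀ x, |l x - g x| ≤ 1) ∧
      ∀ x, (∀ y ∈ Metric.ball x r, g y = g x) → l x = g x := by
  let _ : MeasurableSpace E := borel E
  have : BorelSpace E := ⟨rfl⟩
  let μ : Measure E := Measure.addHaar
  let φ : ContDiffBump (0 : E) := ⟨r / 2, r, by linarith, by linarith⟩
  set l : E → ℝ := convolution (φ.normed μ) g (ContinuousLinearMap.lsmul ℝ ℝ) μ with hl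
  have hφ : Integrable (φ.normed μ) μ :=
    φ.continuous_normed.integrable_of_hasCompactSupport φ.hasCompactSupport_normed
  have hex : ∀ x, Integrable (fun t => φ.normed μ t * g (x - t)) μ := by
    intro x
    refine Continuous.integrable_of_hasCompactSupport ?_ ?_
    · exact φ.continuous_normed.mul (hg.continuous.comp (by fun_prop))
    · exact φ.hasCompactSupport_normed.mul_right
  have hlx : ∀ x, l x = ∫ t, φ.normed μ t * g (x - t) ∂μ := fun x => rfl
  refine ⟨l, ?_, ?_, ?_, ?_⟩
  · exact φ.hasCompactSupport_normed.contDiff_convolution_left _ φ.contDiff_normed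
      hg.continuous.locallyIntegrable
  · intro x
    refine norm_fderiv_le_of_lipschitz ℝ (LipschitzWith.of_dist_le_mul fun x y => ?_)
    rw [Real.dist_eq, hlx, hlx, ← integral_sub (hex x) (hex y)]
    calc |∫ t, (φ.normed μ t * g (x - t) - φ.normed μ t * g (y - t)) ∂μ|
        ≤ ∫ t, φ.normed μ t * (K * dist x y) ∂μ := by
          rw [← Real.norm_eq_abs]
          refine norm_integral_le_of_norm_le (hφ.mul_const _) (ae_of_all μ fun t => ?_)
          rw [← mul_sub, Real.norm_eq_abs, abs_mul, abs_of_nonneg (φ.nonneg_normed t)]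
          refine mul_le_mul_of_nonneg_left ?_ (φ.nonneg_normed t)
          have := hg.dist_le_mul (x - t) (y - t)
          rwa [dist_sub_right, Real.dist_eq] at this
      _ = K * dist x y := by
          rw [integral_mul_const, φ.integral_normed, one_mul]
  · intro x
    exact φ.dist_normed_convolution_le hg.continuous.aestronglyMeasurable fun y _ => hb y x
  · intro x hx
    exact φ.normed_convolution_eq_right hx

/-- Bump functions of arbitrary sets with uniformly bounded derivative. -/
lemma exists_bump {δ : ℝ} (hδ : 0 < δ) : ∃ K : ℝ, 0 ≤ K ∧ ∀ F : Set E, ∃ l : E → ℝ,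
    ContDiff ℝ 1 l ∧ (∀ x, |l x| ≤ 2) ∧ (∀ x, ‖fderiv ℝ l x‖ ≤ K) ∧
    (∀ x ∈ F, ∀ᶠ y in 𝓝 x, l y = 1) ∧ ∀ x, (∀ y ∈ F, δ ≤ dist x y) → l x = 0 := by
  refine ⟨4 / δ, by positivity, fun F => ?_⟩
  rcases F.eq_empty_or_nonempty with rfl | hF
  · exact ⟨fun _ => 0, contDiff_const, by simp, by intro x; simp; positivity, by simp, by simp⟩
  set D : E → ℝ := fun x => Metric.infDist x F with hD
  set g : E → ℝ := fun x => max 0 (min 1 (3 - 4 / δ * D x)) with hg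
  have hg0 : ∀ x, 0 ≤ g x := fun x => le_max_left _ _
  have hg1 : ∀ x, g x ≤ 1 := fun x => max_le zero_le_one (min_le_left _ _)
  have hDl : ∀ x y, |D x - D y| ≤ dist x y := by
    intro x y
    have := (Metric.lipschitz_infDist_pt F).dist_le_mul x y
    rwa [NNReal.coe_one, one_mul, Real.dist_eq] at this
  have hlip : LipschitzWith ⟨4 / δ, by positivity⟩ g := by
    refine LipschitzWith.of_dist_le_mul fun x y => ?_
    rw [Real.dist_eq]
    calc |g x - g y| ≤ |min 1 (3 - 4 / δ * D x) - min 1 (3 - 4 / δ * D y)| := by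
          have := abs_max_sub_max_le_max (0 : ℝ) (min 1 (3 - 4 / δ * D x)) 0
            (min 1 (3 - 4 / δ * D y))
          simpa using this
      _ ≤ |(3 - 4 / δ * D x) - (3 - 4 / δ * D y)| := by
          have := abs_min_sub_min_le_max (1 : ℝ) (3 - 4 / δ * D x) 1 (3 - 4 / δ * D y)
          simpa using this
      _ = 4 / δ * |D x - D y| := by
          rw [show (3 - 4 / δ * D x) - (3 - 4 / δ * D y) = -(4 / δ * (D x - D y)) by ring, abs_neg,
            abs_mul, abs_of_pos (by positivity)]
      _ ≤ 4 / δ * dist x y := mul_le_mul_of_nonneg_left (hDl x y) (by positivity)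
  have hgD1 : ∀ x, D x ≤ δ / 2 → g x = 1 := by
    intro x hx
    have : 4 / δ * D x ≤ 4 / δ * (δ / 2) := mul_le_mul_of_nonneg_left hx (by positivity)
    have e : 4 / δ * (δ / 2) = 2 := by field_simp; norm_num
    simp only [hg]
    rw [min_eq_left (by linarith), max_eq_right zero_le_one]
  have hgD0 : ∀ x, δ * (3 / 4) ≤ D x → g x = 0 := by
    intro x hx
    have : 4 / δ * (δ * (3 / 4)) ≤ 4 / δ * D x := mul_le_mul_of_nonneg_left hx (by positivity)
    have e : 4 / δ * (δ * (3 / 4)) = 3 := by field_simp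
    simp only [hg]
    exact max_eq_left ((min_le_right _ _).trans (by linarith))
  obtain ⟨l, h1, h2, h3, h4⟩ := exists_smooth_of_lipschitz hlip
    (fun x y => abs_le.2 ⟨by linarith [hg0 x, hg1 y], by linarith [hg0 y, hg1 x]⟩)
    (r := δ / 4) (by linarith)
  refine ⟨l, h1, ?_, h2, ?_, ?_⟩
  · intro x
    have := abs_le.1 (h3 x)
    exact abs_le.2 ⟨by linarith [hg0 x], by linarith [hg1 x]⟩
  · intro x hx
    filter_upwards [Metric.ball_mem_nhds x (show 0 < δ / 4 by linarith)] with y hy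
    have hDx : D x = 0 := Metric.infDist_zero_of_mem hx
    have hDy := (abs_le.1 (hDl y x)).2
    rw [Metric.mem_ball] at hy
    rw [h4, hgD1 y (by linarith)]
    intro z hz
    rw [Metric.mem_ball] at hz
    have hDz := (abs_le.1 (hDl z y)).2
    rw [hgD1 y (by linarith), hgD1 z (by linarith)]
  · intro x hx
    have hDx : δ ≤ D x := by
      by_contra h
      push Not at h
      obtain ⟨y, hy, hxy⟩ := (Metric.infDist_lt_iff hF).1 h
      exact absurd (hx y hy) (not_le.2 hxy)
    rw [h4, hgD0 x (by linarith)]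
    intro z hz
    rw [Metric.mem_ball] at hz
    have hDz := (abs_le.1 (hDl z x)).1
    rw [hgD0 x (by linarith), hgD0 z (by linarith)]

end topology

section topology
variable {E : Type*} [NormedAddCommGroup E] [NormedSpace ℝ E] [FiniteDimensional ℝ E]

lemma exists_det_polynomial (A : E →L[ℝ] E) : ∃ p : Polynomial ℝ,
    p.natDegree ≤ Module.finrank ℝ E ∧ ∀ s : ℝ, p.eval s = (1 + s • A).det := by
  let b := Module.finBasis ℝ E
  let M := LinearMap.toMatrix b b (A : E →ₗ[ℝ] E)
  refine ⟨((Polynomial.X : Polynomial ℝ) • M.map Polynomial.C +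
    (1 : Matrix (Fin (Module.finrank ℝ E)) (Fin (Module.finrank ℝ E)) ℝ).map Polynomial.C).det,
    ?_, ?_⟩
  · have := Polynomial.natDegree_det_X_add_C_le M 1
    simpa using this
  · intro s
    rw [← Polynomial.coe_evalRingHom, RingHom.map_det, ContinuousLinearMap.det,
      ← LinearMap.det_toMatrix b]
    congr 1
    have : ((1 + s • A : E →L[ℝ] E) : E →ₗ[ℝ] E) = LinearMap.id + s • (A : E →ₗ[ℝ] E) := rfl
    have e2 : LinearMap.toMatrix b b (LinearMap.id + s • (A : E →ₗ[ℝ] E)) = 1 + s • M := by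
      rw [map_add, map_smul, LinearMap.toMatrix_id]
    rw [this, e2]
    ext i j
    simp only [RingHom.mapMatrix_apply, Matrix.map_apply, Matrix.add_apply, Matrix.smul_apply,
      Polynomial.coe_evalRingHom, Polynomial.eval_add, smul_eq_mul, Polynomial.eval_mul,
      Polynomial.eval_X, Polynomial.eval_C]
    rw [add_comm]

lemma exists_interpolation (d : ℕ) {s0 : ℝ} (hs : 0 < s0) :
    ∃ (v : ℕ → ℝ) (L : ℕ → ℝ), (∀ i ∈ Finset.range (d + 1), 0 ≤ v i ∧ v i ≤ s0) ∧
      ∀ p : Polynomial ℝ, p.natDegree ≤ d →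
        p.eval 1 = ∑ i ∈ Finset.range (d + 1), L i * p.eval (v i) := by
  set v : ℕ → ℝ := fun i => s0 * i / (d + 1) with hv
  have hinj : Set.InjOn v (Finset.range (d + 1)) := by
    intro i _ j _ hij
    have : s0 * (i : ℝ) = s0 * j := by
      have h1 : (d + 1 : ℝ) ≠ 0 := by positivity
      simpa [hv, div_left_inj' h1] using hij
    exact_mod_cast mul_left_cancel₀ hs.ne' this
  refine ⟨v, fun i => (Lagrange.basis (Finset.range (d + 1)) v i).eval 1, ?_, ?_⟩
  · intro i hi
    have : (i : ℝ) ≤ d + 1 := by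
      have := Finset.mem_range.1 hi
      exact_mod_cast this.le
    refine ⟨by positivity, ?_⟩
    simp only [hv]
    rw [div_le_iff₀ (by positivity)]
    gcongr
  · intro p hp
    have h1 : p.degree < (Finset.range (d + 1)).card := by
      rw [Finset.card_range]
      exact Polynomial.degree_le_natDegree.trans_lt (by exact_mod_cast Nat.lt_succ_of_le hp)
    have h2 := Lagrange.eq_interpolate hinj h1
    conv_lhs => rw [h2]
    rw [Lagrange.interpolate_apply, Polynomial.eval_finsetSum]
    refine Finset.sum_congr rfl fun i _ => ?_
    rw [Polynomial.eval_mul, Polynomial.eval_C, mul_comm]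

lemma exists_det_pos (E : Type*) [NormedAddCommGroup E] [NormedSpace ℝ E] [FiniteDimensional ℝ E] :
    ∃ η > 0, ∀ A : E →L[ℝ] E, ‖A‖ ≤ η → 0 < (1 + A).det := by
  have hc : Continuous fun A : E →L[ℝ] E => (1 + A).det :=
    ContinuousLinearMap.continuous_det.comp (by fun_prop)
  have h1 : (fun A : E →L[ℝ] E => (1 + A).det) 0 = 1 := by
    simp [ContinuousLinearMap.det]
  have h2 : ∀ᶠ A : E →L[ℝ] E in 𝓝 0, 0 < (1 + A).det := by
    have := hc.continuousAt (x := 0)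
    exact this.eventually (lt_mem_nhds (by rw [h1]; exact one_pos))
  obtain ⟨r, hr, h⟩ := Metric.eventually_nhds_iff_ball.1 h2
  exact ⟨r / 2, by linarith, fun A hA => h A (by
    rw [Metric.mem_ball, dist_zero_right]; linarith)⟩

lemma exists_det_bound (E : Type*) [NormedAddCommGroup E] [NormedSpace ℝ E] [FiniteDimensional ℝ E]
    (r : ℝ) : ∃ K : ℝ, 0 ≤ K ∧ ∀ A : E →L[ℝ] E, ‖A‖ ≤ r → |A.det| ≤ K := by
  have := (isCompact_closedBall (0 : E →L[ℝ] E) r).exists_bound_of_continuousOn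
    (ContinuousLinearMap.continuous_det.continuousOn)
  obtain ⟨K, hK⟩ := this
  refine ⟨max K 0, le_max_right _ _, fun A hA => ?_⟩
  exact (hK A (by simpa using hA)).trans (le_max_left _ _)

/-- A small compactly supported perturbation of the identity preserves balls. -/
lemma image_ball_perturb {h : E → E} {c : NNReal} (hc : c < 1) (hl : LipschitzWith c h)
    {r : ℝ} (h0 : ∀ x, r ≤ ‖x‖ → h x = 0) :
    Function.Injective (fun x => x + h x) ∧
      (fun x => x + h x) '' Metric.ball 0 r = Metric.ball 0 r := by
  have hinj : Function.Injective (fun x => x + h x) := by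
    intro x y hxy
    have h1 : x - y = h y - h x := by
      have : x + h x = y + h y := hxy
      rw [sub_eq_sub_iff_add_eq_add, this, add_comm]
    have h2 := hl.dist_le_mul y x
    rw [dist_eq_norm, dist_eq_norm, ← h1, norm_sub_rev y x] at h2
    have hc' : (c : ℝ) < 1 := by exact_mod_cast hc
    have h3 : ‖x - y‖ = 0 := by nlinarith [norm_nonneg (x - y)]
    rwa [norm_eq_zero, sub_eq_zero] at h3
  have hsurj : Function.Surjective (fun x => x + h x) := by
    intro y
    have hcon : ContractingWith c (fun x => y - h x) := by
      refine ⟨hc, LipschitzWith.of_dist_le_mul fun a b => ?_⟩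
      rw [dist_sub_left]; exact hl.dist_le_mul a b
    obtain ⟨x, hx, _⟩ := hcon.exists_fixedPoint y (edist_ne_top _ _)
    refine ⟨x, ?_⟩
    have : y - h x = x := hx
    change x + h x = y
    exact (sub_eq_iff_eq_add.1 this).symm
  refine ⟨hinj, Set.Subset.antisymm ?_ ?_⟩
  · rintro _ ⟨x, hx, rfl⟩
    by_contra hlt
    simp only [Metric.mem_ball, dist_zero_right, not_lt] at hx hlt
    have h1 : (x + h x) + h (x + h x) = x + h x := by rw [h0 _ hlt, add_zero]
    have h2 := hinj h1
    rw [h2] at hlt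
    exact absurd hx (not_lt.2 hlt)
  · intro y hy
    obtain ⟨x, rfl⟩ := hsurj y
    refine ⟨x, ?_, rfl⟩
    by_contra hlt
    simp only [Metric.mem_ball, dist_zero_right, not_lt] at hlt hy
    rw [h0 x hlt, add_zero] at hy
    linarith

open MeasureTheory in
lemma integral_det_ball [MeasurableSpace E] [BorelSpace E] (μ : Measure E) [μ.IsAddHaarMeasure]
    {h : E → E} (hd : ContDiff ℝ 1 h) {K r : ℝ} (hK : ∀ x, ‖fderiv ℝ h x‖ ≤ K)
    (h0 : ∀ x, r ≤ ‖x‖ → h x = 0) :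
    ∫ x in Metric.ball 0 r, (1 + fderiv ℝ h x).det ∂μ = μ.real (Metric.ball 0 r) := by
  have hK0 : 0 ≤ K := (norm_nonneg _).trans (hK 0)
  obtain ⟨η, hη, hdet⟩ := exists_det_pos E
  set s0 := min η (1 / 2) / (K + 1) with hs0
  have hs0pos : 0 < s0 := by positivity
  have hsK : ∀ s, 0 ≤ s → s ≤ s0 → s * K ≤ min η (1 / 2) := by
    intro s hs hs'
    calc s * K ≤ s0 * (K + 1) := by gcongr; linarith
      _ = _ := by rw [hs0]; field_simp
  have hdiff : Differentiable ℝ h := hd.differentiable one_ne_zero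
  have hsmall : ∀ s, 0 ≤ s → s ≤ s0 →
      ∫ x in Metric.ball 0 r, (1 + s • fderiv ℝ h x).det ∂μ = μ.real (Metric.ball 0 r) := by
    intro s hs hs'
    have hsK' := hsK s hs hs'
    have hlip : LipschitzWith (1 / 2 : NNReal) (s • h) := by
      refine lipschitzWith_of_nnnorm_fderiv_le (𝕜 := ℝ) (hdiff.const_smul s) fun x => ?_
      rw [← NNReal.coe_le_coe, coe_nnnorm, fderiv_const_smul (hdiff x), norm_smul, Real.norm_eq_abs,
        abs_of_nonneg hs]
      push_cast
      calc s * ‖fderiv ℝ h x‖ ≤ s * K := by gcongr; exact hK x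
        _ ≤ 1 / 2 := hsK'.trans (min_le_right _ _)
    obtain ⟨hinj, himg⟩ := image_ball_perturb (h := s • h) (c := 1 / 2)
      (by rw [← NNReal.coe_lt_coe]; norm_num) hlip (r := r)
      (fun x hx => by simp [h0 x hx])
    have hder : ∀ x ∈ Metric.ball (0 : E) r, HasFDerivWithinAt (fun x => x + (s • h) x)
        (1 + s • fderiv ℝ h x) (Metric.ball 0 r) x := by
      intro x _
      exact ((hasFDerivAt_id x).add ((hdiff x).hasFDerivAt.const_smul s)).hasFDerivWithinAt
    have key := integral_image_eq_integral_abs_det_fderiv_smul μ Metric.isOpen_ball.measurableSet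
      hder hinj.injOn (fun _ => (1 : ℝ))
    rw [himg] at key
    simp only [smul_eq_mul, mul_one, integral_const, measureReal_restrict_apply_univ] at key
    rw [key]
    refine integral_congr_ae (ae_of_all _ fun x => ?_)
    refine (abs_of_pos (hdet _ ?_)).symm
    rw [norm_smul, Real.norm_eq_abs, abs_of_nonneg hs]
    exact (mul_le_mul_of_nonneg_left (hK x) hs).trans (hsK'.trans (min_le_left _ _))
  obtain ⟨v, L, hv, hL⟩ := exists_interpolation (Module.finrank ℝ E) hs0pos
  choose p hp hpe using fun x => exists_det_polynomial (fderiv ℝ h x)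
  have hone : ∀ x, (1 + fderiv ℝ h x).det =
      ∑ i ∈ Finset.range (Module.finrank ℝ E + 1), L i * (1 + v i • fderiv ℝ h x).det := by
    intro x
    have := hL (p x) (hp x)
    simp only [hpe, one_smul] at this
    exact this
  have hsumL : ∑ i ∈ Finset.range (Module.finrank ℝ E + 1), L i = 1 := by
    have := hL 1 (by simp)
    simpa using this.symm
  have hint : ∀ s : ℝ, Integrable (fun x => (1 + s • fderiv ℝ h x).det)
      (μ.restrict (Metric.ball 0 r)) := by
    intro s
    have hcont : Continuous fun x => (1 + s • fderiv ℝ h x).det :=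
      ContinuousLinearMap.continuous_det.comp
        (continuous_const.add ((hd.continuous_fderiv one_ne_zero).const_smul s))
    exact (hcont.continuousOn.integrableOn_compact
      (isCompact_closedBall (0 : E) r)).mono_set Metric.ball_subset_closedBall
  simp only [hone]
  rw [integral_finsetSum _ fun i _ => (hint _).const_mul _]
  simp only [integral_const_mul]
  rw [Finset.sum_congr rfl fun i hi => by rw [hsmall _ (hv i hi).1 (hv i hi).2], ← Finset.sum_mul,
    hsumL, one_mul]

end topology

section topology
variable {E : Type*} [NormedAddCommGroup E] [NormedSpace ℝ E] [FiniteDimensional ℝ E]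

open MeasureTheory in
/-- A map at bounded distance from the identity cannot have degenerate derivative on a large ball. -/
lemma no_collapse [Nontrivial E] (C K : ℝ) : ∃ R > 0, ∀ G : E → E, ContDiff ℝ 1 G →
    (∀ x, ‖G x - x‖ ≤ C) → (∀ x, ‖fderiv ℝ G x‖ ≤ K) →
    ∃ x, ‖x‖ ≤ R ∧ (fderiv ℝ G x).det ≠ 0 := by
  obtain ⟨K1, hK1, hbump⟩ := exists_bump (E := E) one_pos
  set K2 := 2 * (K + 1) + K1 * C with hK2
  obtain ⟨K4, hK4, hdetb⟩ := exists_det_bound E (1 + K2)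
  set d := Module.finrank ℝ E with hd
  set R := K4 * d + 1 with hR
  have hRpos : 0 < R := by positivity
  refine ⟨R, hRpos, fun G hG hC hK => ?_⟩
  by_contra hcon
  push Not at hcon
  obtain ⟨l, hl1, hl2, hlK, hlF, hl0⟩ := hbump (Metric.closedBall 0 R)
  let _ : MeasurableSpace E := borel E
  have : BorelSpace E := ⟨rfl⟩
  let μ : Measure E := Measure.addHaar
  set h : E → E := fun x => l x • (G x - x) with hh
  have hGd : Differentiable ℝ G := hG.differentiable one_ne_zero
  have hld : Differentiable ℝ l := hl1.differentiable one_ne_zero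
  have hhd : ContDiff ℝ 1 h := hl1.smul (hG.sub contDiff_id)
  have hfd : ∀ x, HasFDerivAt (fun x => G x - x) (fderiv ℝ G x - 1) x := fun x =>
    (hGd x).hasFDerivAt.sub (hasFDerivAt_id x)
  have h1n : ‖(1 : E →L[ℝ] E)‖ ≤ 1 := ContinuousLinearMap.norm_id_le
  have hb : ∀ x, ‖fderiv ℝ h x‖ ≤ K2 := by
    intro x
    have hhx : HasFDerivAt h _ x := (hld x).hasFDerivAt.smul (hfd x)
    rw [hhx.fderiv]
    refine (norm_add_le _ _).trans ?_
    rw [norm_smul, ContinuousLinearMap.norm_smulRight_apply]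
    have e1 : ‖fderiv ℝ G x - 1‖ ≤ K + 1 :=
      (norm_sub_le _ _).trans (add_le_add (hK x) h1n)
    exact add_le_add (mul_le_mul (hl2 x) e1 (norm_nonneg _) zero_le_two)
      (mul_le_mul (hlK x) (hC x) (norm_nonneg _) hK1)
  have hz : ∀ x, R + 1 ≤ ‖x‖ → h x = 0 := by
    intro x hx
    have : l x = 0 := hl0 x fun y hy => by
      rw [Metric.mem_closedBall, dist_zero_right] at hy
      have := norm_sub_norm_le x y
      rw [dist_eq_norm]; linarith
    simp [hh, this]
  have key := integral_det_ball μ hhd hb hz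
  have hzero : ∀ x, ‖x‖ ≤ R → (1 + fderiv ℝ h x).det = 0 := by
    intro x hx
    have hev : h =ᶠ[𝓝 x] fun x => G x - x := by
      filter_upwards [hlF x (by simpa using hx)] with y hy
      simp [hh, hy]
    rw [hev.fderiv_eq, (hfd x).fderiv, add_sub_cancel]
    exact hcon x hx
  have hVr : ∀ r : ℝ, 0 ≤ r → μ.real (Metric.ball (0 : E) r) = r ^ d * μ.real (Metric.ball 0 1) := by
    intro r hr
    rw [measureReal_def, Measure.addHaar_ball μ 0 hr, ENNReal.toReal_mul,
      ENNReal.toReal_ofReal (by positivity), measureReal_def]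
  have hVc : μ.real (Metric.closedBall (0 : E) R) = R ^ d * μ.real (Metric.ball 0 1) := by
    rw [measureReal_def, Measure.addHaar_closedBall μ 0 hRpos.le, ENNReal.toReal_mul,
      ENNReal.toReal_ofReal (by positivity), measureReal_def]
  have hV1 : 0 < μ.real (Metric.ball (0 : E) 1) :=
    ENNReal.toReal_pos (Metric.measure_ball_pos μ 0 one_pos).ne' measure_ball_lt_top.ne
  have hsub : Metric.closedBall (0 : E) R ⊆ Metric.ball 0 (R + 1) :=
    Metric.closedBall_subset_ball (by linarith)
  have e1 : ∫ x in Metric.ball (0 : E) (R + 1), (1 + fderiv ℝ h x).det ∂μ =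
      ∫ x in Metric.ball (0 : E) (R + 1) \ Metric.closedBall 0 R, (1 + fderiv ℝ h x).det ∂μ := by
    refine setIntegral_eq_of_subset_of_forall_sdiff_eq_zero Metric.isOpen_ball.measurableSet
      Set.sdiff_subset fun x hx => hzero x ?_
    have := hx.2
    simp only [Set.mem_sdiff, not_and, not_not] at this
    simpa using this hx.1
  have e2 : ‖∫ x in Metric.ball (0 : E) (R + 1) \ Metric.closedBall 0 R,
      (1 + fderiv ℝ h x).det ∂μ‖ ≤
      K4 * μ.real (Metric.ball (0 : E) (R + 1) \ Metric.closedBall 0 R) := by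
    refine norm_setIntegral_le_of_norm_le_const
      ((measure_mono Set.sdiff_subset).trans_lt measure_ball_lt_top) fun x _ => ?_
    exact hdetb _ ((norm_add_le _ _).trans (add_le_add h1n (hb x)))
  rw [measureReal_sdiff hsub Metric.isClosed_closedBall.measurableSet
    measure_ball_lt_top.ne, ← e1, key, hVr _ (by linarith), hVc, Real.norm_eq_abs,
    abs_of_nonneg (by positivity)] at e2
  have e3 : (R + 1) ^ d ≤ K4 * ((R + 1) ^ d - R ^ d) := by
    have : (R + 1) ^ d * μ.real (Metric.ball (0 : E) 1) ≤
        (K4 * ((R + 1) ^ d - R ^ d)) * μ.real (Metric.ball (0 : E) 1) := by linarith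
    exact le_of_mul_le_mul_right this hV1
  have hR1 : 0 < R + 1 := by linarith
  have e4 : 1 - d * (1 / (R + 1)) ≤ (R / (R + 1)) ^ d := by
    have h3 : R / (R + 1) = 1 + (-(1 / (R + 1))) := by field_simp; ring
    rw [h3]
    have h4 : -2 ≤ -(1 / (R + 1)) := by
      have : 1 / (R + 1) ≤ 1 := by rw [div_le_one hR1]; linarith
      linarith
    have := one_add_mul_le_pow h4 d
    linarith
  rw [div_pow, le_div_iff₀ (by positivity)] at e4
  have e5 : (R + 1) ^ d - R ^ d ≤ d / (R + 1) * (R + 1) ^ d := by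
    have : (d : ℝ) / (R + 1) = d * (1 / (R + 1)) := by ring
    rw [this]; linarith
  have e6 : (R + 1) ^ d ≤ K4 * (d / (R + 1)) * (R + 1) ^ d :=
    e3.trans ((mul_le_mul_of_nonneg_left e5 hK4).trans_eq (by ring))
  have e7 : K4 * (d / (R + 1)) < 1 := by
    rw [← mul_div_assoc, div_lt_one hR1]; linarith
  have : 0 < (R + 1) ^ d := by positivity
  nlinarith

end topology

section topology
variable {E : Type*} [NormedAddCommGroup E] [NormedSpace ℝ E] [FiniteDimensional ℝ E]

/-- The rank of a continuous endomorphism. -/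
def crk (A : E →L[ℝ] E) : ℕ := Module.finrank ℝ (LinearMap.range (A : E →ₗ[ℝ] E))

lemma crk_comp_le_left (A B : E →L[ℝ] E) : crk (A.comp B) ≤ crk A :=
  Submodule.finrank_mono (by
    rintro _ ⟨x, rfl⟩
    exact ⟨B x, rfl⟩)

lemma crk_comp_add_smulRight_le (A B : E →L[ℝ] E) (f : E →L[ℝ] ℝ) (v : E) :
    crk (A.comp B + f.smulRight v) ≤ crk B + 1 := by
  have h1 : LinearMap.range ((A.comp B + f.smulRight v : E →L[ℝ] E) : E →ₗ[ℝ] E) ≤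
      (LinearMap.range (B : E →ₗ[ℝ] E)).map (A : E →ₗ[ℝ] E) ⊔ Submodule.span ℝ {v} := by
    rintro _ ⟨x, rfl⟩
    exact Submodule.add_mem_sup (s := A (B x)) (t := f x • v) ⟨B x, ⟨x, rfl⟩, rfl⟩
      (Submodule.smul_mem _ _ (Submodule.mem_span_singleton_self v))
  refine (Submodule.finrank_mono h1).trans ((Submodule.finrank_add_le_finrank_add_finrank _ _).trans
    (add_le_add (Submodule.finrank_map_le _ _) ?_))
  exact (finrank_span_le_card ({v} : Set E)).trans (by simp)

lemma det_eq_zero_of_crk_lt (A : E →L[ℝ] E) (h : crk A < Module.finrank ℝ E) : A.det = 0 := by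
  by_contra hne
  have h1 : IsUnit (LinearMap.det (A : E →ₗ[ℝ] E)) := isUnit_iff_ne_zero.2 hne
  have h2 := LinearMap.range_eq_top.2 (LinearEquiv.ofIsUnitDet
    (f := (A : E →ₗ[ℝ] E)) (v := Module.finBasis ℝ E) (v' := Module.finBasis ℝ E) (by
      rwa [LinearMap.det_toMatrix])).surjective
  have h3 : crk A = Module.finrank ℝ E := by
    rw [crk, ← finrank_top ℝ E, ← h2]
    congr 2
  omega

/-- One step of collapsing a map along a separated family of pieces. -/
lemma exists_collapse_step {δ : ℝ} (hδ : 0 < δ) (Λ C C' K' : ℝ) : ∃ C'' K'' : ℝ,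
    ∀ (ι : Type) (F : ι → Set E) (A : ι → E →L[ℝ] E) (c : ι → E),
    (∀ i, ‖A i‖ ≤ Λ) → (∀ i, ∀ t ∈ F i, ‖A i t + c i - t‖ ≤ C) →
    (∀ i j, i ≠ j → ∀ x ∈ F i, ∀ y ∈ F j, 4 * δ ≤ dist x y) →
    ∀ G : E → E, ContDiff ℝ 1 G → (∀ x, ‖G x - x‖ ≤ C') → (∀ x, ‖fderiv ℝ G x‖ ≤ K') →
    ∃ G' : E → E, ContDiff ℝ 1 G' ∧ (∀ x, ‖G' x - x‖ ≤ C'') ∧ (∀ x, ‖fderiv ℝ G' x‖ ≤ K'') ∧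
      (∀ x, crk (fderiv ℝ G' x) ≤ crk (fderiv ℝ G x) + 1) ∧
      ∀ i, ∀ x ∈ F i, crk (fderiv ℝ G' x) ≤ crk (A i) := by
  obtain ⟨K1, hK1, hbump⟩ := exists_bump (E := E) hδ
  set M := C + (Λ + 1) * (2 * δ) + (Λ + 1) * C' with hM
  refine ⟨max C' (C' + 2 * M), max K' (K' + (2 * ((Λ + 1) * K') + K1 * M)), ?_⟩
  intro ι F A c hA hC hsep G hG hG1 hG2
  choose l hl1 hl2 hlK hlF hl0 using fun i => hbump (F i)
  have hGd : Differentiable ℝ G := hG.differentiable one_ne_zero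
  set T : ι → E → E := fun i x => G x + l i x • (A i (G x) + c i - G x) with hT
  set G' : E → E := fun x => G x + ∑ᶠ i, l i x • (A i (G x) + c i - G x) with hG'
  have hloc : ∀ x, (∀ i, ∀ f ∈ F i, 2 * δ ≤ dist x f) ∧ G' =ᶠ[𝓝 x] G ∨
      ∃ i, (∃ f ∈ F i, dist x f < 2 * δ) ∧ G' =ᶠ[𝓝 x] T i := by
    intro x
    have hz : ∀ y ∈ Metric.ball x δ, ∀ i, (∀ f ∈ F i, 2 * δ ≤ dist x f) → l i y = 0 := by
      intro y hy i hi
      refine hl0 i y fun f hf => ?_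
      have h1 := hi f hf
      have h2 := dist_triangle x y f
      rw [Metric.mem_ball, dist_comm] at hy
      linarith
    by_cases hx : ∃ i, ∃ f ∈ F i, dist x f < 2 * δ
    · obtain ⟨i, f, hf, hxf⟩ := hx
      refine Or.inr ⟨i, ⟨f, hf, hxf⟩, ?_⟩
      filter_upwards [Metric.ball_mem_nhds x hδ] with y hy
      simp only [hG', hT]
      rw [finsum_eq_single _ i]
      intro j hj
      rw [hz y hy j, zero_smul]
      intro f' hf'
      have h1 := hsep i j hj.symm f hf f' hf'
      have h2 := dist_triangle_left f f' x
      linarith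
    · push Not at hx
      refine Or.inl ⟨hx, ?_⟩
      filter_upwards [Metric.ball_mem_nhds x hδ] with y hy
      simp only [hG']
      rw [finsum_eq_zero_of_forall_eq_zero, add_zero]
      intro i
      rw [hz y hy i (hx i), zero_smul]
  have hv : ∀ i x, (∃ f ∈ F i, dist x f < 2 * δ) → ‖A i (G x) + c i - G x‖ ≤ M := by
    rintro i x ⟨f, hf, hxf⟩
    have hΛ : 0 ≤ Λ := (norm_nonneg _).trans (hA i)
    have e : A i (G x) + c i - G x = (A i f + c i - f) + (A i (x - f) - (x - f)) +
        (A i (G x - x) - (G x - x)) := by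
      simp only [map_sub]; abel
    have h1 : ∀ y, ‖A i y - y‖ ≤ (Λ + 1) * ‖y‖ := by
      intro y
      refine (norm_sub_le _ _).trans ?_
      have := (A i).le_of_opNorm_le (hA i) y
      linarith
    rw [e]
    refine (norm_add₃_le).trans (add_le_add (add_le_add (hC i f hf) ((h1 _).trans ?_))
      ((h1 _).trans ?_))
    · rw [← dist_eq_norm]; gcongr
    · gcongr; exact hG1 x
  have hTd : ∀ i x, HasFDerivAt (T i) (fderiv ℝ G x + (l i x • ((A i).comp (fderiv ℝ G x) -
      fderiv ℝ G x) + (fderiv ℝ (l i) x).smulRight (A i (G x) + c i - G x))) x := by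
    intro i x
    have h1 : HasFDerivAt (fun x => A i (G x) + c i - G x)
        ((A i).comp (fderiv ℝ G x) - fderiv ℝ G x) x :=
      (((A i).hasFDerivAt.comp x (hGd x).hasFDerivAt).add_const (c i)).sub (hGd x).hasFDerivAt
    exact (hGd x).hasFDerivAt.add
      ((((hl1 i).differentiable one_ne_zero) x).hasFDerivAt.smul h1)
  have hTc : ∀ i, ContDiff ℝ 1 (T i) := fun i =>
    hG.add ((hl1 i).smul ((((A i).contDiff.comp hG).add contDiff_const).sub hG))
  refine ⟨G', ?_, ?_, ?_, ?_, ?_⟩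
  · rw [contDiff_iff_contDiffAt]
    intro x
    rcases hloc x with ⟨_, h⟩ | ⟨i, _, h⟩
    · exact hG.contDiffAt.congr_of_eventuallyEq h
    · exact (hTc i).contDiffAt.congr_of_eventuallyEq h
  · intro x
    rcases hloc x with ⟨_, h⟩ | ⟨i, hi, h⟩
    · rw [h.eq_of_nhds]; exact (hG1 x).trans (le_max_left _ _)
    · rw [h.eq_of_nhds]
      refine le_trans ?_ (le_max_right _ _)
      have : T i x - x = (G x - x) + l i x • (A i (G x) + c i - G x) := by
        simp only [hT]; abel
      rw [this]
      refine (norm_add_le _ _).trans (add_le_add (hG1 x) ?_)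
      rw [norm_smul]
      exact mul_le_mul (hl2 i x) (hv i x hi) (norm_nonneg _) zero_le_two
  · intro x
    rcases hloc x with ⟨_, h⟩ | ⟨i, hi, h⟩
    · rw [h.fderiv_eq]; exact (hG2 x).trans (le_max_left _ _)
    · rw [h.fderiv_eq, (hTd i x).fderiv]
      refine le_trans ?_ (le_max_right _ _)
      have hΛ : 0 ≤ Λ := (norm_nonneg _).trans (hA i)
      refine (norm_add_le _ _).trans (add_le_add (hG2 x) ((norm_add_le _ _).trans ?_))
      rw [norm_smul, ContinuousLinearMap.norm_smulRight_apply]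
      refine add_le_add (mul_le_mul (hl2 i x) ?_ (norm_nonneg _) zero_le_two)
        (mul_le_mul (hlK i x) (hv i x hi) (norm_nonneg _) hK1)
      refine (norm_sub_le _ _).trans ?_
      have := (ContinuousLinearMap.opNorm_comp_le (A i) (fderiv ℝ G x)).trans
        (mul_le_mul (hA i) (hG2 x) (norm_nonneg _) hΛ)
      have := hG2 x
      linarith
  · intro x
    rcases hloc x with ⟨_, h⟩ | ⟨i, hi, h⟩
    · rw [h.fderiv_eq]; exact Nat.le_succ _
    · rw [h.fderiv_eq, (hTd i x).fderiv]
      have : fderiv ℝ G x + (l i x • ((A i).comp (fderiv ℝ G x) - fderiv ℝ G x) +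
          (fderiv ℝ (l i) x).smulRight (A i (G x) + c i - G x)) =
          ((1 : E →L[ℝ] E) + l i x • (A i - 1)).comp (fderiv ℝ G x) +
          (fderiv ℝ (l i) x).smulRight (A i (G x) + c i - G x) := by
        ext y
        simp
        abel
      rw [this]
      exact crk_comp_add_smulRight_le _ _ _ _
  · intro i x hx
    rcases hloc x with ⟨h, _⟩ | ⟨j, ⟨f, hf, hxf⟩, h⟩
    · have := h i x hx
      rw [dist_self] at this
      linarith
    · have hij : i = j := by
        by_contra hij
        have := hsep i j hij x hx f hf
        linarith
      subst hij
      have h2 : G' =ᶠ[𝓝 x] fun y => A i (G y) + c i := by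
        filter_upwards [h, hlF i x hx] with y hy hy2
        rw [hy]; simp only [hT, hy2, one_smul]; abel
      have h3 : HasFDerivAt (fun y => A i (G y) + c i) ((A i).comp (fderiv ℝ G x)) x :=
        ((A i).hasFDerivAt.comp x (hGd x).hasFDerivAt).add_const (c i)
      rw [h2.fderiv_eq, h3.fderiv]
      exact crk_comp_le_left _ _

lemma exists_collapse {δ : ℝ} (hδ : 0 < δ) (Λ C : ℝ) (k : ℕ) : ∃ C' K' : ℝ,
    ∀ (ι : Type) (F : ι → Set E) (A : ι → E →L[ℝ] E) (c : ι → E) (r : ι → ℕ),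
    (∀ i, ‖A i‖ ≤ Λ) → (∀ i, ∀ t ∈ F i, ‖A i t + c i - t‖ ≤ C) →
    (∀ i j, i ≠ j → r i = r j → ∀ x ∈ F i, ∀ y ∈ F j, 4 * δ ≤ dist x y) →
    (∀ i, crk (A i) ≤ r i) →
    ∃ G : E → E, ContDiff ℝ 1 G ∧ (∀ x, ‖G x - x‖ ≤ C') ∧ (∀ x, ‖fderiv ℝ G x‖ ≤ K') ∧
      ∀ i, r i < k → ∀ x ∈ F i, crk (fderiv ℝ G x) < k := by
  induction k with
  | zero =>
    refine ⟨0, 1, fun ι F A c r _ _ _ _ => ⟨id, contDiff_id, by simp, fun x => ?_, by simp⟩⟩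
    rw [fderiv_id]; exact ContinuousLinearMap.norm_id_le
  | succ k ih =>
    obtain ⟨C', K', h⟩ := ih
    obtain ⟨C'', K'', hs⟩ := exists_collapse_step (E := E) hδ Λ C C' K'
    refine ⟨C'', K'', fun ι F A c r hA hC hsep hr => ?_⟩
    obtain ⟨G, hG, hG1, hG2, hG3⟩ := h ι F A c r hA hC hsep hr
    obtain ⟨G', h1, h2, h3, h4, h5⟩ := hs ι (fun i => {x | x ∈ F i ∧ r i = k}) A c hA
      (fun i t ht => hC i t ht.1)
      (fun i j hij x hx y hy => hsep i j hij (hx.2.trans hy.2.symm) x hx.1 y hy.1) G hG hG1 hG2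
    refine ⟨G', h1, h2, h3, fun i hi x hx => ?_⟩
    rcases Nat.lt_succ_iff_lt_or_eq.1 hi with hlt | heq
    · have := hG3 i hlt x hx
      have := h4 x
      omega
    · have := h5 i x ⟨hx, heq⟩
      have := hr i
      omega

/-- A large ball cannot be covered by separated pieces on which the identity is
close to affine maps of small rank. -/
lemma no_cover [Nontrivial E] {δ : ℝ} (hδ : 0 < δ) (Λ C : ℝ) : ∃ R > 0,
    ∀ (ι : Type) (F : ι → Set E) (A : ι → E →L[ℝ] E) (c : ι → E) (r : ι → ℕ),
    (∀ i, ‖A i‖ ≤ Λ) → (∀ i, ∀ t ∈ F i, ‖A i t + c i - t‖ ≤ C) →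
    (∀ i j, i ≠ j → r i = r j → ∀ x ∈ F i, ∀ y ∈ F j, 4 * δ ≤ dist x y) →
    (∀ i, crk (A i) ≤ r i) → (∀ i, r i < Module.finrank ℝ E) →
    ∃ x, ‖x‖ ≤ R ∧ ∀ i, x ∉ F i := by
  obtain ⟨C', K', h⟩ := exists_collapse (E := E) hδ Λ C (Module.finrank ℝ E)
  obtain ⟨R, hR, hno⟩ := no_collapse (E := E) C' K'
  refine ⟨R, hR, fun ι F A c r hA hC hsep hr hrd => ?_⟩
  obtain ⟨G, hG, hG1, hG2, hG3⟩ := h ι F A c r hA hC hsep hr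
  obtain ⟨x, hx, hdet⟩ := hno G hG hG1 hG2
  exact ⟨x, hx, fun i hi => hdet (det_eq_zero_of_crk_lt _ (hG3 i (hrd i) x hi))⟩

end topology

section modular
variable {m ι κ τ : Type*} [Fintype m] [Fintype ι] [Fintype κ] [Fintype τ]
  [DecidableEq m] [DecidableEq ι] [DecidableEq κ] [DecidableEq τ]

/-- The subgroup generated by the columns of an integer matrix. -/
def rng (M : Matrix m ι ℤ) : Submodule ℤ (m → ℤ) := LinearMap.range M.mulVecLin

lemma mem_rng {M : Matrix m ι ℤ} {x : m → ℤ} : x ∈ rng M ↔ ∃ y, M *ᵥ y = x := by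
  simp [rng]

lemma ZInj.card_le {M : Matrix m ι ℤ} (h : ZInj M) : Fintype.card ι ≤ Fintype.card m := by
  have hinj : Function.Injective M.mulVecLin := by
    rw [injective_iff_map_eq_zero]
    exact fun x hx => h x hx
  have := LinearMap.finrank_le_finrank_of_injective hinj
  simpa using this

lemma exists_factor {W : Matrix m κ ℤ} {M : Matrix m ι ℤ} (h : rng M ≤ rng W) :
    ∃ X : Matrix κ ι ℤ, M = W * X := by
  have h1 : ∀ j : ι, ∃ z, W *ᵥ z = M *ᵥ Pi.single j 1 := fun j =>
    mem_rng.1 (h (mem_rng.2 ⟨_, rfl⟩))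
  choose z hz using h1
  refine ⟨Matrix.of fun i j => z j i, ?_⟩
  ext i j
  have := congrFun (hz j) i
  rw [mulVec_single_one] at this
  exact this.symm

lemma ZInj.of_mul {W : Matrix m κ ℤ} {X : Matrix κ ι ℤ} (h : ZInj (W * X)) : ZInj X := by
  intro x hx
  exact h x (by rw [← mulVec_mulVec, hx, mulVec_zero])

lemma ZInj.card_le_of_rng_le {W : Matrix m κ ℤ} {M : Matrix m ι ℤ} (hM : ZInj M)
    (h : rng M ≤ rng W) : Fintype.card ι ≤ Fintype.card κ := by
  obtain ⟨X, rfl⟩ := exists_factor h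
  exact hM.of_mul.card_le

lemma ZInj.submatrix {M : Matrix m ι ℤ} (hM : ZInj M) (e : κ ≃ ι) :
    ZInj (M.submatrix id e) := by
  intro x hx
  have h1 : M *ᵥ (x ∘ e.symm) = 0 := by
    rw [← hx, submatrix_mulVec_equiv]; rfl
  have h2 := hM _ h1
  ext i
  simpa using congrFun h2 (e i)

lemma zr_submatrix (M : Matrix m ι ℤ) (e : κ → ι) :
    zr (M.submatrix id e) = (zr M).submatrix id e := rfl

lemma gd_mul_zr_submatrix (g : Matrix τ m ℝ) (M : Matrix m ι ℤ) (e : κ ≃ ι) :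
    gd (g * zr (M.submatrix id e)) = gd (g * zr M) := by
  rw [← gd_submatrix_col (g * zr M) e, zr_submatrix]
  congr 1

lemma rng_submatrix (M : Matrix m ι ℤ) (e : κ ≃ ι) : rng (M.submatrix id e) = rng M := by
  ext x
  simp only [mem_rng]
  constructor
  · rintro ⟨y, rfl⟩
    exact ⟨y ∘ e.symm, by rw [submatrix_mulVec_equiv]; rfl⟩
  · rintro ⟨y, rfl⟩
    refine ⟨y ∘ e, ?_⟩
    rw [submatrix_mulVec_equiv]
    ext i
    simp [Function.comp_assoc]

lemma gd_le_of_rng_le {g : Matrix m m ℝ} (hg : g.det ≠ 0) {W : Matrix m κ ℤ} {M : Matrix m ι ℤ}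
    (hc : Fintype.card ι = Fintype.card κ) (hM : ZInj M) (h : rng M ≤ rng W) :
    gd (g * zr W) ≤ gd (g * zr M) := by
  have e : ι ≃ κ := Fintype.equivOfCardEq hc
  rw [← gd_mul_zr_submatrix g W e]
  rw [← rng_submatrix W e] at h
  obtain ⟨X, rfl⟩ := exists_factor h
  exact gd_index_le ((gd_mul_left_ne_zero hg).2 hM.gd_ne_zero)

lemma card_eq_of_rng_eq {W : Matrix m κ ℤ} {M : Matrix m ι ℤ} (hW : ZInj W) (hM : ZInj M)
    (h : rng W = rng M) : Fintype.card κ = Fintype.card ι :=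
  le_antisymm (hW.card_le_of_rng_le h.le) (hM.card_le_of_rng_le h.ge)

lemma gd_eq_of_rng_eq {g : Matrix m m ℝ} (hg : g.det ≠ 0) {W : Matrix m κ ℤ} {M : Matrix m ι ℤ}
    (hW : ZInj W) (hM : ZInj M) (h : rng W = rng M) : gd (g * zr W) = gd (g * zr M) :=
  le_antisymm (gd_le_of_rng_le hg (card_eq_of_rng_eq hW hM h).symm hM h.ge)
    (gd_le_of_rng_le hg (card_eq_of_rng_eq hW hM h) hW h.le)

lemma fromCols_mulVec_eq (a : Matrix m ι ℤ) (b : Matrix m κ ℤ) (y : ι ⊕ κ → ℤ) :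
    fromCols a b *ᵥ y = a *ᵥ (y ∘ Sum.inl) + b *ᵥ (y ∘ Sum.inr) := by
  ext i
  simp [mulVec, dotProduct, Fintype.sum_sum_type]

lemma rng_fromCols (a : Matrix m ι ℤ) (b : Matrix m κ ℤ) :
    rng (fromCols a b) = rng a ⊔ rng b := by
  ext x
  rw [Submodule.mem_sup]
  constructor
  · rw [mem_rng]
    rintro ⟨y, rfl⟩
    exact ⟨_, mem_rng.2 ⟨_, rfl⟩, _, mem_rng.2 ⟨_, rfl⟩, (fromCols_mulVec_eq a b y).symm⟩
  · rintro ⟨_, h1, _, h2, rfl⟩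
    obtain ⟨y, rfl⟩ := mem_rng.1 h1
    obtain ⟨z, rfl⟩ := mem_rng.1 h2
    exact mem_rng.2 ⟨Sum.elim y z, by rw [fromCols_mulVec_eq]; simp⟩

lemma ZInj.fromCols_left {a : Matrix m ι ℤ} {b : Matrix m κ ℤ} (h : ZInj (fromCols a b)) :
    ZInj a := by
  intro x hx
  have := h (Sum.elim x 0) (by rw [fromCols_mulVec_eq]; simp [hx])
  ext i; simpa using congrFun this (Sum.inl i)

lemma ZInj.eq_zero_of_fromCols {a : Matrix m ι ℤ} {b : Matrix m κ ℤ} (h : ZInj (fromCols a b))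
    {y : ι → ℤ} {z : κ → ℤ} (hyz : a *ᵥ y + b *ᵥ z = 0) : y = 0 ∧ z = 0 := by
  have := h (Sum.elim y z) (by rw [fromCols_mulVec_eq]; simpa using hyz)
  constructor
  · ext i; simpa using congrFun this (Sum.inl i)
  · ext i; simpa using congrFun this (Sum.inr i)

lemma exists_basis (Q : Submodule ℤ (m → ℤ)) : ∃ (p : ℕ) (a : Matrix m (Fin p) ℤ),
    ZInj a ∧ rng a = Q := by
  obtain ⟨p, q, a, b, h, h1, _⟩ := exists_adapted_basis (le_refl Q) (fun _ _ _ hx _ => hx)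
  exact ⟨p, a, h.fromCols_left, by ext x; rw [mem_rng, h1]⟩

lemma exists_modular_pair {k : ℕ} {W₁ W₂ : Matrix m (Fin k) ℤ} (h1 : ZInj W₁) (h2 : ZInj W₂)
    (s1 : IsSat (rng W₁)) (s2 : IsSat (rng W₂)) (hne : rng W₁ ≠ rng W₂) :
    ∃ (p q : ℕ) (a : Matrix m (Fin p) ℤ) (b c : Matrix m (Fin q) ℤ), 0 < q ∧ p + q = k ∧
      ZInj (fromCols a (fromCols b c)) ∧ ∀ g : Matrix m m ℝ, g.det ≠ 0 →
        gd (g * zr (fromCols a b)) = gd (g * zr W₁) ∧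
        gd (g * zr (fromCols a c)) = gd (g * zr W₂) := by
  obtain ⟨p, q, a, b, hab, ha, hb⟩ := exists_adapted_basis (P := rng W₁ ⊓ rng W₂) (Q := rng W₁)
    inf_le_left (fun c x hc hx hcx => ⟨hx, s2 c x hc hcx.2⟩)
  obtain ⟨p', q', a', c, hac, ha', hc⟩ := exists_adapted_basis (P := rng W₁ ⊓ rng W₂)
    (Q := rng W₂) inf_le_right (fun c x hc hx hcx => ⟨s1 c x hc hcx.1, hx⟩)
  have ra : rng a = rng W₁ ⊓ rng W₂ := by ext x; rw [mem_rng, ha]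
  have ra' : rng a' = rng W₁ ⊓ rng W₂ := by ext x; rw [mem_rng, ha']
  have rab : rng (fromCols a b) = rng W₁ := by ext x; rw [mem_rng, hb]
  have rac' : rng (fromCols a' c) = rng W₂ := by ext x; rw [mem_rng, hc]
  have rac : rng (fromCols a c) = rng W₂ := by
    rw [rng_fromCols, ra, ← ra', ← rng_fromCols, rac']
  have habc : ZInj (fromCols a (fromCols b c)) := by
    intro x hx
    rw [fromCols_mulVec_eq, fromCols_mulVec_eq] at hx
    set y := x ∘ Sum.inl
    set z := (x ∘ Sum.inr) ∘ Sum.inl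
    set w := (x ∘ Sum.inr) ∘ Sum.inr
    have hcw : c *ᵥ w ∈ rng a' := by
      rw [ra']
      refine ⟨?_, ?_⟩
      · rw [← rab]
        refine mem_rng.2 ⟨-(Sum.elim y z), ?_⟩
        rw [mulVec_neg, fromCols_mulVec_eq, neg_eq_iff_add_eq_zero]
        simp only [Sum.elim_comp_inl, Sum.elim_comp_inr]
        rw [add_assoc]; exact hx
      · rw [← rac']
        exact mem_rng.2 ⟨Sum.elim 0 w, by rw [fromCols_mulVec_eq]; simp⟩
    obtain ⟨v, hv⟩ := mem_rng.1 hcw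
    have hw : w = 0 := (hac.eq_zero_of_fromCols (y := -v) (z := w) (by
      rw [mulVec_neg, hv, neg_add_cancel])).2
    rw [hw, mulVec_zero, add_zero] at hx
    obtain ⟨hy, hz⟩ := hab.eq_zero_of_fromCols hx
    ext i
    rcases i with i | i | i
    · exact congrFun hy i
    · exact congrFun hz i
    · exact congrFun hw i
  have hac2 : ZInj (fromCols a c) := by
    intro x hx
    rw [fromCols_mulVec_eq] at hx
    obtain ⟨h3, h4⟩ := habc.eq_zero_of_fromCols (y := x ∘ Sum.inl)
      (z := Sum.elim 0 (x ∘ Sum.inr)) (by rw [fromCols_mulVec_eq]; simpa using hx)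
    ext i
    rcases i with i | i
    · exact congrFun h3 i
    · simpa using congrFun h4 (Sum.inr i)
  have k1 := card_eq_of_rng_eq hab h1 rab
  have k2 := card_eq_of_rng_eq hac2 h2 rac
  simp only [Fintype.card_sum, Fintype.card_fin] at k1 k2
  obtain rfl : q' = q := by omega
  refine ⟨p, q', a, b, c, ?_, k1, habc, fun g hg =>
    ⟨gd_eq_of_rng_eq hg hab h1 rab, gd_eq_of_rng_eq hg hac2 h2 rac⟩⟩
  rcases Nat.eq_zero_or_pos q' with rfl | hq
  · exfalso
    apply hne
    have hbz : ∀ b : Matrix m (Fin 0) ℤ, rng b = ⊥ := by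
      intro b
      rw [eq_bot_iff]
      rintro x hx
      obtain ⟨y, rfl⟩ := mem_rng.1 hx
      rw [Subsingleton.elim y 0, mulVec_zero]
      exact zero_mem _
    rw [← rab, ← rac, rng_fromCols, rng_fromCols, hbz, hbz]
  · exact hq

/-- The saturation of the range of an integer matrix. -/
lemma exists_saturation {M : Matrix m ι ℤ} (hM : ZInj M) :
    ∃ Q : Submodule ℤ (m → ℤ), IsSat Q ∧ rng M ≤ Q ∧
      ∀ (κ : Type) [Fintype κ] [DecidableEq κ] (W : Matrix m κ ℤ), ZInj W → rng W = Q →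
        Fintype.card κ = Fintype.card ι := by
  let Q : Submodule ℤ (m → ℤ) :=
    { carrier := {x | ∃ c : ℤ, c ≠ 0 ∧ c • x ∈ rng M}
      zero_mem' := ⟨1, one_ne_zero, by simp⟩
      add_mem' := by
        rintro x y ⟨c, hc, hx⟩ ⟨d, hd, hy⟩
        refine ⟨c * d, mul_ne_zero hc hd, ?_⟩
        rw [smul_add]
        refine add_mem ?_ ?_
        · rw [mul_comm, mul_smul]; exact Submodule.smul_mem _ _ hx
        · rw [mul_smul]; exact Submodule.smul_mem _ _ hy
      smul_mem' := by
        rintro a x ⟨c, hc, hx⟩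
        exact ⟨c, hc, by rw [smul_comm]; exact Submodule.smul_mem _ _ hx⟩ }
  have hMQ : rng M ≤ Q := fun x hx => ⟨1, one_ne_zero, by simpa using hx⟩
  refine ⟨Q, ?_, hMQ, ?_⟩
  · rintro c x hc ⟨d, hd, hx⟩
    exact ⟨d * c, mul_ne_zero hd hc, by rwa [mul_smul]⟩
  · intro κ _ _ W hW hWQ
    refine le_antisymm ?_ (hM.card_le_of_rng_le (hMQ.trans hWQ.ge))
    have h1 : ∀ j : κ, ∃ c : ℤ, c ≠ 0 ∧ c • (W *ᵥ Pi.single j 1) ∈ rng M := fun j => by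
      have : W *ᵥ Pi.single j 1 ∈ Q := hWQ ▸ mem_rng.2 ⟨_, rfl⟩
      exact this
    choose c hc hcm using h1
    have h2 : ZInj (W * diagonal c) := by
      intro x hx
      rw [← mulVec_mulVec] at hx
      have := hW _ hx
      ext i
      have h3 := congrFun this i
      rw [mulVec_diagonal] at h3
      simpa [hc i] using h3
    refine h2.card_le_of_rng_le (W := M) ?_
    intro x hx
    obtain ⟨y, rfl⟩ := mem_rng.1 hx
    have : (W * diagonal c) *ᵥ y = ∑ j, y j • (c j • (W *ᵥ Pi.single j 1)) := by
      ext i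
      simp only [mulVec, dotProduct, mul_diagonal, Finset.sum_apply, Pi.smul_apply, smul_eq_mul,
        Pi.single_apply, mul_ite, mul_one, mul_zero, Finset.sum_ite_eq', Finset.mem_univ, if_true]
      exact Finset.sum_congr rfl fun j _ => by ring
    rw [this]
    exact Submodule.sum_mem _ fun j _ => Submodule.smul_mem _ _ (hcm j)

end modular

section normform
variable {m : Type*} [Fintype m] [DecidableEq m]

/-- The absolute value of the norm form is bounded below by `c` on the nonzero vectors. -/
def NormBdd (c : ℝ) (g : Matrix m m ℝ) : Prop :=
  ∀ x : m → ℤ, x ≠ 0 → c ≤ |∏ i, (g *ᵥ fun j => (x j : ℝ)) i|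

lemma ed_mul_mulVec (t : m → ℝ) (g : Matrix m m ℝ) (x : m → ℝ) (i : m) :
    ((ed t * g) *ᵥ x) i = Real.exp (t i) * (g *ᵥ x) i := by
  rw [← mulVec_mulVec, ed, mulVec_diagonal]

lemma prod_ed_mulVec {t : m → ℝ} (ht : ∑ i, t i = 0) (g : Matrix m m ℝ) (x : m → ℝ) :
    ∏ i, ((ed t * g) *ᵥ x) i = ∏ i, (g *ᵥ x) i := by
  simp only [ed_mul_mulVec, Finset.prod_mul_distrib, ← Real.exp_sum, ht, Real.exp_zero, one_mul]

lemma NormBdd.ed_mul {c : ℝ} {g : Matrix m m ℝ} (h : NormBdd c g) {t : m → ℝ}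
    (ht : ∑ i, t i = 0) : NormBdd c (ed t * g) := by
  intro x hx
  rw [prod_ed_mulVec ht]; exact h x hx

lemma NormBdd.exists_le [Nonempty m] {c : ℝ} (hc1 : c ≤ 1) {g : Matrix m m ℝ} (h : NormBdd c g)
    {x : m → ℤ} (hx : x ≠ 0) : ∃ i, c ≤ |(g *ᵥ fun j => (x j : ℝ)) i| := by
  by_contra hcon
  push Not at hcon
  have h1 := h x hx
  rw [Finset.abs_prod] at h1
  obtain ⟨i0⟩ := ‹Nonempty m›
  rw [← Finset.mul_prod_erase _ _ (Finset.mem_univ i0)] at h1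
  have h2 : ∏ i ∈ Finset.univ.erase i0, |(g *ᵥ fun j => (x j : ℝ)) i| ≤ 1 :=
    Finset.prod_le_one (fun _ _ => abs_nonneg _) fun i _ => (hcon i).le.trans hc1
  have h3 := hcon i0
  nlinarith [abs_nonneg ((g *ᵥ fun j => (x j : ℝ)) i0)]

lemma NormBdd.le_abs {c B : ℝ} (hB1 : 1 ≤ B) {g : Matrix m m ℝ} (h : NormBdd c g)
    {x : m → ℤ} (hx : x ≠ 0) (hB : ∀ i, |(g *ᵥ fun j => (x j : ℝ)) i| ≤ B) (i : m) :
    c / B ^ Fintype.card m ≤ |(g *ᵥ fun j => (x j : ℝ)) i| := by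
  have h1 := h x hx
  rw [Finset.abs_prod, ← Finset.mul_prod_erase _ _ (Finset.mem_univ i)] at h1
  have h2 : ∏ i ∈ Finset.univ.erase i, |(g *ᵥ fun j => (x j : ℝ)) i| ≤ B ^ Fintype.card m := by
    refine (Finset.prod_le_prod (fun _ _ => abs_nonneg _) fun i _ => hB i).trans ?_
    rw [Finset.prod_const]
    exact pow_le_pow_right₀ hB1 (Finset.card_le_univ _)
  rw [div_le_iff₀ (by positivity)]
  exact h1.trans (mul_le_mul_of_nonneg_left h2 (abs_nonneg _))

lemma minor_sq_le {k : ℕ} (V : Matrix m (Fin k) ℝ) (σ : Fin k → m) :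
    minor V σ ^ 2 ≤ k.factorial * gd V := by
  have := factorial_mul_gd V
  rw [Fintype.card_fin] at this
  rw [this]
  exact Finset.single_le_sum (f := fun I => minor V I ^ 2) (fun _ _ => sq_nonneg _)
    (Finset.mem_univ σ)

lemma IsSupRed.det_u {k : ℕ} {V : Matrix m (Fin k) ℝ} {u σ} (h : IsSupRed V u σ) : u.det = 1 := by
  rw [det_of_isUpperTriangular (fun i j hij => h.low i j hij)]
  simp [h.diag]

lemma IsSupRed.minor_eq {k : ℕ} {V : Matrix m (Fin k) ℝ} {u σ} (h : IsSupRed V u σ) :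
    minor V σ = ∏ b, V (σ b) b := by
  unfold minor
  exact det_of_isLowerTriangular (V.submatrix σ id) (fun i j hij => h.piv i j hij)

lemma IsSupRed.abs_u {k : ℕ} {V : Matrix m (Fin k) ℝ} {u σ} (h : IsSupRed V u σ) (i j) :
    |u i j| ≤ 1 := by
  rcases lt_trichotomy i j with hij | rfl | hij
  · exact (h.half i j hij).trans (by norm_num)
  · rw [h.diag]; simp
  · rw [h.low i j hij]; simp

lemma IsSupRed.abs_mul_le {k : ℕ} {V : Matrix m (Fin k) ℝ} {u σ} (h : IsSupRed V u σ) (i j) :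
    |(V * u) i j| ≤ ∑ b, |V (σ b) b| := by
  rw [mul_apply]
  refine (Finset.abs_sum_le_sum_abs _ _).trans (Finset.sum_le_sum fun b _ => ?_)
  rw [abs_mul]
  calc |V i b| * |u b j| ≤ |V (σ b) b| * 1 :=
        mul_le_mul (h.max i b) (h.abs_u b j) (abs_nonneg _) (abs_nonneg _)
    _ = _ := mul_one _

lemma IsSupRed.le_piv {k : ℕ} {V : Matrix m (Fin k) ℝ} {u σ} (h : IsSupRed V u σ) {c : ℝ}
    (h0 : ∀ j : Fin k, (j : ℕ) = 0 → c ≤ |V (σ j) j|) (j : Fin k) : c / 2 ^ (j : ℕ) ≤ |V (σ j) j| := by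
  obtain ⟨j, hj⟩ := j
  induction j with
  | zero => simpa using h0 ⟨0, hj⟩ rfl
  | succ j ih =>
    have h1 := ih (by omega)
    have h2 := h.step ⟨j, by omega⟩ ⟨j + 1, hj⟩ rfl
    have : c / 2 ^ (j + 1) = c / 2 ^ j / 2 := by rw [pow_succ, div_div]
    simp only at h1 h2 ⊢
    rw [this]; linarith

lemma det_sq_of_inv {k : ℕ} {U U' : Matrix (Fin k) (Fin k) ℤ} (h : U * U' = 1) :
    (zr U).det ^ 2 = 1 := by
  have h1 : IsUnit U.det := IsUnit.of_mul_eq_one U'.det (by rw [← det_mul, h, det_one])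
  rw [zr_det]
  rcases Int.isUnit_iff.1 h1 with h2 | h2 <;> simp [h2]

lemma exists_good_basis [Nonempty m] {c : ℝ} (hc : 0 < c) (hc1 : c ≤ 1) {Y : Matrix m m ℝ}
    (hY : NormBdd c Y) (hdet : Y.det ≠ 0) {k : ℕ} {W : Matrix m (Fin k) ℤ} (hW : ZInj W) :
    ∃ (U : Matrix (Fin k) (Fin k) ℤ) (D : Fin k → ℝ), ZInj (W * U) ∧ (zr U).det ^ 2 = 1 ∧
      (∀ b, c / 2 ^ k ≤ D b) ∧ (∏ b, D b) ^ 2 ≤ k.factorial * gd (Y * zr W) ∧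
      ∀ i j, |(Y * zr (W * U)) i j| ≤ ∑ b, D b := by
  have hgd : gd (Y * zr W) ≠ 0 := (gd_mul_left_ne_zero hdet).2 hW.gd_ne_zero
  obtain ⟨U, U', V, u, σ, hU, hU', hV, hred⟩ := exists_sup_red (Y * zr W) hgd
  have hdU := det_sq_of_inv hU
  have hZ : ZInj (W * U) := by
    intro x hx
    rw [← mulVec_mulVec] at hx
    have h1 := hW _ hx
    have h2 : U' *ᵥ (U *ᵥ x) = x := by rw [mulVec_mulVec, hU', one_mulVec]
    rw [← h2, h1, mulVec_zero]
  have hYV : Y * zr (W * U) = V * u := by rw [zr_mul, ← Matrix.mul_assoc, hV]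
  refine ⟨U, fun b => |V (σ b) b|, hZ, hdU, ?_, ?_, ?_⟩
  · intro j
    refine le_trans ?_ (hred.le_piv (c := c) ?_ j)
    · gcongr
      · norm_num
      · exact j.2.le
    · intro j hj
      have hx : (W * U) *ᵥ Pi.single j 1 ≠ 0 := fun h0 => by
        have := congrFun (hZ _ h0) j
        simp at this
      obtain ⟨i, hi⟩ := hY.exists_le hc1 hx
      refine hi.trans (le_trans (le_of_eq ?_) (hred.max i j))
      have e1 : (Y *ᵥ fun a => ((((W * U) *ᵥ Pi.single j 1) a : ℤ) : ℝ)) i = (V * u) i j := by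
        rw [← zr_mulVec, mulVec_mulVec, hYV]
        have : (fun a => ((Pi.single j (1 : ℤ) : Fin k → ℤ) a : ℝ)) = Pi.single j 1 := by
          ext a; by_cases ha : a = j <;> simp [ha]
        rw [this, mulVec_single_one]; rfl
      rw [e1, mul_apply, Finset.sum_eq_single j]
      · rw [hred.diag, mul_one]
      · intro b _ hb
        have : j < b := by
          rw [Fin.lt_def, hj]
          rcases Nat.eq_zero_or_pos (b : ℕ) with h | h
          · exact absurd (Fin.ext (h.trans hj.symm)) hb
          · exact h
        rw [hred.low b j this, mul_zero]
      · simp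
  · have h1 := minor_sq_le V σ
    have h2 : gd (Y * zr W) = gd V := by
      have h3 := gd_mul (Y * zr W) (zr U)
      rw [hdU, one_mul, hV, gd_mul, hred.det_u] at h3
      rw [← h3]; ring
    rw [hred.minor_eq, ← h2] at h1
    rw [← Finset.abs_prod, sq_abs]
    exact h1
  · intro i j
    rw [hYV]; exact hred.abs_mul_le i j

lemma exists_gd_lower [Nonempty m] {c : ℝ} (hc : 0 < c) (hc1 : c ≤ 1) : ∃ c₁ > 0,
    ∀ Y : Matrix m m ℝ, NormBdd c Y → Y.det ≠ 0 → ∀ (k : ℕ) (W : Matrix m (Fin k) ℤ), ZInj W →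
      c₁ ≤ gd (Y * zr W) := by
  set n := Fintype.card m with hn
  refine ⟨((c / 2 ^ n) ^ n) ^ 2 / n.factorial, by positivity, fun Y hY hdet k W hW => ?_⟩
  obtain ⟨U, D, _, _, h1, h2, _⟩ := exists_good_basis hc hc1 hY hdet hW
  have hk : k ≤ n := by simpa using hW.card_le
  have h4 : c / 2 ^ n ≤ 1 := by
    rw [div_le_one (by positivity)]; exact hc1.trans (one_le_pow₀ one_le_two)
  have h3 : (c / 2 ^ n) ^ n ≤ ∏ b, D b := by
    calc (c / 2 ^ n) ^ n ≤ (c / 2 ^ n) ^ k := pow_le_pow_of_le_one (by positivity) h4 hk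
      _ = ∏ b : Fin k, (c / 2 ^ n) := by
          rw [Finset.prod_const, Finset.card_univ, Fintype.card_fin]
      _ ≤ ∏ b, D b := Finset.prod_le_prod (fun _ _ => by positivity) fun b _ =>
          le_trans (by gcongr; norm_num) (h1 b)
  rw [div_le_iff₀ (by positivity)]
  calc ((c / 2 ^ n) ^ n) ^ 2 ≤ (∏ b, D b) ^ 2 := by gcongr
    _ ≤ k.factorial * gd (Y * zr W) := h2
    _ ≤ n.factorial * gd (Y * zr W) := by
        have := gd_nonneg (Y * zr W)
        gcongr
    _ = _ := mul_comm _ _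

lemma exists_entry_bound [Nonempty m] {c : ℝ} (hc : 0 < c) (hc1 : c ≤ 1) : ∃ C ≥ 1,
    ∀ Y : Matrix m m ℝ, NormBdd c Y → Y.det ≠ 0 → ∀ (k : ℕ) (W : Matrix m (Fin k) ℤ), ZInj W →
      gd (Y * zr W) ≤ 3 → ∃ U : Matrix (Fin k) (Fin k) ℤ, ZInj (W * U) ∧ (zr U).det ^ 2 = 1 ∧
        ∀ i j, |(Y * zr (W * U)) i j| ≤ C := by
  set n := Fintype.card m with hn
  set c' := c / 2 ^ n with hc'
  have hc'0 : 0 < c' := by positivity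
  have hc'1 : c' ≤ 1 := by
    rw [hc', div_le_one (by positivity)]; exact hc1.trans (one_le_pow₀ one_le_two)
  have hfac : (1 : ℝ) ≤ n.factorial := by exact_mod_cast Nat.one_le_iff_ne_zero.2 n.factorial_ne_zero
  have hn1 : (1 : ℝ) ≤ n := by exact_mod_cast Fintype.card_pos
  have hpw : c' ^ n ≤ 1 := pow_le_one₀ hc'0.le hc'1
  have hB : 1 ≤ 3 * n.factorial / c' ^ n := by
    rw [le_div_iff₀ (by positivity)]; linarith
  refine ⟨n * (3 * n.factorial / c' ^ n), by nlinarith, fun Y hY hdet k W hW h3 => ?_⟩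
  obtain ⟨U, D, hZ, hU, h1, h2, h4⟩ := exists_good_basis hc hc1 hY hdet hW
  have hk : k ≤ n := by simpa using hW.card_le
  have h1' : ∀ b, c' ≤ D b := fun b => le_trans (by rw [hc']; gcongr; norm_num) (h1 b)
  have hD0 : ∀ b, 0 < D b := fun b => hc'0.trans_le (h1' b)
  refine ⟨U, hZ, hU, fun i j => (h4 i j).trans ?_⟩
  have hkf : (k.factorial : ℝ) ≤ n.factorial := by exact_mod_cast Nat.factorial_le hk
  have hprod : ∏ b, D b ≤ 3 * n.factorial := by
    have : (∏ b, D b) ^ 2 ≤ (3 * n.factorial) ^ 2 := by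
      refine h2.trans ?_
      calc (k.factorial : ℝ) * gd (Y * zr W) ≤ n.factorial * 3 := by
            have := gd_nonneg (Y * zr W)
            gcongr
        _ ≤ (3 * n.factorial) ^ 2 := by nlinarith
    exact le_of_sq_le_sq this (by positivity)
  have hDb : ∀ b, D b ≤ 3 * n.factorial / c' ^ n := by
    intro b
    rw [le_div_iff₀ (by positivity)]
    refine le_trans ?_ hprod
    rw [← Finset.mul_prod_erase _ _ (Finset.mem_univ b)]
    refine mul_le_mul_of_nonneg_left ?_ (hD0 b).le
    calc c' ^ n ≤ c' ^ (Finset.univ.erase b).card :=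
          pow_le_pow_of_le_one hc'0.le hc'1 ((Finset.card_le_univ _).trans (by simpa using hk))
      _ = ∏ _b ∈ Finset.univ.erase b, c' := by rw [Finset.prod_const]
      _ ≤ _ := Finset.prod_le_prod (fun _ _ => hc'0.le) fun b _ => h1' b
  calc ∑ b, D b ≤ ∑ _b : Fin k, (3 * n.factorial / c' ^ n) := Finset.sum_le_sum fun b _ => hDb b
    _ = k * (3 * n.factorial / c' ^ n) := by simp
    _ ≤ _ := by gcongr

end normform

section affine
variable {m : Type*} [Fintype m] [DecidableEq m]

lemma exists_max_minor [Nonempty m] {k : ℕ} (hk : 0 < k) (hkn : k ≤ Fintype.card m)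
    {y : Matrix m (Fin k) ℝ} {B c₁ c' : ℝ} (hB : 1 ≤ B) (hc₁ : 0 < c₁) (hc' : 0 < c')
    (hyB : ∀ i j, |y i j| ≤ B) (hy : c₁ ≤ gd y) (hrow : ∀ i, c' ≤ |y i ⟨0, hk⟩|) :
    ∃ (I : Fin k → m) (b : m → Fin k),
      c₁ / (Fintype.card m : ℝ) ^ Fintype.card m ≤ minor y I ^ 2 ∧
      ∀ j, c₁ / (Fintype.card m : ℝ) ^ Fintype.card m * (c' / (Fintype.card m * B)) ^ 2 ≤
        minor y (Function.update I (b j) j) ^ 2 := by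
  set n := Fintype.card m with hn
  have hn1 : (1 : ℝ) ≤ n := by exact_mod_cast Fintype.card_pos
  have hB0 : 0 < B := by linarith
  obtain ⟨I, hI⟩ := Finite.exists_max fun I : Fin k → m => minor y I ^ 2
  have h1 : c₁ / (n : ℝ) ^ n ≤ minor y I ^ 2 := by
    rw [div_le_iff₀ (by positivity)]
    have h2 := factorial_mul_gd y
    have h3 : ∑ J : Fin k → m, minor y J ^ 2 ≤ (n : ℝ) ^ k * minor y I ^ 2 := by
      refine (Finset.sum_le_card_nsmul _ _ _ fun J _ => hI J).trans (le_of_eq ?_)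
      rw [Finset.card_univ, Fintype.card_fun, Fintype.card_fin, nsmul_eq_mul]; push_cast; rfl
    rw [← h2, Fintype.card_fin] at h3
    have h4 : (1 : ℝ) ≤ k.factorial := by
      exact_mod_cast Nat.one_le_iff_ne_zero.2 k.factorial_ne_zero
    calc c₁ ≤ 1 * gd y := by linarith
      _ ≤ k.factorial * gd y := by
          have := gd_nonneg y
          gcongr
      _ ≤ (n : ℝ) ^ k * minor y I ^ 2 := h3
      _ ≤ (n : ℝ) ^ n * minor y I ^ 2 := by gcongr
      _ = _ := mul_comm _ _
  have h0 : 0 < |minor y I| := by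
    rw [abs_pos]; intro h
    rw [h] at h1
    have : 0 < c₁ / (n : ℝ) ^ n := by positivity
    linarith [h1.trans_eq (zero_pow two_ne_zero)]
  have h2 : ∀ j, ∃ b, |minor y I| * (c' / (n * B)) ≤ |minor y (Function.update I b j)| := by
    intro j
    by_contra hcon
    push Not at hcon
    have hcr := congrFun (mulVec_cramer (y.submatrix I id)ᵀ (y j)) ⟨0, hk⟩
    rw [det_transpose] at hcr
    have hcr' : minor y I * y j ⟨0, hk⟩ =
        ∑ b, y (I b) ⟨0, hk⟩ * minor y (Function.update I b j) := by
      have hcr2 : ∑ b, y (I b) ⟨0, hk⟩ * (cramer (y.submatrix I id)ᵀ (y j)) b =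
          minor y I * y j ⟨0, hk⟩ := hcr
      rw [← hcr2]
      refine Finset.sum_congr rfl fun b _ => ?_
      rw [cramer_transpose_apply]
      congr 2
      ext a l
      by_cases ha : a = b
      · subst ha; simp
      · simp [ha]
    have h3 : |minor y I| * c' ≤ ∑ b : Fin k, B * |minor y (Function.update I b j)| := by
      calc |minor y I| * c' ≤ |minor y I * y j ⟨0, hk⟩| := by
            rw [abs_mul]; exact mul_le_mul_of_nonneg_left (hrow j) (abs_nonneg _)
        _ ≤ _ := by
            rw [hcr']
            refine (Finset.abs_sum_le_sum_abs _ _).trans (Finset.sum_le_sum fun b _ => ?_)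
            rw [abs_mul]
            exact mul_le_mul_of_nonneg_right (hyB _ _) (abs_nonneg _)
    have h4 : ∑ b : Fin k, B * |minor y (Function.update I b j)| <
        ∑ b : Fin k, B * (|minor y I| * (c' / (n * B))) :=
      Finset.sum_lt_sum_of_nonempty ⟨⟨0, hk⟩, Finset.mem_univ _⟩ fun b _ =>
        mul_lt_mul_of_pos_left (hcon b) hB0
    rw [Finset.sum_const, Finset.card_univ, Fintype.card_fin, nsmul_eq_mul] at h4
    have h5 : (k : ℝ) * (B * (|minor y I| * (c' / (n * B)))) = k / n * (|minor y I| * c') := by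
      field_simp
    have h6 : (k : ℝ) / n ≤ 1 := by
      rw [div_le_one (by linarith)]; exact_mod_cast hkn
    have h7 : 0 < |minor y I| * c' := by positivity
    nlinarith
  choose b hb using h2
  refine ⟨I, b, h1, fun j => ?_⟩
  calc c₁ / (n : ℝ) ^ n * (c' / (n * B)) ^ 2 ≤ minor y I ^ 2 * (c' / (n * B)) ^ 2 := by gcongr
    _ = (|minor y I| * (c' / (n * B))) ^ 2 := by rw [mul_pow, sq_abs]
    _ ≤ |minor y (Function.update I (b j) j)| ^ 2 := by
        have := hb j
        gcongr
    _ = _ := sq_abs _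

lemma first_order_nonneg {α : Type*} [Fintype α] {P x : α → ℝ}
    (h : ∀ s : ℝ, 0 ≤ s → s ≤ 1 → ∑ a, P a ≤ ∑ a, P a * Real.exp (2 * (s * x a))) :
    0 ≤ ∑ a, P a * x a := by
  have hd : HasDerivAt (fun s : ℝ => ∑ a, P a * Real.exp (2 * (s * x a)))
      (∑ a, P a * (Real.exp (2 * (0 * x a)) * (2 * (1 * x a)))) 0 :=
    HasDerivAt.fun_sum fun a _ =>
      ((((hasDerivAt_id (0 : ℝ)).mul_const (x a)).const_mul 2).exp).const_mul (P a)
  have ht := hd.tendsto_slope_zero_right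
  have h0 : 0 ≤ ∑ a, P a * (Real.exp (2 * (0 * x a)) * (2 * (1 * x a))) := by
    refine ge_of_tendsto ht ?_
    filter_upwards [Ioo_mem_nhdsGT (zero_lt_one (α := ℝ))] with s hs
    have := h s hs.1.le hs.2.le
    simp only [zero_add, zero_mul, mul_zero, Real.exp_zero, mul_one, smul_eq_mul]
    exact mul_nonneg (inv_nonneg.2 hs.1.le) (by linarith)
  have : ∑ a, P a * (Real.exp (2 * (0 * x a)) * (2 * (1 * x a))) = 2 * ∑ a, P a * x a := by
    rw [Finset.mul_sum]
    refine Finset.sum_congr rfl fun a _ => ?_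
    rw [zero_mul, mul_zero, Real.exp_zero]; ring
  linarith

lemma abs_le_of_first_order {α : Type*} [Fintype α] [DecidableEq α] {P x : α → ℝ}
    (hP : ∀ a, 0 ≤ P a) (h1 : 0 ≤ ∑ a, P a * x a) {K η : ℝ}
    (h2 : ∑ a, P a * Real.exp (2 * x a) ≤ K) (hη : 0 < η) {a : α} (ha : η ≤ P a) :
    |x a| ≤ K / η := by
  have hx : ∀ a, P a * x a ≤ P a * Real.exp (2 * x a) := by
    intro a
    refine mul_le_mul_of_nonneg_left ?_ (hP a)
    have e1 := Real.add_one_le_exp (2 * x a)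
    have e2 := Real.exp_pos (2 * x a)
    rcases le_total 0 (x a) with h | h <;> linarith
  have hpos : ∀ a, 0 ≤ P a * Real.exp (2 * x a) := fun a =>
    mul_nonneg (hP a) (Real.exp_pos _).le
  have hu : P a * x a ≤ K := (hx a).trans
    ((Finset.single_le_sum (f := fun a => P a * Real.exp (2 * x a)) (fun b _ => hpos b)
      (Finset.mem_univ a)).trans h2)
  have hl : -(P a * x a) ≤ K := by
    rw [← Finset.add_sum_erase _ _ (Finset.mem_univ a)] at h1 h2
    have := Finset.sum_le_sum (s := Finset.univ.erase a) fun b _ => hx b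
    have := hpos a
    linarith
  rw [le_div_iff₀ hη]
  calc |x a| * η ≤ |x a| * P a := mul_le_mul_of_nonneg_left ha (abs_nonneg _)
    _ = |P a * x a| := by rw [abs_mul, abs_of_nonneg (hP a), mul_comm]
    _ ≤ K := abs_le.2 ⟨by linarith, hu⟩

lemma continuous_gd_ed {k : ℕ} (M : Matrix m (Fin k) ℝ) :
    Continuous fun t : m → ℝ => gd (ed t * M) := by
  unfold gd ed
  fun_prop

lemma factorial_mul_gd_ed {k : ℕ} (t : m → ℝ) (y : Matrix m (Fin k) ℝ) :
    k.factorial * gd (ed t * y) =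
      ∑ I : Fin k → m, minor y I ^ 2 * Real.exp (2 * ∑ a, t (I a)) := by
  have := factorial_mul_gd (ed t * y)
  rw [Fintype.card_fin] at this
  rw [this]
  refine Finset.sum_congr rfl fun I _ => ?_
  rw [minor_ed, mul_pow, ← Real.exp_nat_mul]; push_cast; ring

lemma exists_affine_model [Nonempty m] {c : ℝ} (hc : 0 < c) (hc1 : c ≤ 1) : ∃ C : ℝ,
    ∀ g : Matrix m m ℝ, NormBdd c g → g.det ≠ 0 → ∀ (R : ℝ) (k : ℕ), 0 < k →
    ∀ W : Matrix m (Fin k) ℤ, ZInj W → ∀ F : Set (m → ℝ),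
    (∀ t ∈ F, ∑ i, t i = 0 ∧ ‖t‖ ≤ R ∧ gd (ed t * g * zr W) ≤ 3) →
    ∃ (t₀ : m → ℝ) (I : Fin k → m) (b : m → Fin k), ∑ i, t₀ i = 0 ∧
      ∀ t ∈ F, ∀ j, |(t - t₀) j - (t - t₀) (I (b j))| ≤ C := by
  obtain ⟨c₁, hc₁, hlow⟩ := exists_gd_lower (m := m) hc hc1
  obtain ⟨B, hB, hent⟩ := exists_entry_bound (m := m) hc hc1
  set n := Fintype.card m with hn
  have hn1 : (1 : ℝ) ≤ n := by exact_mod_cast Fintype.card_pos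
  have hB0 : 0 < B := by linarith
  set c' := c / B ^ n with hc'
  have hc'0 : 0 < c' := by positivity
  set η₀ := c₁ / (n : ℝ) ^ n * (c' / (n * B)) ^ 2 with hη₀
  have hη₀0 : 0 < η₀ := by positivity
  set K := 3 * (n.factorial : ℝ) with hK
  refine ⟨2 * (K / η₀), fun g hg hdet R k hk W hW F hF => ?_⟩
  rcases F.eq_empty_or_nonempty with rfl | ⟨t₁, ht₁⟩
  · exact ⟨0, fun _ => Classical.arbitrary m, fun _ => ⟨0, hk⟩, by simp, by simp⟩
  have hkn : k ≤ n := by simpa using hW.card_le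
  set S : Set (m → ℝ) := {t | ∑ i, t i = 0} ∩ Metric.closedBall 0 R with hS
  have hScomp : IsCompact S :=
    (isCompact_closedBall (0 : m → ℝ) R).inter_left
      (isClosed_eq (by fun_prop) continuous_const)
  have hFS : F ⊆ S := fun t ht => ⟨(hF t ht).1, by simpa using (hF t ht).2.1⟩
  obtain ⟨t₀, ht₀, hmin⟩ := hScomp.exists_isMinOn ⟨t₁, hFS ht₁⟩
    (continuous_gd_ed (g * zr W)).continuousOn
  have ht₀s : ∑ i, t₀ i = 0 := ht₀.1
  have hY : NormBdd c (ed t₀ * g) := hg.ed_mul ht₀s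
  have hYd : (ed t₀ * g).det ≠ 0 := by
    rw [det_mul, det_ed, ht₀s, Real.exp_zero, one_mul]; exact hdet
  have hgd3 : gd (ed t₀ * g * zr W) ≤ 3 := by
    rw [Matrix.mul_assoc]
    refine (hmin (hFS ht₁)).trans ?_
    change gd (ed t₁ * (g * zr W)) ≤ 3
    rw [← Matrix.mul_assoc]
    exact (hF t₁ ht₁).2.2
  obtain ⟨U, hZ, hU, hUB⟩ := hent _ hY hYd k W hW hgd3
  set y := ed t₀ * g * zr (W * U) with hy
  have hgdU : ∀ t : m → ℝ, gd (ed t * y) = gd (ed (t + t₀) * g * zr W) := by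
    intro t
    have : ed t * y = ed (t + t₀) * g * zr W * zr U := by
      rw [hy, ed_add, zr_mul]; simp only [Matrix.mul_assoc]
    rw [this, gd_mul, hU, one_mul]
  have hrow : ∀ i, c' ≤ |y i ⟨0, hk⟩| := by
    have hx : (W * U) *ᵥ Pi.single ⟨0, hk⟩ 1 ≠ 0 := fun h0 => by
      have := congrFun (hZ _ h0) ⟨0, hk⟩
      simp at this
    have e1 : ((ed t₀ * g) *ᵥ fun a => ((((W * U) *ᵥ Pi.single ⟨0, hk⟩ 1) a : ℤ) : ℝ)) =
        fun i => y i ⟨0, hk⟩ := by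
      rw [← zr_mulVec, mulVec_mulVec]
      have : (fun a => ((Pi.single (⟨0, hk⟩ : Fin k) (1 : ℤ) : Fin k → ℤ) a : ℝ)) =
          Pi.single ⟨0, hk⟩ 1 := by
        ext a; by_cases ha : a = ⟨0, hk⟩ <;> simp [ha]
      rw [this, mulVec_single_one]; rfl
    have := hY.le_abs hB hx (by rw [e1]; exact fun i => hUB i _)
    rw [e1] at this
    exact this
  obtain ⟨I, b, hI1, hI2⟩ := exists_max_minor hk hkn hB hc₁ hc'0 hUB
    (hlow _ hY hYd k _ hZ) hrow
  have hIη : η₀ ≤ minor y I ^ 2 := by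
    refine le_trans ?_ hI1
    have h1 : c' / (n * B) ≤ 1 := by
      rw [div_le_one (by positivity)]
      have : c' ≤ 1 := by
        rw [hc', div_le_one (by positivity)]; exact hc1.trans (one_le_pow₀ hB)
      nlinarith
    rw [hη₀]
    exact mul_le_of_le_one_right (by positivity) (pow_le_one₀ (by positivity) h1)
  refine ⟨t₀, I, b, ht₀s, fun t ht j => ?_⟩
  set x := t - t₀ with hx
  set P : (Fin k → m) → ℝ := fun J => minor y J ^ 2 with hP
  set X : (Fin k → m) → ℝ := fun J => ∑ a, x (J a) with hX
  have hfirst : 0 ≤ ∑ J, P J * X J := by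
    refine first_order_nonneg fun s hs hs1 => ?_
    have e1 : ∑ J, P J * Real.exp (2 * (s * X J)) = k.factorial * gd (ed (s • x) * y) := by
      rw [factorial_mul_gd_ed]
      refine Finset.sum_congr rfl fun J _ => ?_
      simp only [hX, Finset.mul_sum, Pi.smul_apply, smul_eq_mul, hP]
    have e2 : ∑ J, P J = k.factorial * gd (ed (0 : m → ℝ) * y) := by
      rw [factorial_mul_gd_ed]
      simp [hP]
    rw [e1, e2, hgdU, hgdU, zero_add]
    refine mul_le_mul_of_nonneg_left ?_ (Nat.cast_nonneg _)
    have hmem : s • x + t₀ ∈ S := by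
      refine ⟨?_, ?_⟩
      · have h1 : ∑ i, t i = 0 := (hF t ht).1
        simp only [Set.mem_ofPred_eq, hx, Pi.add_apply, Pi.smul_apply, Pi.sub_apply, smul_eq_mul,
          Finset.sum_add_distrib, ← Finset.mul_sum, Finset.sum_sub_distrib, h1, ht₀s]
        ring
      · have e3 : s • x + t₀ = (1 - s) • t₀ + s • t := by
          rw [hx, sub_smul, one_smul, smul_sub]; abel
        rw [e3]
        exact (convex_closedBall (0 : m → ℝ) R) ht₀.2 (hFS ht).2 (by linarith) hs (by ring)
    have h2 := hmin hmem
    simp only [Set.mem_ofPred_eq] at h2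
    rwa [← Matrix.mul_assoc, ← Matrix.mul_assoc] at h2
  have hsum : ∑ J, P J * Real.exp (2 * X J) ≤ K := by
    have e1 : ∑ J, P J * Real.exp (2 * X J) = k.factorial * gd (ed x * y) := by
      rw [factorial_mul_gd_ed]
    rw [e1, hgdU, hx, sub_add_cancel, hK, mul_comm (3 : ℝ)]
    have h1 := (hF t ht).2.2
    have h2 : (k.factorial : ℝ) ≤ n.factorial := by exact_mod_cast Nat.factorial_le hkn
    have h3 := gd_nonneg (ed t * g * zr W)
    gcongr
  have hPn : ∀ J, 0 ≤ P J := fun J => sq_nonneg _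
  have b1 := abs_le_of_first_order hPn hfirst hsum hη₀0 hIη
  have b2 := abs_le_of_first_order hPn hfirst hsum hη₀0 (hI2 j)
  have e : x j - x (I (b j)) = X (Function.update I (b j) j) - X I := by
    simp only [hX]
    rw [← Finset.add_sum_erase _ _ (Finset.mem_univ (b j)),
      ← Finset.add_sum_erase _ (fun a => x (I a)) (Finset.mem_univ (b j))]
    have : ∑ a ∈ Finset.univ.erase (b j), x (Function.update I (b j) j a) =
        ∑ a ∈ Finset.univ.erase (b j), x (I a) :=
      Finset.sum_congr rfl fun a ha => by
        rw [Function.update_of_ne (Finset.ne_of_mem_erase ha)]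
    rw [this, Function.update_self]; ring
  rw [e]
  calc |X (Function.update I (b j) j) - X I| ≤ _ := abs_sub _ _
    _ ≤ 2 * (K / η₀) := by linarith

end affine

section nearstable
variable {m : Type*} [Fintype m] [DecidableEq m]

/-- Every subgroup of the lattice `g ℤᵐ` has squared covolume at least `exp (-ε)`. -/
def NS {τ : Type*} [Fintype τ] (ε : ℝ) (g : Matrix τ m ℝ) : Prop :=
  ∀ (k : ℕ) (M : Matrix m (Fin k) ℤ), ZInj M → Real.exp (-ε) ≤ gd (g * zr M)

lemma gd_pos {ι : Type*} [Fintype ι] [DecidableEq ι] {g : Matrix m m ℝ} (hg : g.det ≠ 0)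
    {M : Matrix m ι ℤ} (hM : ZInj M) : 0 < gd (g * zr M) :=
  (gd_nonneg _).lt_of_ne ((gd_mul_left_ne_zero hg).2 hM.gd_ne_zero).symm

lemma det_ed_mul_ne_zero {g : Matrix m m ℝ} (hg : g.det ≠ 0) (t : m → ℝ) : (ed t * g).det ≠ 0 := by
  rw [det_mul, det_ed]
  exact mul_ne_zero (Real.exp_pos _).ne' hg

/-- The hyperplane of vectors with coordinate sum zero. -/
def hyp (m : Type*) [Fintype m] : Submodule ℝ (m → ℝ) :=
  LinearMap.ker (∑ i, LinearMap.proj i : (m → ℝ) →ₗ[ℝ] ℝ)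

lemma mem_hyp {t : m → ℝ} : t ∈ hyp m ↔ ∑ i, t i = 0 := by
  simp [hyp, LinearMap.sum_apply]

lemma finrank_hyp [Nonempty m] : Module.finrank ℝ (hyp m) + 1 = Fintype.card m := by
  have h := LinearMap.finrank_range_add_finrank_ker (∑ i, LinearMap.proj i : (m → ℝ) →ₗ[ℝ] ℝ)
  have hs : LinearMap.range (∑ i, LinearMap.proj i : (m → ℝ) →ₗ[ℝ] ℝ) = ⊤ := by
    rw [LinearMap.range_eq_top]
    intro y
    obtain ⟨i⟩ := ‹Nonempty m›
    exact ⟨Pi.single i y, by simp [LinearMap.sum_apply]⟩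
  rw [hs, finrank_top, Module.finrank_self, Module.finrank_fintype_fun_eq_card] at h
  unfold hyp
  omega

/-- The projection of `ℝᵐ` onto the sum zero hyperplane along the constants. -/
def hypProj (m : Type*) [Fintype m] [Nonempty m] : (m → ℝ) →ₗ[ℝ] hyp m :=
  LinearMap.codRestrict (hyp m)
    { toFun := fun z j => z j - (∑ i, z i) / Fintype.card m
      map_add' := by intro x y; ext j; simp [Finset.sum_add_distrib]; ring
      map_smul' := by intro c x; ext j; simp [← Finset.mul_sum]; ring }
    (by
      intro z
      have h : (Fintype.card m : ℝ) ≠ 0 := by exact_mod_cast Fintype.card_ne_zero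
      classical
      rw [mem_hyp]
      simp [Finset.sum_sub_distrib]
      field_simp
      ring)

lemma hypProj_apply [Nonempty m] (z : m → ℝ) (j : m) :
    (hypProj m z : m → ℝ) j = z j - (∑ i, z i) / Fintype.card m := rfl

lemma hypProj_coe [Nonempty m] (x : hyp m) : hypProj m x = x := by
  ext j
  rw [hypProj_apply, mem_hyp.1 x.2]
  simp

lemma norm_hypProj_le [Nonempty m] (z : m → ℝ) : ‖hypProj m z‖ ≤ 2 * ‖z‖ := by
  rw [Submodule.coe_norm, pi_norm_le_iff_of_nonneg (by positivity)]
  intro j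
  have hc : (0 : ℝ) < Fintype.card m := by exact_mod_cast Fintype.card_pos
  have h1 : |∑ i, z i| ≤ Fintype.card m * ‖z‖ := by
    refine (Finset.abs_sum_le_sum_abs _ _).trans ?_
    refine (Finset.sum_le_sum fun i _ => norm_le_pi_norm z i).trans ?_
    simp
  have h2 : |(∑ i, z i) / (Fintype.card m : ℝ)| ≤ ‖z‖ := by
    rw [abs_div, abs_of_pos hc, div_le_iff₀ hc]; linarith
  rw [hypProj_apply, Real.norm_eq_abs]
  have h3 : |z j| ≤ ‖z‖ := norm_le_pi_norm z j
  have := abs_sub (z j) ((∑ i, z i) / (Fintype.card m : ℝ))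
  linarith

lemma hypProj_const [Nonempty m] (c : ℝ) : hypProj m (fun _ => c) = 0 := by
  have hc : (Fintype.card m : ℝ) ≠ 0 := by exact_mod_cast Fintype.card_ne_zero
  ext j
  rw [hypProj_apply]
  simp

lemma exists_low_rank_map [Nonempty m] {k : ℕ} (I : Fin k → m) (b : m → Fin k) :
    ∃ A : hyp m →L[ℝ] hyp m, ‖A‖ ≤ 2 ∧ crk A ≤ k - 1 ∧
      ∀ (C : ℝ) (x : hyp m), (∀ j, |(x : m → ℝ) j - (x : m → ℝ) (I (b j))| ≤ C) →
        ‖A x - x‖ ≤ 2 * C := by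
  let B : (Fin k → ℝ) →ₗ[ℝ] hyp m := (hypProj m).comp (LinearMap.funLeft ℝ ℝ b)
  let A₀ : hyp m →ₗ[ℝ] hyp m := B.comp ((LinearMap.funLeft ℝ ℝ I).comp (hyp m).subtype)
  have hA₀ : ∀ x : hyp m, A₀ x = hypProj m (fun j => (x : m → ℝ) (I (b j))) := fun x => rfl
  refine ⟨LinearMap.toContinuousLinearMap A₀, ?_, ?_, ?_⟩
  · refine ContinuousLinearMap.opNorm_le_bound _ (by norm_num) fun x => ?_
    rw [LinearMap.coe_toContinuousLinearMap', hA₀]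
    refine (norm_hypProj_le _).trans ?_
    gcongr
    rw [pi_norm_le_iff_of_nonneg (norm_nonneg _)]
    exact fun j => norm_le_pi_norm (x : m → ℝ) _
  · have h1 : crk (LinearMap.toContinuousLinearMap A₀) ≤ Module.finrank ℝ (LinearMap.range B) := by
      refine Submodule.finrank_mono ?_
      exact LinearMap.range_comp_le_range _ _
    have h2 := LinearMap.finrank_range_add_finrank_ker B
    have h3 : 0 < Module.finrank ℝ (LinearMap.ker B) := by
      rw [Module.finrank_pos_iff_exists_ne_zero]
      refine ⟨⟨fun _ => 1, ?_⟩, ?_⟩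
      · rw [LinearMap.mem_ker]
        exact hypProj_const 1
      · intro h
        obtain ⟨i⟩ := ‹Nonempty m›
        have := congrFun (congrArg Subtype.val h) (b i)
        simp at this
    rw [Module.finrank_fintype_fun_eq_card, Fintype.card_fin] at h2
    omega
  · intro C x hx
    have hC : 0 ≤ C := by
      obtain ⟨i⟩ := ‹Nonempty m›
      exact (abs_nonneg _).trans (hx i)
    rw [LinearMap.coe_toContinuousLinearMap', hA₀]
    have h1 : hypProj m (fun j => (x : m → ℝ) (I (b j))) - x =
        hypProj m ((fun j => (x : m → ℝ) (I (b j))) - (x : m → ℝ)) := by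
      rw [map_sub, hypProj_coe]
    rw [h1]
    refine (norm_hypProj_le _).trans ?_
    gcongr
    rw [pi_norm_le_iff_of_nonneg hC]
    intro j
    rw [Real.norm_eq_abs, Pi.sub_apply, abs_sub_comm]
    exact hx j

/-- The penalised log covolume of the subgroup spanned by the columns of `M`. -/
def pcov (ε : ℝ) (g : Matrix m m ℝ) {ι : Type*} [Fintype ι] [DecidableEq ι]
    (M : Matrix m ι ℤ) : ℝ :=
  Real.log (gd (g * zr M)) + ε * (Fintype.card ι * (Fintype.card m - Fintype.card ι))

/-- The subgroup spanned by the columns of `W` minimises `pcov` up to `η`. -/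
def NearMin (ε η : ℝ) (g : Matrix m m ℝ) {ι : Type*} [Fintype ι] [DecidableEq ι]
    (W : Matrix m ι ℤ) : Prop :=
  ∀ (k : ℕ) (M : Matrix m (Fin k) ℤ), ZInj M → pcov ε g W ≤ pcov ε g M + η

lemma NearMin.le {ε η : ℝ} {g : Matrix m m ℝ} {ι κ : Type*} [Fintype ι] [DecidableEq ι]
    [Fintype κ] [DecidableEq κ] {W : Matrix m ι ℤ} (h : NearMin ε η g W)
    {M : Matrix m κ ℤ} (hM : ZInj M) : pcov ε g W ≤ pcov ε g M + η := by
  have := h _ _ (hM.submatrix (Fintype.equivFin κ).symm)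
  rw [pcov, pcov, gd_mul_zr_submatrix, Fintype.card_fin] at this
  exact this

lemma pcov_le_add {ε : ℝ} {g : Matrix m m ℝ} (hg : g.det ≠ 0) (t s : m → ℝ)
    {ι : Type*} [Fintype ι] [DecidableEq ι] {M : Matrix m ι ℤ} (hM : ZInj M) :
    pcov ε (ed t * g) M ≤ pcov ε (ed s * g) M + 2 * Fintype.card m * dist t s := by
  have h1 : ed t * g * zr M = ed (t - s) * (ed s * g * zr M) := by
    have : ed t = ed (t - s) * ed s := by rw [← ed_add, sub_add_cancel]
    rw [this]; simp only [Matrix.mul_assoc]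
  have h2 := gd_ed_le (t := t - s) (c := dist t s) (fun i => by
    rw [Pi.sub_apply]
    exact (le_abs_self _).trans (by rw [← Real.dist_eq]; exact dist_le_pi_dist t s i))
    (ed s * g * zr M)
  rw [← h1] at h2
  have p1 := gd_pos (det_ed_mul_ne_zero hg t) hM
  have p2 := gd_pos (det_ed_mul_ne_zero hg s) hM
  have h3 := Real.log_le_log p1 h2
  rw [Real.log_mul (Real.exp_pos _).ne' p2.ne', Real.log_exp] at h3
  have h4 : (Fintype.card ι : ℝ) ≤ Fintype.card m := by exact_mod_cast hM.card_le
  unfold pcov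
  have : 2 * dist t s * Fintype.card ι ≤ 2 * Fintype.card m * dist t s := by
    have := mul_le_mul_of_nonneg_right h4 (dist_nonneg (x := t) (y := s))
    linarith
  linarith

lemma NearMin.of_dist {ε η : ℝ} {g : Matrix m m ℝ} (hg : g.det ≠ 0) {t s : m → ℝ}
    {ι : Type*} [Fintype ι] [DecidableEq ι] {W : Matrix m ι ℤ} (hW : ZInj W)
    (h : NearMin ε η (ed s * g) W) :
    NearMin ε (η + 4 * Fintype.card m * dist t s) (ed t * g) W := by
  intro k M hM
  have h1 := pcov_le_add (ε := ε) hg t s hW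
  have h2 := pcov_le_add (ε := ε) hg s t hM
  have h3 := h k M hM
  rw [dist_comm s t] at h2
  linarith

lemma rng_eq_of_nearMin {ε η : ℝ} (hη : η < ε) {g : Matrix m m ℝ} (hg : g.det ≠ 0) {k : ℕ}
    (hε : 0 < ε) {W₁ W₂ : Matrix m (Fin k) ℤ} (z1 : ZInj W₁) (z2 : ZInj W₂)
    (s1 : IsSat (rng W₁)) (s2 : IsSat (rng W₂))
    (h1 : NearMin ε η g W₁) (h2 : NearMin ε η g W₂) : rng W₁ = rng W₂ := by
  by_contra hne
  obtain ⟨p, q, a, b, c, hq, hpq, hz, hgd⟩ := exists_modular_pair z1 z2 s1 s2 hne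
  obtain ⟨e1, e2⟩ := hgd g hg
  have z1' := gd_pos hg z1
  have z2' := gd_pos hg z2
  have za := hz.fromCols_left
  have hN := gd_pos hg hz
  have ha := gd_pos hg za
  have hsub := gd_submodular (A := g * zr a) (B := g * zr b) (C := g * zr c) (by
    rw [← mul_fromCols, ← zr_fromCols, e1]; exact z1'.ne')
  rw [← mul_fromCols, ← mul_fromCols, ← mul_fromCols, ← mul_fromCols, ← zr_fromCols,
    ← zr_fromCols, ← zr_fromCols, ← zr_fromCols, e1, e2] at hsub
  have hl := Real.log_le_log (mul_pos hN ha) hsub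
  rw [Real.log_mul hN.ne' ha.ne', Real.log_mul z1'.ne' z2'.ne'] at hl
  have m1 := h1.le hz
  have m2 := h2.le za
  unfold pcov at m1 m2
  simp only [Fintype.card_sum, Fintype.card_fin, Nat.cast_add] at m1 m2
  have hk : (k : ℝ) = p + q := by exact_mod_cast hpq.symm
  rw [hk] at m1 m2
  have hq1 : (1 : ℝ) ≤ q := by exact_mod_cast hq
  nlinarith [mul_le_mul_of_nonneg_left (show (1 : ℝ) ≤ q * q by nlinarith) hε.le]

lemma one_le_gd_of_card_eq {g : Matrix m m ℝ} (hg : g.det ^ 2 = 1) {p : ℕ} {W : Matrix m (Fin p) ℤ}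
    (hW : ZInj W) (hpe : p = Fintype.card m) : 1 ≤ gd (g * zr W) := by
  have hg0 : g.det ≠ 0 := by
    intro h; rw [h] at hg; norm_num at hg
  have e : m ≃ Fin p := Fintype.equivOfCardEq (by simp [hpe])
  have h1 : gd (g * zr W) = (zr (W.submatrix id e)).det ^ 2 := by
    rw [← gd_mul_zr_submatrix g W e, gd_mul, gd_square, hg, mul_one]
  have h3 := gd_pos hg0 hW
  rw [h1, zr_det] at h3 ⊢
  have h4 : 0 < ((W.submatrix id e).det) ^ 2 := by exact_mod_cast h3
  have h5 : 1 ≤ ((W.submatrix id e).det) ^ 2 := h4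
  exact_mod_cast h5

lemma exists_nearMin {ε η ε₀ c₁ : ℝ} (hη : 0 < η) (hc₁ : 0 < c₁)
    (hε : 0 ≤ ε) (hε₀ : ε * Fintype.card m ^ 2 ≤ ε₀) {g : Matrix m m ℝ}
    (hg : g.det ^ 2 = 1)
    (hlow : ∀ k (W : Matrix m (Fin k) ℤ), ZInj W → c₁ ≤ gd (g * zr W)) (hns : ¬ NS ε₀ g) :
    ∃ Q : Submodule ℤ (m → ℤ), IsSat Q ∧ ∀ (p : ℕ) (W : Matrix m (Fin p) ℤ), ZInj W →
      rng W = Q → 0 < p ∧ p < Fintype.card m ∧ NearMin ε η g W := by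
  have hg0 : g.det ≠ 0 := by
    intro h; rw [h] at hg; norm_num at hg
  let S : Set ℝ := {x | ∃ (k : ℕ) (M : Matrix m (Fin k) ℤ), ZInj M ∧ x = pcov ε g M}
  have hpen : ∀ (k : ℕ) (M : Matrix m (Fin k) ℤ), ZInj M →
      0 ≤ ε * ((k : ℝ) * (Fintype.card m - k)) ∧
      ε * ((k : ℝ) * (Fintype.card m - k)) ≤ ε₀ := by
    intro k M hM
    have h4 : (k : ℝ) ≤ Fintype.card m := by
      have := hM.card_le
      rw [Fintype.card_fin] at this
      exact_mod_cast this
    have h5 : (0 : ℝ) ≤ k := k.cast_nonneg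
    constructor
    · have : (0 : ℝ) ≤ Fintype.card m - k := by linarith
      positivity
    · refine le_trans ?_ hε₀
      gcongr
      nlinarith
  have hbdd : BddBelow S := by
    refine ⟨Real.log c₁, ?_⟩
    rintro _ ⟨k, M, hM, rfl⟩
    have := Real.log_le_log hc₁ (hlow k M hM)
    have := (hpen k M hM).1
    unfold pcov
    rw [Fintype.card_fin]
    linarith
  unfold NS at hns
  push Not at hns
  obtain ⟨k₀, M₀, hM₀, hlt⟩ := hns
  have hI : sInf S < 0 := by
    refine (csInf_le hbdd ⟨k₀, M₀, hM₀, rfl⟩).trans_lt ?_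
    have := Real.log_lt_log (gd_pos hg0 hM₀) hlt
    rw [Real.log_exp] at this
    have := (hpen k₀ M₀ hM₀).2
    unfold pcov
    rw [Fintype.card_fin]
    linarith
  obtain ⟨_, ⟨k, M, hM, rfl⟩, hlt'⟩ := exists_lt_of_csInf_lt (s := S) ⟨_, ⟨k₀, M₀, hM₀, rfl⟩⟩
    (show sInf S < min (sInf S + η) 0 by rw [lt_min_iff]; exact ⟨by linarith, hI⟩)
  rw [lt_min_iff] at hlt'
  obtain ⟨Q, hQ, hMQ, hcard⟩ := exists_saturation hM
  refine ⟨Q, hQ, fun p W hW hWQ => ?_⟩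
  have hpk : p = k := by simpa using hcard (Fin p) W hW hWQ
  subst hpk
  have hle : pcov ε g W ≤ pcov ε g M := by
    have := Real.log_le_log (gd_pos hg0 hW)
      (gd_le_of_rng_le hg0 rfl hM (by rw [hWQ]; exact hMQ))
    unfold pcov
    linarith
  have hneg : pcov ε g W < 0 := hle.trans_lt hlt'.2
  refine ⟨?_, ?_, ?_⟩
  · rcases Nat.eq_zero_or_pos p with rfl | h
    · exfalso
      unfold pcov at hneg
      rw [gd_of_isEmpty] at hneg
      simp at hneg
    · exact h
  · by_contra hp
    have hpe : p = Fintype.card m := by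
      have := hW.card_le
      rw [Fintype.card_fin] at this
      omega
    have h3 := Real.log_nonneg (one_le_gd_of_card_eq hg hW hpe)
    unfold pcov at hneg
    rw [Fintype.card_fin] at hneg
    have := (hpen p W hW).1
    linarith
  · intro k' M' hM'
    have := csInf_le hbdd ⟨k', M', hM', rfl⟩
    linarith [hlt'.1]

end nearstable

section main
variable {m : Type} [Fintype m] [DecidableEq m]

theorem exists_ns_of_normBdd {c : ℝ} (hc : 0 < c) {g : Matrix m m ℝ} (hg : g.det ^ 2 = 1)
    (hN : NormBdd c g) (hcard : 2 ≤ Fintype.card m) {ε₀ : ℝ} (hε₀ : 0 < ε₀) :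
    ∃ t : m → ℝ, ∑ i, t i = 0 ∧ NS ε₀ (ed t * g) := by
  have hne : Nonempty m := Fintype.card_pos_iff.1 (by omega)
  have hN1 : NormBdd (min c 1) g := fun x hx => (min_le_left _ _).trans (hN x hx)
  have hc1 : 0 < min c 1 := by positivity
  have hg0 : g.det ≠ 0 := by
    intro h; rw [h] at hg; norm_num at hg
  by_contra! hcon
  set n : ℝ := ((Fintype.card m : ℕ) : ℝ) with hn
  have hn0 : 0 < n := by rw [hn]; exact_mod_cast Fintype.card_pos
  set ε : ℝ := min ε₀ 1 / n ^ 2 with hε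
  have hε0 : 0 < ε := by positivity
  have hεn : ε * n ^ 2 = min ε₀ 1 := by rw [hε]; field_simp
  have hε1 : ε ≤ 1 := by
    have h1 : (1 : ℝ) ≤ n ^ 2 := by
      have : (1 : ℝ) ≤ n := by rw [hn]; exact_mod_cast Fintype.card_pos
      nlinarith
    rw [hε, div_le_one (by positivity)]
    exact (min_le_right _ _).trans h1
  set δ : ℝ := ε / (64 * n) with hδ
  have hδ0 : 0 < δ := by positivity
  obtain ⟨c₁, hc₁, hlow⟩ := exists_gd_lower (m := m) hc1 (min_le_right _ _)
  obtain ⟨C, hC⟩ := exists_affine_model (m := m) hc1 (min_le_right _ _)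
  choose p a ha hr using exists_basis (m := m)
  have hfr := finrank_hyp (m := m)
  have : Nontrivial (hyp m) := Module.nontrivial_of_finrank_pos (R := ℝ) (by omega)
  obtain ⟨R, hR, hcov⟩ := no_cover (E := hyp m) hδ0 2 (2 * C)
  let ι : Type := {Q : Submodule ℤ (m → ℤ) // IsSat Q ∧ 0 < p Q ∧ p Q < Fintype.card m}
  let F : ι → Set (hyp m) := fun Q =>
    {t | ‖t‖ ≤ R ∧ NearMin ε (ε / 4) (ed (t : m → ℝ) * g) (a Q.1)}
  have hmodel : ∀ Q : ι, ∃ (A : hyp m →L[ℝ] hyp m) (c : hyp m), ‖A‖ ≤ 2 ∧ crk A ≤ p Q.1 - 1 ∧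
      ∀ t ∈ F Q, ‖A t + c - t‖ ≤ 2 * C := by
    intro Q
    obtain ⟨t₀, I, b, ht₀, hF⟩ := hC g hN1 hg0 R (p Q.1) Q.2.2.1 (a Q.1) (ha _)
      {t | ∃ s ∈ F Q, (s : m → ℝ) = t} (by
        rintro _ ⟨s, hs, rfl⟩
        refine ⟨mem_hyp.1 s.2, hs.1, ?_⟩
        have h1 := hs.2 0 (Matrix.of fun _ j => j.elim0) (fun x _ => Subsingleton.elim _ _)
        have h0 : ∀ X : Matrix m (Fin 0) ℝ, gd X = 1 := fun X => gd_of_isEmpty X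
        unfold pcov at h1
        rw [h0] at h1
        simp only [Fintype.card_fin, Real.log_one, Nat.cast_zero] at h1
        have h2 : 0 ≤ ε * ((p Q.1 : ℝ) * (Fintype.card m - p Q.1)) := by
          have : (p Q.1 : ℝ) ≤ Fintype.card m := by exact_mod_cast Q.2.2.2.le
          have : (0 : ℝ) ≤ Fintype.card m - p Q.1 := by linarith
          positivity
        have h3 : Real.log (gd (ed (s : m → ℝ) * g * zr (a Q.1))) ≤ 1 := by linarith
        rw [Real.log_le_iff_le_exp (gd_pos (det_ed_mul_ne_zero hg0 _) (ha _))] at h3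
        exact h3.trans (by linarith [Real.exp_one_lt_d9]))
    obtain ⟨A, hA2, hAr, hA⟩ := exists_low_rank_map I b
    refine ⟨A, ⟨t₀, mem_hyp.2 ht₀⟩ - A ⟨t₀, mem_hyp.2 ht₀⟩, hA2, hAr, fun t ht => ?_⟩
    have h1 := hA C (t - ⟨t₀, mem_hyp.2 ht₀⟩) (fun j => hF t ⟨t, ht, rfl⟩ j)
    rw [map_sub] at h1
    refine le_of_eq_of_le ?_ h1
    congr 1
    abel
  choose A cc hA2 hAr hAc using hmodel
  obtain ⟨x, hxR, hx⟩ := hcov ι F A cc (fun Q => p Q.1 - 1) hA2 hAc (by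
    rintro ⟨Q₁, hQ₁, hp₁, hp₁'⟩ ⟨Q₂, hQ₂, hp₂, hp₂'⟩ hne hrr t ht s hs
    by_contra! hd
    refine hne (Subtype.ext ?_)
    have hpp : p Q₁ = p Q₂ := by
      dsimp only at hrr; omega
    have hd' : dist (t : m → ℝ) (s : m → ℝ) < 4 * δ := hd
    have h1 : NearMin ε (ε / 4) (ed (t : m → ℝ) * g) (a Q₁) := ht.2
    have h2 := NearMin.of_dist (t := (t : m → ℝ)) hg0 (ha _) hs.2
    have hb : ε / 4 + 4 * Fintype.card m * dist (t : m → ℝ) (s : m → ℝ) ≤ ε / 2 := by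
      have : 4 * n * (4 * δ) = ε / 4 := by rw [hδ]; field_simp; norm_num
      have : 4 * n * dist (t : m → ℝ) (s : m → ℝ) ≤ 4 * n * (4 * δ) := by gcongr
      rw [← hn]
      linarith
    have key : ∀ (k₁ k₂ : ℕ) (W₁ : Matrix m (Fin k₁) ℤ) (W₂ : Matrix m (Fin k₂) ℤ), k₁ = k₂ →
        ZInj W₁ → ZInj W₂ → IsSat (rng W₁) → IsSat (rng W₂) →
        NearMin ε (ε / 4) (ed (t : m → ℝ) * g) W₁ →
        NearMin ε (ε / 4 + 4 * Fintype.card m * dist (t : m → ℝ) (s : m → ℝ))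
          (ed (t : m → ℝ) * g) W₂ → rng W₁ = rng W₂ := by
      rintro k₁ k₂ W₁ W₂ rfl z1 z2 s1 s2 m1 m2
      have hlt : ε / 2 < ε := by linarith
      refine rng_eq_of_nearMin (g := ed (t : m → ℝ) * g) hlt (det_ed_mul_ne_zero hg0 _) hε0
        z1 z2 s1 s2 (fun k M hM => ?_) (fun k M hM => ?_)
      · have := m1 k M hM
        linarith
      · have := m2 k M hM
        linarith
    have := key _ _ _ _ hpp (ha Q₁) (ha Q₂) (by rwa [hr]) (by rwa [hr]) h1 h2
    rwa [hr, hr] at this)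
    hAr (by
      rintro ⟨Q, hQ, h1, h2⟩
      dsimp only
      omega)
  have hdet : (ed (x : m → ℝ) * g).det ^ 2 = 1 := by
    rw [det_mul, det_ed, mem_hyp.1 x.2, Real.exp_zero, one_mul, hg]
  obtain ⟨Q, hQ, hQW⟩ := exists_nearMin (η := ε / 4) (by linarith) hc₁ hε0.le
    (show ε * (Fintype.card m : ℝ) ^ 2 ≤ ε₀ by rw [← hn, hεn]; exact min_le_left _ _) hdet
    (fun k W hW => hlow _ (hN1.ed_mul (mem_hyp.1 x.2)) (det_ed_mul_ne_zero hg0 _) k W hW)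
    (hcon x (mem_hyp.1 x.2))
  obtain ⟨q1, q2, q3⟩ := hQW _ (a Q) (ha Q) (hr Q)
  exact hx ⟨Q, hQ, q1, q2⟩ ⟨hxR, q3⟩

end main

section nsbasic
variable {m τ ρ κ : Type*} [Fintype m] [DecidableEq m] [Fintype τ] [DecidableEq τ]
  [Fintype ρ] [DecidableEq ρ] [Fintype κ] [DecidableEq κ]

lemma NS.submatrix {ε : ℝ} {g : Matrix τ m ℝ} (h : NS ε g) (s : ρ ≃ τ) (e : κ ≃ m) :
    NS ε (g.submatrix s e) := by
  intro k M hM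
  have hz : ZInj (M.submatrix e.symm id) := by
    intro x hx
    refine hM x ?_
    ext i
    have := congrFun hx (e i)
    simpa [mulVec, dotProduct] using this
  have h1 := h k _ hz
  have h2 : g.submatrix s e * zr M = (g * zr (M.submatrix e.symm id)).submatrix s id := by
    ext i j
    simp only [mul_apply, submatrix_apply, zr, map_apply, id]
    exact Fintype.sum_equiv e _ _ (fun x => by simp)
  rw [h2, gd_submatrix_row]
  exact h1

lemma NS.mul_zr {ε : ℝ} {g : Matrix τ m ℝ} {U U' : Matrix m m ℤ} (hU : U' * U = 1)
    (h : NS ε g) : NS ε (g * zr U) := by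
  intro k M hM
  rw [Matrix.mul_assoc, ← zr_mul]
  refine h k _ fun x hx => hM x ?_
  rw [← mulVec_mulVec] at hx
  have := congrArg (U' *ᵥ ·) hx
  simpa [mulVec_mulVec, ← Matrix.mul_assoc, hU] using this

lemma NS.of_mul_zr {ε : ℝ} {g : Matrix τ m ℝ} {U U' : Matrix m m ℤ} (hU : U * U' = 1)
    (h : NS ε (g * zr U)) : NS ε g := by
  have h1 := h.mul_zr (U := U') (U' := U) hU
  rw [Matrix.mul_assoc, ← zr_mul, hU, zr_one, Matrix.mul_one] at h1
  exact h1

lemma NS.fromBlocks {ε : ℝ} {P : Matrix m m ℝ} {R : Matrix τ τ ℝ} (hP : P.det ≠ 0)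
    (hR : R.det ≠ 0) (nP : NS ε P) (nR : NS ε R) (Q : Matrix m τ ℝ) :
    NS (2 * ε) (fromBlocks P Q 0 R) := by
  intro k M hM
  have hdet : (Matrix.fromBlocks P Q 0 R).det ≠ 0 := by
    rw [det_fromBlocks_zero₂₁]; exact mul_ne_zero hP hR
  let T : Submodule ℤ (m ⊕ τ → ℤ) :=
    { carrier := {x | x ∈ rng M ∧ ∀ i, x (Sum.inr i) = 0}
      zero_mem' := ⟨zero_mem _, fun _ => rfl⟩
      add_mem' := by
        rintro x y ⟨hx, hx'⟩ ⟨hy, hy'⟩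
        exact ⟨add_mem hx hy, fun i => by rw [Pi.add_apply, hx', hy', add_zero]⟩
      smul_mem' := by
        rintro c x ⟨hx, hx'⟩
        exact ⟨Submodule.smul_mem _ c hx, fun i => by rw [Pi.smul_apply, hx', smul_zero]⟩ }
  obtain ⟨p, q, a, b, hz, ha, hab⟩ := exists_adapted_basis (P := T) (Q := rng M)
    (fun x hx => hx.1) (by
      rintro c x hc hx ⟨_, h⟩
      refine ⟨hx, fun i => ?_⟩
      have := h i
      rw [Pi.smul_apply, smul_eq_mul] at this
      exact (mul_eq_zero.1 this).resolve_left hc)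
  have hr : rng (fromCols a b) = rng M := by
    ext x; rw [mem_rng, hab]
  have ha0 : ∀ i j, a (Sum.inr i) j = 0 := by
    intro i j
    have h1 : a *ᵥ Pi.single j 1 ∈ T := (ha _).2 ⟨_, rfl⟩
    have := h1.2 i
    rwa [mulVec_single_one] at this
  rw [gd_eq_of_rng_eq hdet hM hz hr.symm]
  have hmul : Matrix.fromBlocks P Q 0 R * zr (fromCols a b) =
      Matrix.fromBlocks (P * zr (a.submatrix Sum.inl id))
        (P * zr (b.submatrix Sum.inl id) + Q * zr (b.submatrix Sum.inr id)) 0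
        (R * zr (b.submatrix Sum.inr id)) := by
    have : zr (fromCols a b) = Matrix.fromBlocks (zr (a.submatrix Sum.inl id))
        (zr (b.submatrix Sum.inl id)) 0 (zr (b.submatrix Sum.inr id)) := by
      ext i j
      rcases i with i | i <;> rcases j with j | j <;> simp [zr, ha0]
    rw [this, fromBlocks_multiply]
    simp
  have za : ZInj (a.submatrix Sum.inl id) := by
    intro x hx
    refine hz.fromCols_left x ?_
    ext i
    rcases i with i | i
    · exact congrFun hx i
    · simp [mulVec, dotProduct, ha0]
  have zb : ZInj (b.submatrix Sum.inr id) := by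
    intro y hy
    have h1 : b *ᵥ y ∈ T := by
      refine ⟨(hab _).2 ⟨Sum.elim 0 y, ?_⟩, fun i => congrFun hy i⟩
      rw [fromCols_mulVec_eq]
      simp
    obtain ⟨z, hz'⟩ := (ha _).1 h1
    have h2 := hz (Sum.elim (-z) y) (by
      rw [fromCols_mulVec_eq]
      simp [mulVec_neg, hz'])
    ext i
    exact congrFun h2 (Sum.inr i)
  rw [hmul]
  have ga := gd_pos hP za
  refine le_trans ?_ (gd_fromBlocks_ge ga.ne' _ _)
  rw [show -(2 * ε) = -ε + -ε by ring, Real.exp_add]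
  exact mul_le_mul (nP _ _ za) (nR _ _ zb) (Real.exp_pos _).le ga.le

open scoped Matrix.Norms.L2Operator in
lemma eventually_mulVec_le {α : Type*} {l : Filter α} {T : α → Matrix m m ℝ}
    (hT : Tendsto T l (𝓝 1)) {c : ℝ} (hc : 1 < c) :
    ∀ᶠ j in l, ∀ x, (T j *ᵥ x) ⬝ᵥ (T j *ᵥ x) ≤ c * (x ⬝ᵥ x) := by
  have h1 : Tendsto (fun j => ‖T j‖ ^ 2) l (𝓝 (‖(1 : Matrix m m ℝ)‖ ^ 2)) := hT.norm.pow 2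
  have h2 : ‖(1 : Matrix m m ℝ)‖ ^ 2 < c := by
    cases isEmpty_or_nonempty m
    · rw [Subsingleton.elim (1 : Matrix m m ℝ) 0, norm_zero]; norm_num; linarith
    · rw [CStarRing.norm_one]; simpa using hc
  filter_upwards [h1.eventually_lt_const h2] with j hj x
  have h3 := l2_opNorm_mulVec (T j) ((EuclideanSpace.equiv m ℝ).symm x)
  have h4 : ∀ y : m → ℝ, ‖(EuclideanSpace.equiv m ℝ).symm y‖ ^ 2 = y ⬝ᵥ y := by
    intro y
    rw [EuclideanSpace.real_norm_sq_eq]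
    simp [dotProduct, pow_two]
  have h5 := pow_le_pow_left₀ (norm_nonneg _) h3 2
  rw [mul_pow, h4 x] at h5
  have h6 : (EuclideanSpace.equiv m ℝ).symm ((T j) *ᵥ (EuclideanSpace.equiv m ℝ).symm x)
     = (EuclideanSpace.equiv m ℝ).symm ((T j) *ᵥ x) := rfl
  rw [h6, h4] at h5
  refine h5.trans ?_
  have : 0 ≤ x ⬝ᵥ x := by rw [← h4]; positivity
  gcongr

lemma eventually_ns {α : Type*} {l : Filter α} {A : α → Matrix m m ℝ} {A₀ : Matrix m m ℝ}
    (hA : Tendsto A l (𝓝 A₀)) (h0 : A₀.det ≠ 0) {ε ε' : ℝ} (h : NS ε A₀) (hε : ε < ε') :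
    ∀ᶠ j in l, NS ε' (A j) := by
  have hinv : Tendsto (fun j => A₀ * (A j)⁻¹) l (𝓝 1) := by
    have h1 : ContinuousAt (fun B : Matrix m m ℝ => B⁻¹) A₀ := by
      simp only [Matrix.inv_def, Ring.inverse_eq_inv']
      refine ContinuousAt.smul (f := fun B : Matrix m m ℝ => B.det⁻¹)
        (g := fun B : Matrix m m ℝ => B.adjugate) ?_ ?_
      · exact (continuous_id.matrix_det.continuousAt).inv₀ h0
      · exact continuous_id.matrix_adjugate.continuousAt
    have h2 := (h1.tendsto.comp hA).const_mul A₀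
    rw [mul_nonsing_inv _ (isUnit_iff_ne_zero.2 h0)] at h2
    exact h2
  set n : ℝ := ((Fintype.card m : ℕ) : ℝ) with hn
  have hn0 : 0 ≤ n := by positivity
  have hc : 1 < Real.exp ((ε' - ε) / (n + 1)) := by
    rw [Real.one_lt_exp_iff]
    have : 0 < ε' - ε := by linarith
    positivity
  have hdet : ∀ᶠ j in l, (A j).det ≠ 0 :=
    ((continuous_id.matrix_det.tendsto A₀).comp hA).eventually_ne h0
  filter_upwards [hdet, eventually_mulVec_le hinv hc] with j hj hT k M hM
  have h1 := gd_mul_le (A₀ * (A j)⁻¹) (A j * zr M) hT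
  rw [← Matrix.mul_assoc, Matrix.mul_assoc A₀, nonsing_inv_mul _ (isUnit_iff_ne_zero.2 hj),
    Matrix.mul_one, Fintype.card_fin, ← Real.exp_nat_mul] at h1
  have h2 := (h k M hM).trans h1
  have hk : (k : ℝ) ≤ n := by
    have := hM.card_le
    rw [Fintype.card_fin] at this
    rw [hn]; exact_mod_cast this
  have h3 : (k : ℝ) * ((ε' - ε) / (n + 1)) ≤ ε' - ε := by
    rw [mul_div_assoc', div_le_iff₀ (by positivity)]
    nlinarith
  have h4 : Real.exp (k * ((ε' - ε) / (n + 1))) ≤ Real.exp (ε' - ε) := Real.exp_le_exp.2 h3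
  have h5 : Real.exp (-ε) ≤ Real.exp (ε' - ε) * gd (A j * zr M) :=
    h2.trans (mul_le_mul_of_nonneg_right h4 (gd_nonneg _))
  have h6 : Real.exp (-ε) = Real.exp (ε' - ε) * Real.exp (-ε') := by
    rw [← Real.exp_add]; ring_nf
  rw [h6] at h5
  exact le_of_mul_le_mul_left h5 (Real.exp_pos _)

end nsbasic

section gap

lemma exists_add_prod_eq {m : Type*} [Fintype m] [Nonempty m] {τ : ℝ} (hτ : 0 < τ) {y : m → ℝ}
    (hy : |∏ i, y i| < τ ^ Fintype.card m) :
    ∃ s > 0, ∏ i, (|y i| + s) = τ ^ Fintype.card m := by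
  have hc : Continuous fun s : ℝ => ∏ i, (|y i| + s) := by fun_prop
  have h0 : ∏ i, (|y i| + 0) < τ ^ Fintype.card m := by
    simp only [add_zero]; rwa [← Finset.abs_prod]
  have h1 : τ ^ Fintype.card m ≤ ∏ i, (|y i| + τ) := by
    rw [← Finset.card_univ, ← Finset.prod_const]
    exact Finset.prod_le_prod (fun _ _ => hτ.le) fun i _ => by linarith [abs_nonneg (y i)]
  obtain ⟨s, hs, hse⟩ := intermediate_value_Icc hτ.le hc.continuousOn ⟨h0.le, h1⟩
  refine ⟨s, lt_of_le_of_ne hs.1 ?_, hse⟩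
  rintro rfl
  exact h0.ne hse

lemma exists_small_vector {m : Type*} [Fintype m] [DecidableEq m] [Nonempty m] {τ : ℝ}
    (hτ : 0 < τ) {g : Matrix m m ℝ} (hg : ¬ NormBdd (τ ^ Fintype.card m) g) :
    ∃ (t : m → ℝ) (x : m → ℤ), ∑ i, t i = 0 ∧ x ≠ 0 ∧
      ∀ i, |((ed t * g) *ᵥ fun j => (x j : ℝ)) i| ≤ τ := by
  unfold NormBdd at hg
  push Not at hg
  obtain ⟨x, hx, hlt⟩ := hg
  obtain ⟨s, hs, hp⟩ := exists_add_prod_eq hτ hlt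
  set y := g *ᵥ fun j => (x j : ℝ) with hy
  have hpos : ∀ i, 0 < |y i| + s := fun i => by positivity
  refine ⟨fun i => Real.log τ - Real.log (|y i| + s), x, ?_, hx, fun i => ?_⟩
  · rw [Finset.sum_sub_distrib, ← Real.log_prod (fun i _ => (hpos i).ne'), hp]
    simp [Real.log_pow]
  · rw [ed_mul_mulVec, ← hy, abs_mul, abs_of_pos (Real.exp_pos _), Real.exp_sub,
      Real.exp_log hτ, Real.exp_log (hpos i), div_mul_eq_mul_div, div_le_iff₀ (hpos i)]
    have := abs_nonneg (y i)
    nlinarith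

lemma exists_gap {n : ℕ} {D : Fin n → ℝ} {θ : ℝ} (hn : 0 < n) (hθ : 0 < θ) (hθ1 : θ < 1)
    (hD : ∀ i, 0 < D i) (hprod : ∏ i, D i = 1)
    (h0 : ∀ i : Fin n, (i : ℕ) = 0 → D i ≤ θ ^ n) :
    ∃ i j : Fin n, (j : ℕ) = i + 1 ∧ D i ≤ θ * D j := by
  by_contra! hcon
  have h1 : ∀ (d : ℕ) (hd : d < n), D ⟨d, hd⟩ * θ ^ d ≤ θ ^ n := by
    intro d
    induction d with
    | zero => intro hd; simpa using h0 ⟨0, hd⟩ rfl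
    | succ d ih =>
      intro hd
      refine le_trans ?_ (ih (by omega))
      rw [pow_succ', ← mul_assoc]
      have := hcon ⟨d, by omega⟩ ⟨d + 1, hd⟩ rfl
      have h2 : 0 < θ ^ d := by positivity
      nlinarith
  have h2 : ∀ i, D i < 1 := by
    intro i
    have h3 := h1 i i.2
    have h4 : θ ^ n < θ ^ (i : ℕ) := pow_lt_pow_right_of_lt_one₀ hθ hθ1 i.2
    have h5 : 0 < θ ^ (i : ℕ) := by positivity
    by_contra! h6
    have : θ ^ (i : ℕ) ≤ D i * θ ^ (i : ℕ) := by nlinarith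
    have h7 : D ⟨i, i.2⟩ = D i := rfl
    linarith
  have h3 : ∏ i, D i < ∏ _i : Fin n, (1 : ℝ) :=
    Finset.prod_lt_prod_of_nonempty (fun i _ => hD i) (fun i _ => h2 i) ⟨⟨0, hn⟩, Finset.mem_univ _⟩
  rw [hprod] at h3
  simp at h3

lemma toSquareBlockProp_mul_of_zero {n : Type*} [Fintype n] [DecidableEq n] (p : n → Prop) [DecidablePred p]
    (L u : Matrix n n ℝ) (hL : ∀ i j, p i → ¬ p j → L i j = 0) :
    toSquareBlockProp (L * u) p = toSquareBlockProp L p * toSquareBlockProp u p := by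
  ext i j
  simp only [toSquareBlockProp_def, of_apply, mul_apply]
  rw [← Fintype.sum_subtype_add_sum_subtype p]
  rw [add_eq_left]
  exact Finset.sum_eq_zero fun b _ => by rw [hL i b i.2 b.2, zero_mul]

/-- The matrices `ed t * g * zr U`, up to a permutation of the rows, with `|entries| ≤ B`, whose
lower left block has entries at most `θ` and whose upper left block has determinant `±1`. -/
def NearBlock {n : ℕ} (g : Matrix (Fin n) (Fin n) ℝ) (k : ℕ) (B θ : ℝ)
    (Y : Matrix (Fin n) (Fin n) ℝ) : Prop :=
  (∃ (s : Equiv.Perm (Fin n)) (t : Fin n → ℝ) (U U' : Matrix (Fin n) (Fin n) ℤ),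
    ∑ i, t i = 0 ∧ U * U' = 1 ∧ U' * U = 1 ∧ ed t * g.submatrix s id * zr U = Y) ∧
  (∀ i j, |Y i j| ≤ B) ∧ (∀ i j : Fin n, (j : ℕ) < k → k ≤ i → |Y i j| ≤ θ) ∧
  (toSquareBlockProp Y fun i => (i : ℕ) < k).det ^ 2 = 1

lemma exists_nearBlock {n : ℕ} (hn : 0 < n) {g : Matrix (Fin n) (Fin n) ℝ} (hg : g.det ^ 2 = 1)
    (h : ∀ c > 0, ¬ NormBdd c g) {θ : ℝ} (hθ : 0 < θ) (hθ1 : θ < 1) :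
    ∃ k Y, 0 < k ∧ k < n ∧ NearBlock g k (n * 2 ^ n) (n * (4 ^ n * θ)) Y := by
  have : Nonempty (Fin n) := ⟨⟨0, hn⟩⟩
  obtain ⟨t, x, ht, hx, hsmall⟩ := exists_small_vector (τ := θ ^ n) (g := g) (by positivity)
    (h _ (by positivity))
  have hdet : (ed t * g).det ^ 2 = 1 := by
    rw [det_mul, det_ed, ht, Real.exp_zero, one_mul, hg]
  obtain ⟨U, U', V, u, σ, hU, hU', hY, hR⟩ := exists_sup_red (ed t * g) (by
    rw [gd_square, hdet]; norm_num)
  set D : Fin n → ℝ := fun j => |V (σ j) j| with hD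
  have hDpos : ∀ j, 0 < D j := fun j => abs_pos.2 (hR.ne j)
  have hσ : Function.Injective σ := by
    intro i j hij
    rcases lt_trichotomy i j with hlt | heq | hlt
    · exact absurd (by rw [← hij]; exact hR.piv i j hlt) (hR.ne j)
    · exact heq
    · exact absurd (by rw [hij]; exact hR.piv j i hlt) (hR.ne i)
  let s : Equiv.Perm (Fin n) := Equiv.ofBijective σ (Finite.injective_iff_bijective.1 hσ)
  have hs : ∀ i, s i = σ i := fun i => rfl
  have hprod2 : (∏ j, V (σ j) j) ^ 2 = 1 := by
    have h1 : (V.submatrix s id).det = ∏ j, V (σ j) j :=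
      det_of_isLowerTriangular (V.submatrix σ id) (fun i j hij => hR.piv i j hij)
    rw [← h1, det_permute, mul_pow]
    have h2 : (V.det * u.det) ^ 2 = 1 := by
      rw [← det_mul, ← hY, det_mul, mul_pow, hdet, det_sq_of_inv hU, one_mul]
    rw [hR.det_u, mul_one] at h2
    rw [h2, mul_one]
    rcases Int.units_eq_one_or (Equiv.Perm.sign s) with h3 | h3 <;> simp [h3]
  have hprod : ∏ j, D j = 1 := by
    have h1 : (∏ j, D j) ^ 2 = 1 := by rw [hD, ← Finset.abs_prod, sq_abs, hprod2]
    have h2 : 0 < ∏ j, D j := Finset.prod_pos fun j _ => hDpos j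
    nlinarith
  have h0 : ∀ i : Fin n, (i : ℕ) = 0 → D i ≤ θ ^ n := by
    intro i hi
    obtain ⟨r, hr⟩ := hR.min (U' *ᵥ x) i (by
      by_contra! hz
      apply hx
      have h1 : U' *ᵥ x = 0 := funext hz
      have h2 := congrArg (U *ᵥ ·) h1
      simpa [mulVec_mulVec, hU] using h2) hi
    refine hr.trans ?_
    rw [← zr_mulVec, ← hY, mulVec_mulVec, Matrix.mul_assoc, ← zr_mul, hU, zr_one,
      Matrix.mul_one]
    exact hsmall r
  obtain ⟨a, b, hab, hgap⟩ := exists_gap hn hθ hθ1 hDpos hprod h0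
  have hstep : ∀ (d : ℕ) (i j : Fin n), (j : ℕ) = i + d → D i ≤ 2 ^ d * D j := by
    intro d
    induction d with
    | zero =>
      intro i j hij
      have : i = j := Fin.ext (by omega)
      rw [this]; simp
    | succ d ih =>
      intro i j hij
      have h1 := ih i ⟨i + d, by omega⟩ rfl
      have h2 : D ⟨i + d, by omega⟩ ≤ 2 * D j := hR.step _ _ hij
      rw [pow_succ]
      have : (0 : ℝ) < 2 ^ d := by positivity
      nlinarith
  have hmono : ∀ i j : Fin n, i ≤ j → D i ≤ 2 ^ n * D j := by
    intro i j hij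
    have hij' : (i : ℕ) ≤ j := hij
    refine (hstep (j - i) i j (by omega)).trans ?_
    have := hDpos j
    gcongr
    · norm_num
    · omega
  set L : Matrix (Fin n) (Fin n) ℝ := Matrix.of fun i j => V (σ i) j / D i with hL
  have hL0 : ∀ i j, i < j → L i j = 0 := by
    intro i j hij
    rw [hL, of_apply, hR.piv i j hij, zero_div]
  have hLle : ∀ i j, |L i j| ≤ D j / D i := by
    intro i j
    rw [hL, of_apply, abs_div, abs_of_pos (hDpos i)]
    have := hDpos i
    gcongr
    exact hR.max _ _
  have hb : ∀ (C : ℝ) (i j : Fin n), (∀ l, l ≤ i → l ≤ j → D l ≤ C * D i) → 0 ≤ C →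
      |(L * u) i j| ≤ n * C := by
    intro C i j hC hC0
    rw [mul_apply]
    refine (Finset.abs_sum_le_sum_abs _ _).trans ?_
    have : (n : ℝ) * C = ∑ _l : Fin n, C := by simp
    rw [this]
    refine Finset.sum_le_sum fun l _ => ?_
    rw [abs_mul]
    rcases lt_or_ge i l with h1 | h1
    · rw [hL0 i l h1]; simpa using hC0
    rcases lt_or_ge j l with h2 | h2
    · rw [hR.low l j h2]; simpa using hC0
    have h3 : |L i l| ≤ C := (hLle i l).trans (by rw [div_le_iff₀ (hDpos i)]; exact hC l h1 h2)
    have h4 := hR.abs_u l j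
    have h5 := abs_nonneg (u l j)
    nlinarith
  refine ⟨b, L * u, by omega, b.2, ⟨s, fun i => t (σ i) - Real.log (D i), U, U', ?_, hU, hU', ?_⟩,
    fun i j => hb _ i j (fun l hl _ => hmono l i hl) (by positivity), fun i j hj hi => ?_, ?_⟩
  · rw [Finset.sum_sub_distrib, ← Real.log_prod (fun i _ => (hDpos i).ne'), hprod, Real.log_one,
      sub_zero, ← ht]
    exact Fintype.sum_equiv s _ _ fun i => rfl
  · have h1 : ed (fun i => t (σ i) - Real.log (D i)) * g.submatrix s id =
        diagonal (fun i => (D i)⁻¹) * (ed t * g).submatrix σ id := by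
      ext i j
      simp only [ed, diagonal_mul, submatrix_apply, id, hs]
      rw [Real.exp_sub, Real.exp_log (hDpos i)]
      ring
    have h2 : (ed t * g).submatrix σ id * zr U = (V * u).submatrix σ id := by
      rw [← hY]; rfl
    rw [h1, Matrix.mul_assoc, h2]
    ext i j
    rw [diagonal_mul, submatrix_apply, mul_apply, mul_apply, Finset.mul_sum]
    refine Finset.sum_congr rfl fun l _ => ?_
    simp only [id, hL, of_apply]
    ring
  · refine hb _ i j (fun l hl hlj => ?_) (by positivity)
    have h1 : l ≤ a := by
      have : (l : ℕ) ≤ j := hlj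
      exact Fin.le_def.2 (by omega)
    have h2 := hmono l a h1
    have h3 := hmono b i (Fin.le_def.2 hi)
    have h4 : (4 : ℝ) ^ n = 2 ^ n * 2 ^ n := by rw [← mul_pow]; norm_num
    calc D l ≤ 2 ^ n * D a := h2
      _ ≤ 2 ^ n * (θ * (2 ^ n * D i)) := by gcongr; exact hgap.trans (by gcongr)
      _ = 4 ^ n * θ * D i := by rw [h4]; ring
  · have hu : (toSquareBlockProp u fun i : Fin n => (i : ℕ) < b).det = 1 := by
      rw [det_of_isUpperTriangular (M := toSquareBlockProp u fun i : Fin n => (i : ℕ) < b)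
        (fun i j hij => hR.low _ _ hij)]
      exact Finset.prod_eq_one fun i _ => hR.diag i
    have hl : (toSquareBlockProp L fun i : Fin n => (i : ℕ) < b).det =
        ∏ i : {i : Fin n // (i : ℕ) < b}, L i i :=
      det_of_isLowerTriangular (toSquareBlockProp L fun i : Fin n => (i : ℕ) < b)
        (fun i j hij => hL0 _ _ hij)
    rw [toSquareBlockProp_mul_of_zero _ _ _ (fun i j hi hj => hL0 i j (Fin.lt_def.2 (by omega))),
      det_mul, hu, hl, mul_one, ← Finset.prod_pow]
    refine Finset.prod_eq_one fun i _ => ?_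
    rw [hL, of_apply, div_pow, hD, sq_abs]
    exact div_self (pow_ne_zero 2 (hR.ne _))

end gap

section all

lemma ns_of_card_le_one {m : Type*} [Fintype m] [DecidableEq m] (hm : Fintype.card m ≤ 1)
    {g : Matrix m m ℝ} (hg : g.det ^ 2 = 1) {ε : ℝ} (hε : 0 ≤ ε) : NS ε g := by
  intro k M hM
  have h1 : Real.exp (-ε) ≤ 1 := Real.exp_le_one_iff.2 (by linarith)
  have h2 := hM.card_le
  rw [Fintype.card_fin] at h2
  rcases Nat.eq_zero_or_pos k with rfl | hk
  · rwa [gd_of_isEmpty]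
  · exact h1.trans (one_le_gd_of_card_eq hg hM (by omega))

lemma exists_ns_of_blockTriangular {m : Type} [Fintype m] [DecidableEq m] {Y : Matrix m m ℝ}
    (p : m → Prop) [DecidablePred p] (h : ∀ i, ¬ p i → ∀ j, p j → Y i j = 0)
    (hY : Y.det ^ 2 = 1) (hP : (toSquareBlockProp Y p).det ^ 2 = 1) {ε : ℝ}
    (ih₁ : ∀ g : Matrix {i // p i} {i // p i} ℝ, g.det ^ 2 = 1 →
      ∃ t, ∑ i, t i = 0 ∧ NS ε (ed t * g))
    (ih₂ : ∀ g : Matrix {i // ¬ p i} {i // ¬ p i} ℝ, g.det ^ 2 = 1 →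
      ∃ t, ∑ i, t i = 0 ∧ NS ε (ed t * g)) :
    ∃ T : m → ℝ, ∑ i, T i = 0 ∧ NS (2 * ε) (ed T * Y) := by
  set P := toSquareBlockProp Y p with hPd
  set R := toSquareBlockProp Y fun i => ¬ p i with hRd
  have hR : R.det ^ 2 = 1 := by
    rw [twoBlockTriangular_det Y p h, mul_pow, hP, one_mul] at hY
    exact hY
  obtain ⟨t₁, hs₁, h₁⟩ := ih₁ P hP
  obtain ⟨t₂, hs₂, h₂⟩ := ih₂ R hR
  have hne : ∀ {κ : Type} [Fintype κ] [DecidableEq κ] (t : κ → ℝ) (G : Matrix κ κ ℝ),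
      G.det ^ 2 = 1 → (ed t * G).det ≠ 0 := by
    intro κ _ _ t G hG
    rw [det_mul, det_ed]
    exact mul_ne_zero (Real.exp_pos _).ne' fun h0 => by rw [h0] at hG; norm_num at hG
  let T : m → ℝ := fun i => if hi : p i then t₁ ⟨i, hi⟩ else t₂ ⟨i, hi⟩
  have hT₁ : ∀ i : {i // p i}, T i = t₁ i := fun i => dif_pos i.2
  have hT₂ : ∀ i : {i // ¬ p i}, T i = t₂ i := fun i => dif_neg i.2
  refine ⟨T, ?_, ?_⟩
  · rw [← Fintype.sum_subtype_add_sum_subtype p]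
    simp only [hT₁, hT₂, hs₁, hs₂, add_zero]
  · have h3 := NS.fromBlocks (hne t₁ P hP) (hne t₂ R hR) h₁ h₂
      (ed t₁ * toBlock Y p fun i => ¬ p i)
    have h4 := h3.submatrix (Equiv.sumCompl p).symm (Equiv.sumCompl p).symm
    have h5 : ed T * Y = (Matrix.fromBlocks (ed t₁ * P) (ed t₁ * toBlock Y p fun i => ¬ p i) 0
        (ed t₂ * R)).submatrix (Equiv.sumCompl p).symm (Equiv.sumCompl p).symm := by
      rw [← Equiv.symm_symm (Equiv.sumCompl p)]
      have : (ed T * Y).submatrix (Equiv.sumCompl p) (Equiv.sumCompl p) =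
          Matrix.fromBlocks (ed t₁ * P) (ed t₁ * toBlock Y p fun i => ¬ p i) 0 (ed t₂ * R) := by
        ext (i | i) (j | j)
        · simp [ed, diagonal_mul, hT₁, hPd, toSquareBlockProp_def]
        · simp [ed, diagonal_mul, hT₁, toBlock]
        · simp [ed, diagonal_mul, h i i.2 j j.2]
        · simp [ed, diagonal_mul, hT₂, hRd, toSquareBlockProp_def]
      rw [← this]
      simp
    rw [h5]
    exact h4

lemma NearBlock.mono {n : ℕ} {g Y : Matrix (Fin n) (Fin n) ℝ} {k : ℕ} {B θ θ' : ℝ}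
    (h : NearBlock g k B θ Y) (hθ : θ ≤ θ') : NearBlock g k B θ' Y :=
  ⟨h.1, h.2.1, fun i j hj hi => (h.2.2.1 i j hj hi).trans hθ, h.2.2.2⟩

lemma exists_nearBlock_index {n : ℕ} (hn : 0 < n) {g : Matrix (Fin n) (Fin n) ℝ}
    (hg : g.det ^ 2 = 1) (h : ∀ c > 0, ¬ NormBdd c g) :
    ∃ k, 0 < k ∧ k < n ∧ ∀ θ > 0, ∃ Y, NearBlock g k (n * 2 ^ n) θ Y := by
  by_contra! hcon
  have h1 : ∀ k : Fin n, ∃ θ > 0, 0 < (k : ℕ) → ∀ Y, ¬ NearBlock g k (n * 2 ^ n) θ Y := by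
    intro k
    rcases Nat.eq_zero_or_pos (k : ℕ) with h0 | h0
    · exact ⟨1, one_pos, fun h => absurd h (by omega)⟩
    · obtain ⟨θ, hθ, h2⟩ := hcon k h0 k.2
      exact ⟨θ, hθ, fun _ => h2⟩
  choose θ hθ hθY using h1
  have : Nonempty (Fin n) := ⟨⟨0, hn⟩⟩
  obtain ⟨k₀, -, hk₀⟩ := Finset.exists_min_image Finset.univ θ Finset.univ_nonempty
  have hC : (0 : ℝ) < n * 4 ^ n := by positivity
  have hm : 0 < min (1 / 2) (θ k₀ / (n * 4 ^ n)) := lt_min (by norm_num) (div_pos (hθ k₀) hC)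
  obtain ⟨k, Y, hk, hkn, hY⟩ := exists_nearBlock hn hg h hm
    (lt_of_le_of_lt (min_le_left _ _) (by norm_num))
  refine hθY ⟨k, hkn⟩ hk Y (hY.mono ?_)
  refine le_trans ?_ (hk₀ ⟨k, hkn⟩ (Finset.mem_univ _))
  rw [← mul_assoc]
  calc (n : ℝ) * 4 ^ n * min (1 / 2) (θ k₀ / (n * 4 ^ n))
      ≤ n * 4 ^ n * (θ k₀ / (n * 4 ^ n)) := by gcongr; exact min_le_right _ _
    _ = θ k₀ := by field_simp

lemma NearBlock.det_sq {n : ℕ} {g Y : Matrix (Fin n) (Fin n) ℝ} {k : ℕ} {B θ : ℝ}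
    (h : NearBlock g k B θ Y) (hg : g.det ^ 2 = 1) : Y.det ^ 2 = 1 := by
  obtain ⟨⟨s, t, U, U', ht, hU, hU', rfl⟩, -⟩ := h
  rw [det_mul, det_mul, det_ed, ht, Real.exp_zero, one_mul, mul_pow, det_sq_of_inv hU, mul_one,
    det_permute, mul_pow, hg]
  rcases Int.units_eq_one_or (Equiv.Perm.sign s) with h3 | h3 <;> simp [h3]

lemma exists_blockTriangular_limit {n : ℕ} {g : Matrix (Fin n) (Fin n) ℝ} (hg : g.det ^ 2 = 1)
    {k : ℕ} {B : ℝ} (h : ∀ θ > 0, ∃ Y, NearBlock g k B θ Y) :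
    ∃ (Y : ℕ → Matrix (Fin n) (Fin n) ℝ) (Y₀ : Matrix (Fin n) (Fin n) ℝ),
      Tendsto Y atTop (𝓝 Y₀) ∧ (∀ j, ∃ θ, NearBlock g k B θ (Y j)) ∧
      (∀ i : Fin n, ¬ (i : ℕ) < k → ∀ j : Fin n, (j : ℕ) < k → Y₀ i j = 0) ∧ Y₀.det ^ 2 = 1 ∧
      (toSquareBlockProp Y₀ fun i => (i : ℕ) < k).det ^ 2 = 1 := by
  choose Y hY using fun j : ℕ => h (1 / ((j : ℝ) + 1)) (by positivity)
  have hK : IsCompact (Set.univ.pi fun _ : Fin n => Set.univ.pi fun _ : Fin n => Set.Icc (-B) B) :=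
    isCompact_univ_pi fun _ => isCompact_univ_pi fun _ => isCompact_Icc
  obtain ⟨Y₀, -, φ, hφ, hlim⟩ := hK.tendsto_subseq (X := Fin n → Fin n → ℝ) (x := Y)
    (fun j i _ l _ => abs_le.1 ((hY j).2.1 i l))
  have hlim' : Tendsto (fun j => Y (φ j)) atTop (𝓝 (Y₀ : Matrix (Fin n) (Fin n) ℝ)) := hlim
  refine ⟨fun j => Y (φ j), Y₀, hlim', fun j => ⟨_, hY (φ j)⟩, fun i hi j hj => ?_, ?_, ?_⟩
  · have h1 : Tendsto (fun l => |Y (φ l) i j|) atTop (𝓝 |Y₀ i j|) :=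
      (((continuous_id.matrix_elem i j).tendsto Y₀).comp hlim').abs
    have h2 : Tendsto (fun l : ℕ => 1 / (((φ l : ℕ) : ℝ) + 1)) atTop (𝓝 0) :=
      tendsto_one_div_add_atTop_nhds_zero_nat.comp hφ.tendsto_atTop
    have h3 := le_of_tendsto_of_tendsto' h1 h2 fun l => (hY (φ l)).2.2.1 i j hj (by omega)
    exact abs_nonpos_iff.1 h3
  · have hc : Continuous fun X : Matrix (Fin n) (Fin n) ℝ => X.det ^ 2 := by fun_prop
    have h1 := (hc.tendsto Y₀).comp hlim'
    refine tendsto_nhds_unique h1 ?_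
    simp only [Function.comp_def, (hY _).det_sq hg]
    exact tendsto_const_nhds
  · have hc : Continuous fun X : Matrix (Fin n) (Fin n) ℝ =>
        (toSquareBlockProp X fun i : Fin n => (i : ℕ) < k).det ^ 2 := by
      refine Continuous.pow (Continuous.matrix_det ?_) 2
      exact continuous_matrix fun i j => continuous_id.matrix_elem _ _
    have h1 := (hc.tendsto Y₀).comp hlim'
    refine tendsto_nhds_unique h1 ?_
    simp only [Function.comp_def, (hY _).2.2.2]
    exact tendsto_const_nhds

lemma NearBlock.exists_ns {n : ℕ} {g Y : Matrix (Fin n) (Fin n) ℝ} {k : ℕ} {B θ ε : ℝ}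
    (h : NearBlock g k B θ Y) {T : Fin n → ℝ} (hT : ∑ i, T i = 0) (hN : NS ε (ed T * Y)) :
    ∃ t, ∑ i, t i = 0 ∧ NS ε (ed t * g) := by
  obtain ⟨⟨s, t, U, U', ht, hU, hU', rfl⟩, -⟩ := h
  rw [← Matrix.mul_assoc] at hN
  have h1 := hN.of_mul_zr hU
  have h2 := h1.submatrix s.symm (Equiv.refl _)
  refine ⟨fun i => T (s.symm i) + t (s.symm i), ?_, ?_⟩
  · rw [Finset.sum_add_distrib, Equiv.sum_comp s.symm T, Equiv.sum_comp s.symm t, hT, ht, add_zero]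
  · convert h2 using 1
    ext i j
    simp [ed, diagonal_mul, Real.exp_add, mul_assoc]

/-- Every orbit of the diagonal group comes arbitrarily close to the stable lattices. -/
theorem exists_ns (n : ℕ) : ∀ (m : Type) [Fintype m] [DecidableEq m], Fintype.card m = n →
    ∀ g : Matrix m m ℝ, g.det ^ 2 = 1 → ∀ ε > 0, ∃ t, ∑ i, t i = 0 ∧ NS ε (ed t * g) := by
  induction n using Nat.strong_induction_on with
  | _ n ih =>
  intro m _ _ hm g hg ε hε
  rcases le_or_gt n 1 with h1 | h1
  · refine ⟨0, by simp, ns_of_card_le_one (by omega) ?_ hε.le⟩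
    rw [det_mul, det_ed]
    simpa using hg
  suffices h : ∀ g : Matrix (Fin n) (Fin n) ℝ, g.det ^ 2 = 1 →
      ∃ t, ∑ i, t i = 0 ∧ NS ε (ed t * g) by
    let e : Fin n ≃ m := (Fintype.equivFinOfCardEq hm).symm
    obtain ⟨t, ht, hN⟩ := h (g.submatrix e e) (by rwa [det_submatrix_equiv_self])
    refine ⟨t ∘ e.symm, ?_, ?_⟩
    · rw [← ht]; exact Equiv.sum_comp e.symm t
    · convert hN.submatrix e.symm e.symm using 1
      ext i j
      simp [ed, diagonal_mul]
  intro g hg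
  by_cases hN : ∃ c > 0, NormBdd c g
  · obtain ⟨c, hc, hN⟩ := hN
    exact exists_ns_of_normBdd hc hg hN (by rw [Fintype.card_fin]; omega) hε
  push Not at hN
  obtain ⟨k, hk, hkn, hY⟩ := exists_nearBlock_index (by omega) hg hN
  obtain ⟨Y, Y₀, hlim, hnb, h0, hd, hP⟩ := exists_blockTriangular_limit hg hY
  have hc₁ : Fintype.card {i : Fin n // (i : ℕ) < k} < n := by
    have := Fintype.card_subtype_lt (p := fun i : Fin n => (i : ℕ) < k) (x := ⟨k, hkn⟩) (by simp)
    simpa using this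
  have hc₂ : Fintype.card {i : Fin n // ¬ (i : ℕ) < k} < n := by
    have := Fintype.card_subtype_lt (p := fun i : Fin n => ¬ (i : ℕ) < k) (x := ⟨0, by omega⟩)
      (by simp; omega)
    simpa using this
  obtain ⟨T, hT, hNT⟩ := exists_ns_of_blockTriangular (fun i : Fin n => (i : ℕ) < k) h0 hd hP
    (ε := ε / 4) (fun g hg => ih _ hc₁ _ rfl g hg _ (by linarith))
    (fun g hg => ih _ hc₂ _ rfl g hg _ (by linarith))
  have hlim' : Tendsto (fun j => ed T * Y j) atTop (𝓝 (ed T * Y₀)) := hlim.const_mul _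
  obtain ⟨j, hj⟩ := (eventually_ns hlim' (by
    rw [det_mul, det_ed]
    exact mul_ne_zero (Real.exp_pos _).ne' fun h => by rw [h] at hd; norm_num at hd) hNT
    (ε' := ε) (by linarith)).exists
  obtain ⟨θ, hθ⟩ := hnb j
  exact hθ.exists_ns hT hj

end all

section covolume

lemma mem_closure_cols {n r : ℕ} (G : Matrix (Fin n) (Fin r) ℝ) (w : Fin n → ℝ) :
    w ∈ AddSubgroup.closure (Set.range G.col) ↔ ∃ x : Fin r → ℤ, (G *ᵥ fun i => (x i : ℝ)) = w := by
  rw [← Submodule.span_int_eq_addSubgroupClosure, Submodule.mem_toAddSubgroup,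
    Submodule.mem_span_range_iff_exists_fun]
  refine exists_congr fun x => ?_
  have : ∑ i, x i • G.col i = G *ᵥ fun i => (x i : ℝ) := by
    ext i
    simp [mulVec, dotProduct, mul_comm]
  rw [this]

lemma gvol_col {n r : ℕ} (G : Matrix (Fin n) (Fin r) ℝ) : gvol G.col = Real.sqrt (gd G) := by
  unfold gvol gd
  congr 2

lemma gd_ne_zero_iff_linearIndependent {n r : ℕ} (G : Matrix (Fin n) (Fin r) ℝ) :
    gd G ≠ 0 ↔ LinearIndependent ℝ G.col := by
  rw [gd_ne_zero_iff, ← Matrix.mulVec_injective_iff]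
  constructor
  · intro h x y hxy
    have := h (x - y) (by rw [mulVec_sub, sub_eq_zero]; exact hxy)
    exact sub_eq_zero.1 this
  · intro h x hx
    exact h (by rw [hx, mulVec_zero])

lemma gd_eq_of_same_lattice {n : ℕ} {G G' : Matrix (Fin n) (Fin n) ℝ} (hG : gd G ≠ 0)
    (h₁ : ∀ x : Fin n → ℤ, ∃ y : Fin n → ℤ, (G *ᵥ fun i => (y i : ℝ)) = G' *ᵥ fun i => (x i : ℝ))
    (h₂ : ∀ x : Fin n → ℤ, ∃ y : Fin n → ℤ, (G' *ᵥ fun i => (y i : ℝ)) = G *ᵥ fun i => (x i : ℝ)) :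
    gd G' = gd G := by
  have key : ∀ {A B : Matrix (Fin n) (Fin n) ℝ},
      (∀ x : Fin n → ℤ, ∃ y : Fin n → ℤ, (A *ᵥ fun i => (y i : ℝ)) = B *ᵥ fun i => (x i : ℝ)) →
      ∃ M : Matrix (Fin n) (Fin n) ℤ, A * zr M = B := by
    intro A B h
    choose y hy using fun j : Fin n => h (Pi.single j 1)
    refine ⟨Matrix.of fun i j => y j i, ?_⟩
    ext i j
    have h1 := congrFun (hy j) i
    have h2 : (fun i => ((Pi.single j 1 : Fin n → ℤ) i : ℝ)) = Pi.single j 1 := by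
      ext i
      by_cases hi : i = j
      · subst hi; simp
      · simp [hi]
    rw [h2, mulVec_single_one] at h1
    rw [← show B.col j i = B i j from rfl, ← h1]
    rfl
  obtain ⟨M, hM⟩ := key h₁
  obtain ⟨M', hM'⟩ := key h₂
  have h3 : G * zr (M * M') = G := by rw [zr_mul, ← Matrix.mul_assoc, hM, hM']
  have hdet : G.det ≠ 0 := fun h => hG (by rw [gd_square, h]; norm_num)
  have h4 : ((zr M).det * (zr M').det) = 1 := by
    have := congrArg Matrix.det h3
    rw [det_mul, zr_mul, det_mul] at this
    exact mul_left_cancel₀ hdet (this.trans (mul_one _).symm)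
  have h5 : (zr M).det ^ 2 = 1 := by
    rw [zr_det, zr_det] at h4
    rw [zr_det]
    have h6 : M.det * M'.det = 1 := by exact_mod_cast h4
    rcases Int.eq_one_or_neg_one_of_mul_eq_one h6 with h | h <;> rw [h] <;> norm_num
  rw [← hM, gd_mul, h5, one_mul]

lemma exists_square_of_covolSpec {n : ℕ} {L : AddSubgroup (Fin n → ℝ)}
    (hL : Submodule.span ℝ (L : Set (Fin n → ℝ)) = ⊤) {c : ℝ} (h : covolSpec L c) :
    ∃ G : Matrix (Fin n) (Fin n) ℝ, gd G ≠ 0 ∧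
      (∀ w, w ∈ L ↔ ∃ x : Fin n → ℤ, (G *ᵥ fun i => (x i : ℝ)) = w) ∧ c = Real.sqrt (gd G) := by
  obtain ⟨r, v, hv, rfl, rfl⟩ := h
  have h1 : Submodule.span ℝ (Set.range v) = ⊤ := by
    rw [eq_top_iff, ← hL, Submodule.span_le]
    exact (AddSubgroup.closure_le (Submodule.span ℝ (Set.range v)).toAddSubgroup).2
      Submodule.subset_span
  have h2 := finrank_span_eq_card hv
  rw [h1, finrank_top, Module.finrank_fin_fun, Fintype.card_fin] at h2
  subst h2
  let G : Matrix (Fin n) (Fin n) ℝ := Matrix.of fun i j => v j i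
  have hG : G.col = v := rfl
  rw [← hG] at hv ⊢
  exact ⟨G, (gd_ne_zero_iff_linearIndependent G).2 hv, mem_closure_cols G, gvol_col G⟩

lemma covol_eq {n : ℕ} {L : AddSubgroup (Fin n → ℝ)}
    (hL : Submodule.span ℝ (L : Set (Fin n → ℝ)) = ⊤) {c : ℝ} (h : covolSpec L c) : covol L = c := by
  obtain ⟨G, hG, hGm, hc⟩ := exists_square_of_covolSpec hL h
  have : {c | covolSpec L c} = {c} := by
    ext c'
    refine ⟨fun h' => ?_, fun h' => by rw [Set.mem_singleton_iff.1 h']; exact h⟩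
    obtain ⟨G', hG', hGm', hc'⟩ := exists_square_of_covolSpec hL h'
    rw [Set.mem_singleton_iff, hc, hc', gd_eq_of_same_lattice hG
      (fun x => (hGm _).1 ((hGm' _).2 ⟨x, rfl⟩)) (fun x => (hGm' _).1 ((hGm _).2 ⟨x, rfl⟩))]
  rw [covol, this, csInf_singleton]

lemma exists_matrix_of_isUnimodularLattice {n : ℕ} {L : AddSubgroup (Fin n → ℝ)}
    (h : IsUnimodularLattice L) : ∃ G : Matrix (Fin n) (Fin n) ℝ, G.det ^ 2 = 1 ∧
      ∀ w, w ∈ L ↔ ∃ x : Fin n → ℤ, (G *ᵥ fun i => (x i : ℝ)) = w := by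
  have hne : {c | covolSpec L c}.Nonempty := by
    by_contra h0
    have := h.2
    rw [covol, Set.not_nonempty_iff_eq_empty.1 h0, Real.sInf_empty] at this
    norm_num at this
  obtain ⟨c, hc⟩ := hne
  obtain ⟨G, hG, hGm, hcG⟩ := exists_square_of_covolSpec h.1.2 hc
  refine ⟨G, ?_, hGm⟩
  have h1 : Real.sqrt (gd G) = 1 := by rw [← hcG, ← covol_eq h.1.2 hc, h.2]
  rw [← gd_square]
  simpa using h1

/-- A lower bound on the nonzero vectors of a lattice, as needed for its discreteness. -/
lemma isUnimodularLattice_closure_cols {n : ℕ} {G : Matrix (Fin n) (Fin n) ℝ} (hG : G.det ^ 2 = 1)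
    {c : ℝ} (hc : 0 < c) (h : ∀ x : Fin n → ℤ, x ≠ 0 →
      c ≤ (G *ᵥ fun i => (x i : ℝ)) ⬝ᵥ (G *ᵥ fun i => (x i : ℝ))) :
    IsUnimodularLattice (AddSubgroup.closure (Set.range G.col)) := by
  have hgd : gd G ≠ 0 := by rw [gd_square, hG]; norm_num
  have hli := (gd_ne_zero_iff_linearIndependent G).1 hgd
  have hspan : Submodule.span ℝ (AddSubgroup.closure (Set.range G.col) : Set (Fin n → ℝ)) = ⊤ := by
    rw [eq_top_iff, ← hli.span_eq_top_of_card_eq_finrank' (by simp)]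
    exact Submodule.span_mono AddSubgroup.subset_closure
  refine ⟨⟨discreteTopology_of_isOpen_singleton_zero ?_, hspan⟩, ?_⟩
  · have hc' : Continuous fun w : AddSubgroup.closure (Set.range G.col) =>
        (w : Fin n → ℝ) ⬝ᵥ (w : Fin n → ℝ) := by fun_prop
    convert (isOpen_Iio (a := c)).preimage hc' using 1
    ext w
    refine ⟨fun hw => ?_, fun hw => ?_⟩
    · rw [Set.mem_singleton_iff.1 hw]; simpa using hc
    · obtain ⟨x, hx⟩ := (mem_closure_cols G w).1 w.2
      by_contra hne
      have hx0 : x ≠ 0 := by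
        rintro rfl
        apply hne
        rw [Set.mem_singleton_iff]
        ext1
        rw [← hx]
        have h0 : (fun i => (((0 : Fin n → ℤ) i : ℤ) : ℝ)) = 0 := by ext; simp
        rw [h0, mulVec_zero]
        rfl
      have := h x hx0
      rw [hx] at this
      exact absurd hw (not_lt.2 this)
  · rw [covol_eq hspan ⟨n, G.col, hli, rfl, rfl⟩, gvol_col, gd_square, hG, Real.sqrt_one]

end covolume

section hermite

lemma enorm_eq {n : ℕ} (v : Fin n → ℝ) : enorm v = Real.sqrt (v ⬝ᵥ v) := by
  simp only [enorm, dotProduct, pow_two]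

lemma dotProduct_self_nonneg' {κ : Type*} [Fintype κ] (v : κ → ℝ) : 0 ≤ v ⬝ᵥ v :=
  Finset.sum_nonneg fun i _ => mul_self_nonneg (v i)

lemma mulVec_dotProduct_of_orthogonal {m κ : Type*} [Fintype m] [Fintype κ] [DecidableEq κ]
    {Q : Matrix m κ ℝ} (hQ : Qᵀ * Q = 1) (v : κ → ℝ) : (Q *ᵥ v) ⬝ᵥ (Q *ᵥ v) = v ⬝ᵥ v := by
  rw [dotProduct_mulVec, ← mulVec_transpose, mulVec_mulVec, hQ, one_mulVec]

lemma IsKZ.gd_eq {k : ℕ} {A : Fin k → ℝ} {R : Matrix (Fin k) (Fin k) ℝ} (h : IsKZ A R) :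
    gd R = (∏ i, A i) ^ 2 := by
  rw [gd_square, det_of_isUpperTriangular (fun i j hij => h.low i j hij)]
  simp only [h.diag]

lemma IsKZ.chain {k : ℕ} {A : Fin k → ℝ} {R : Matrix (Fin k) (Fin k) ℝ} (h : IsKZ A R)
    (hk : 0 < k) (i : Fin k) : (3 / 4) ^ (i : ℕ) * A ⟨0, hk⟩ ^ 2 ≤ A i ^ 2 := by
  obtain ⟨i, hi⟩ := i
  induction i with
  | zero => simp
  | succ i ih =>
    have h1 := ih (by omega)
    have h2 := h.three_quarters (i := ⟨i, by omega⟩) (j := ⟨i + 1, hi⟩) rfl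
    rw [pow_succ']
    simp only at h1 ⊢
    linarith

lemma IsKZ.lower {k : ℕ} {A : Fin k → ℝ} {R : Matrix (Fin k) (Fin k) ℝ} (h : IsKZ A R)
    (hk : 0 < k) (i : Fin k) : (3 / 4) ^ k * A ⟨0, hk⟩ ^ 2 ≤ A i ^ 2 := by
  refine le_trans ?_ (h.chain hk i)
  have : (3 / 4 : ℝ) ^ k ≤ (3 / 4) ^ (i : ℕ) :=
    pow_le_pow_of_le_one (by norm_num) (by norm_num) i.2.le
  gcongr

lemma IsKZ.first_le {k : ℕ} {A : Fin k → ℝ} {R : Matrix (Fin k) (Fin k) ℝ} (h : IsKZ A R)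
    (hk : 0 < k) (h1 : (∏ i, A i) ^ 2 = 1) : A ⟨0, hk⟩ ^ 2 ≤ (4 / 3) ^ k := by
  by_contra! hcon
  have h2 : ∀ i, 1 < A i ^ 2 := by
    intro i
    refine lt_of_lt_of_le ?_ (h.lower hk i)
    have : (3 / 4 : ℝ) ^ k * (4 / 3) ^ k = 1 := by rw [← mul_pow]; norm_num
    rw [← this]
    gcongr
  have : Nonempty (Fin k) := ⟨⟨0, hk⟩⟩
  have h3 : ∏ _i : Fin k, (1 : ℝ) < ∏ i, A i ^ 2 :=
    Finset.prod_lt_prod_of_nonempty (fun _ _ => one_pos) (fun i _ => h2 i) Finset.univ_nonempty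
  rw [Finset.prod_pow, h1] at h3
  simp at h3

lemma IsKZ.min_first {k : ℕ} {A : Fin k → ℝ} {R : Matrix (Fin k) (Fin k) ℝ} (h : IsKZ A R)
    (hk : 0 < k) (x : Fin k → ℤ) (hx : x ≠ 0) :
    A ⟨0, hk⟩ ^ 2 ≤ (R *ᵥ fun i => (x i : ℝ)) ⬝ᵥ (R *ᵥ fun i => (x i : ℝ)) := by
  obtain ⟨i, hi⟩ := Function.ne_iff.1 hx
  refine (h.min ⟨0, hk⟩ x ⟨i, Fin.mk_le_of_le_val (Nat.zero_le _), hi⟩).trans (le_of_eq ?_)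
  rw [dotProduct]
  refine Finset.sum_congr rfl fun i _ => ?_
  rw [if_pos (Fin.mk_le_of_le_val (Nat.zero_le _)), pow_two]

/-- The nonzero minimum of a unimodular quadratic form is attained, and is bounded in terms of the
dimension only. -/
lemma exists_minimum {n : ℕ} (hn : 0 < n) {G : Matrix (Fin n) (Fin n) ℝ} (hG : G.det ^ 2 = 1) :
    ∃ c > 0, c ^ 2 ≤ (4 / 3) ^ n ∧ (∀ x : Fin n → ℤ, x ≠ 0 →
      c ^ 2 ≤ (G *ᵥ fun i => (x i : ℝ)) ⬝ᵥ (G *ᵥ fun i => (x i : ℝ))) ∧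
      ∃ x : Fin n → ℤ, x ≠ 0 ∧
        (G *ᵥ fun i => (x i : ℝ)) ⬝ᵥ (G *ᵥ fun i => (x i : ℝ)) = c ^ 2 := by
  obtain ⟨U, U', Q, A, R, hU, hU', hQ, hGU, hA, hK⟩ := exists_kz G (by
    rw [gd_square, hG]; norm_num)
  have key : ∀ y : Fin n → ℤ, (G *ᵥ fun i => ((U *ᵥ y) i : ℝ)) ⬝ᵥ (G *ᵥ fun i => ((U *ᵥ y) i : ℝ)) =
      (R *ᵥ fun i => (y i : ℝ)) ⬝ᵥ (R *ᵥ fun i => (y i : ℝ)) := by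
    intro y
    rw [← zr_mulVec, mulVec_mulVec, hGU, ← mulVec_mulVec, mulVec_dotProduct_of_orthogonal hQ]
  have hprod : (∏ i, A i) ^ 2 = 1 := by
    rw [← hK.gd_eq, gd_square]
    have h1 : (Q.det) ^ 2 = 1 := by
      have := congrArg Matrix.det hQ
      rw [det_mul, det_transpose, det_one] at this
      rw [pow_two, this]
    have h2 := congrArg (fun M => M.det ^ 2) hGU
    simp only [det_mul, mul_pow, hG, h1, det_sq_of_inv hU, one_mul] at h2
    exact h2.symm
  refine ⟨A ⟨0, hn⟩, hA _, hK.first_le hn hprod, fun x hx => ?_, U *ᵥ Pi.single ⟨0, hn⟩ 1, ?_, ?_⟩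
  · have h1 : U *ᵥ (U' *ᵥ x) = x := by rw [mulVec_mulVec, hU, one_mulVec]
    rw [← h1, key]
    refine hK.min_first hn _ fun h => hx ?_
    rw [← h1, h, mulVec_zero]
  · intro h
    have := congrArg (U' *ᵥ ·) h
    simp only [mulVec_mulVec, hU', one_mulVec, mulVec_zero] at this
    simpa using congrFun this ⟨0, hn⟩
  · rw [key]
    have h2 : (fun i => ((Pi.single ⟨0, hn⟩ 1 : Fin n → ℤ) i : ℝ)) = Pi.single ⟨0, hn⟩ 1 := by
      ext i
      by_cases hi : i = ⟨0, hn⟩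
      · subst hi; simp
      · simp [hi]
    rw [h2, mulVec_single_one, dotProduct, Fintype.sum_eq_single ⟨0, hn⟩]
    · change R _ _ * R _ _ = _
      rw [hK.diag, pow_two]
    · intro i hi
      change R _ _ * R _ _ = _
      rw [hK.low _ _ (Fin.lt_def.2 (Nat.pos_of_ne_zero fun h => hi (Fin.ext h))), zero_mul]

lemma shortest_eq {n : ℕ} {L : AddSubgroup (Fin n → ℝ)} {G : Matrix (Fin n) (Fin n) ℝ}
    (hG : ∀ w, w ∈ L ↔ ∃ x : Fin n → ℤ, (G *ᵥ fun i => (x i : ℝ)) = w) {c : ℝ} (hc : 0 < c)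
    (hmin : ∀ x : Fin n → ℤ, x ≠ 0 →
      c ^ 2 ≤ (G *ᵥ fun i => (x i : ℝ)) ⬝ᵥ (G *ᵥ fun i => (x i : ℝ)))
    (hex : ∃ x : Fin n → ℤ, x ≠ 0 ∧
        (G *ᵥ fun i => (x i : ℝ)) ⬝ᵥ (G *ᵥ fun i => (x i : ℝ)) = c ^ 2) : shortest L = c := by
  refine IsLeast.csInf_eq ⟨?_, ?_⟩
  · obtain ⟨x, hx, hxc⟩ := hex
    refine ⟨_, (hG _).2 ⟨x, rfl⟩, fun h => ?_, ?_⟩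
    · rw [h, dotProduct_zero] at hxc
      exact (pow_pos hc 2).ne hxc
    · rw [enorm_eq, hxc, Real.sqrt_sq hc.le]
  · rintro t ⟨w, hw, hw0, rfl⟩
    obtain ⟨x, rfl⟩ := (hG w).1 hw
    rw [enorm_eq]
    refine Real.le_sqrt_of_sq_le (hmin x ?_)
    rintro rfl
    apply hw0
    have h0 : (fun i => (((0 : Fin n → ℤ) i : ℤ) : ℝ)) = 0 := by ext; simp
    rw [h0, mulVec_zero]

lemma exists_short_of_unimodular {n : ℕ} (hn : 0 < n) {G : Matrix (Fin n) (Fin n) ℝ}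
    (hG : G.det ^ 2 = 1) : ∃ x : Fin n → ℤ, x ≠ 0 ∧
      0 < (G *ᵥ fun i => (x i : ℝ)) ⬝ᵥ (G *ᵥ fun i => (x i : ℝ)) ∧
      (G *ᵥ fun i => (x i : ℝ)) ⬝ᵥ (G *ᵥ fun i => (x i : ℝ)) ≤ hermiteConst n := by
  obtain ⟨c, hc, -, hmin, x, hx, hxc⟩ := exists_minimum hn hG
  refine ⟨x, hx, by rw [hxc]; positivity, ?_⟩
  have hb : BddAbove {c | ∃ L : AddSubgroup (Fin n → ℝ),
      IsUnimodularLattice L ∧ c = shortest L ^ 2} := by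
    refine ⟨(4 / 3) ^ n, ?_⟩
    rintro _ ⟨L, hL, rfl⟩
    obtain ⟨G', hG', hGm⟩ := exists_matrix_of_isUnimodularLattice hL
    obtain ⟨c', hc', hle, hmin', hex'⟩ := exists_minimum hn hG'
    rwa [shortest_eq hGm hc' hmin' hex']
  refine le_csSup hb ⟨_, isUnimodularLattice_closure_cols hG (pow_pos hc 2) hmin, ?_⟩
  rw [shortest_eq (mem_closure_cols G) hc hmin ⟨x, hx, hxc⟩, hxc]

lemma hermiteConst_pos {n : ℕ} (hn : 0 < n) : 0 < hermiteConst n := by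
  obtain ⟨x, -, h1, h2⟩ := exists_short_of_unimodular hn (G := 1) (by simp)
  exact h1.trans_le h2

/-- Hermite's inequality. -/
lemma exists_short {n : ℕ} (hn : 0 < n) {G : Matrix (Fin n) (Fin n) ℝ} (hG : G.det ≠ 0) :
    ∃ x : Fin n → ℤ, x ≠ 0 ∧ ((G *ᵥ fun i => (x i : ℝ)) ⬝ᵥ (G *ᵥ fun i => (x i : ℝ))) ^ n ≤
      hermiteConst n ^ n * G.det ^ 2 := by
  set s : ℝ := |G.det| ^ ((n : ℝ)⁻¹) with hs
  have hd : 0 < |G.det| := abs_pos.2 hG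
  have hs0 : 0 < s := Real.rpow_pos_of_pos hd _
  have hsn : s ^ n = |G.det| := Real.rpow_inv_natCast_pow hd.le (by omega)
  obtain ⟨x, hx, h1, h2⟩ := exists_short_of_unimodular hn (G := s⁻¹ • G) (by
    rw [det_smul, Fintype.card_fin, inv_pow, hsn, mul_pow, inv_pow, sq_abs,
      inv_mul_cancel₀ (pow_ne_zero 2 hG)])
  refine ⟨x, hx, ?_⟩
  have h3 : (G *ᵥ fun i => (x i : ℝ)) ⬝ᵥ (G *ᵥ fun i => (x i : ℝ)) =
      s ^ 2 * (((s⁻¹ • G) *ᵥ fun i => (x i : ℝ)) ⬝ᵥ ((s⁻¹ • G) *ᵥ fun i => (x i : ℝ))) := by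
    rw [smul_mulVec, dotProduct_smul, smul_dotProduct, smul_eq_mul, smul_eq_mul]
    field_simp
  rw [h3, mul_pow, ← pow_mul, mul_comm 2 n, pow_mul, hsn, sq_abs, mul_comm]
  gcongr

lemma exists_short' {κ : Type*} [Fintype κ] [DecidableEq κ] {n : ℕ} (hκ : Fintype.card κ = n)
    (hn : 0 < n) {G : Matrix κ κ ℝ} (hG : G.det ≠ 0) :
    ∃ x : κ → ℤ, x ≠ 0 ∧ ((G *ᵥ fun i => (x i : ℝ)) ⬝ᵥ (G *ᵥ fun i => (x i : ℝ))) ^ n ≤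
      hermiteConst n ^ n * G.det ^ 2 := by
  let e : Fin n ≃ κ := (Fintype.equivFinOfCardEq hκ).symm
  obtain ⟨x, hx, h⟩ := exists_short hn (G := G.submatrix e e) (by
    rwa [det_submatrix_equiv_self])
  rw [det_submatrix_equiv_self] at h
  refine ⟨x ∘ e.symm, fun h0 => hx ?_, ?_⟩
  · ext i
    have := congrFun h0 (e i)
    simpa using this
  · have h1 : (G.submatrix e e *ᵥ fun i => (x i : ℝ)) =
        (G *ᵥ fun i => ((x ∘ e.symm) i : ℝ)) ∘ e := by
      rw [submatrix_mulVec_equiv]; rfl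
    rw [h1, comp_equiv_dotProduct_comp_equiv] at h
    exact h

end hermite

section woods

variable {κ : Type*} [Fintype κ] [DecidableEq κ]

lemma dotProduct_add_self_le (p q : κ → ℝ) {δ : ℝ} (hδ : 0 < δ) :
    (p + q) ⬝ᵥ (p + q) ≤ (1 + δ) * (p ⬝ᵥ p) + (1 + δ⁻¹) * (q ⬝ᵥ q) := by
  simp only [dotProduct, Pi.add_apply, Finset.mul_sum, ← Finset.sum_add_distrib]
  refine Finset.sum_le_sum fun i _ => ?_
  have h : 0 ≤ δ⁻¹ * (δ * p i - q i) ^ 2 := by positivity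
  have h2 : δ⁻¹ * (δ * p i - q i) ^ 2 = δ * (p i * p i) - 2 * (p i * q i) + δ⁻¹ * (q i * q i) := by
    field_simp
    ring
  nlinarith

lemma bordered_short {m : ℕ} (hκ : Fintype.card κ = m) {B : Matrix κ κ ℝ} (hB : B.det ≠ 0)
    (u : κ → ℝ) {s : ℝ} (hs : 0 < s) :
    ∃ (x : κ → ℤ) (k : ℤ), (x ≠ 0 ∨ k ≠ 0) ∧
      ((B *ᵥ (fun i => (x i : ℝ)) + (k : ℝ) • u) ⬝ᵥ (B *ᵥ (fun i => (x i : ℝ)) + (k : ℝ) • u)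
        + (k * s) ^ 2) ^ (m + 1) ≤ hermiteConst (m + 1) ^ (m + 1) * (B.det * s) ^ 2 := by
  let G : Matrix (κ ⊕ Unit) (κ ⊕ Unit) ℝ :=
    Matrix.fromBlocks B (Matrix.of fun i _ => u i) 0 (Matrix.of fun _ _ => s)
  have hG : G.det = B.det * s := by
    rw [det_fromBlocks_zero₂₁, det_unique (Matrix.of fun _ _ => s)]; rfl
  obtain ⟨x, hx, h⟩ := exists_short' (n := m + 1) (by simp [hκ]) (by omega) (G := G) (by
    rw [hG]; exact mul_ne_zero hB hs.ne')
  refine ⟨fun i => x (Sum.inl i), x (Sum.inr ()), ?_, ?_⟩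
  · by_contra! h0
    apply hx
    ext (i | i)
    · exact congrFun h0.1 i
    · exact h0.2
  · rw [hG] at h
    convert h using 2
    simp only [dotProduct, Fintype.sum_sum_type, Finset.univ_unique, Finset.sum_singleton]
    congr 1
    · refine Finset.sum_congr rfl fun i _ => ?_
      have : (G *ᵥ fun i => (x i : ℝ)) (Sum.inl i) =
          (B *ᵥ (fun i => (x (Sum.inl i) : ℝ)) + (x (Sum.inr ()) : ℝ) • u) i := by
        simp [G, mulVec, dotProduct, Fintype.sum_sum_type, mul_comm]
      rw [this]
    · have : (G *ᵥ fun i => (x i : ℝ)) (Sum.inr ()) = x (Sum.inr ()) * s := by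
        simp [G, mulVec, dotProduct, Fintype.sum_sum_type, mul_comm]
      rw [PUnit.default_eq_unit, this, pow_two]

/-- The hypotheses of Woods' covering lemma. -/
structure Woods (m : ℕ) (B : Matrix κ κ ℝ) (a t : ℝ) : Prop where
  card : Fintype.card κ = m
  det : B.det ≠ 0
  a_pos : 0 < a
  t_pos : 0 < t
  half : a ≤ 2 * t
  min : ∀ x : κ → ℤ, x ≠ 0 →
    a ^ 2 ≤ (B *ᵥ fun i => (x i : ℝ)) ⬝ᵥ (B *ᵥ fun i => (x i : ℝ))
  herm : hermiteConst (m + 1) ^ (m + 1) * (B.det * t) ^ 2 ≤ (a ^ 2) ^ (m + 1)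

lemma Woods.t_sq_le {m : ℕ} {B : Matrix κ κ ℝ} {a t : ℝ} (h : Woods m B a t) (u : κ → ℝ) {s : ℝ}
    (hs : 0 < s) (hst : s < t) (hs3 : a < 3 * s) :
    (∃ x : κ → ℤ, (u - B *ᵥ fun i => (x i : ℝ)) ⬝ᵥ (u - B *ᵥ fun i => (x i : ℝ)) < a ^ 2 - s ^ 2) ∨
    ∃ x : κ → ℤ, ((2 : ℝ) • u - B *ᵥ fun i => (x i : ℝ)) ⬝ᵥ
      ((2 : ℝ) • u - B *ᵥ fun i => (x i : ℝ)) < a ^ 2 - 4 * s ^ 2 := by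
  obtain ⟨x, k, hxk, hle⟩ := bordered_short h.card h.det u hs
  set w := B *ᵥ (fun i => (x i : ℝ)) + (k : ℝ) • u with hw
  have hγ := hermiteConst_pos (n := m + 1) (by omega)
  have hlt : w ⬝ᵥ w + (k * s) ^ 2 < a ^ 2 := by
    refine lt_of_pow_lt_pow_left₀ (m + 1) (by positivity) (hle.trans_lt (lt_of_lt_of_le ?_ h.herm))
    have h1 : 0 < B.det ^ 2 := by have := h.det; positivity
    rw [mul_pow, mul_pow]
    have h2 : s ^ 2 < t ^ 2 := by gcongr
    gcongr
  have hw0 := dotProduct_self_nonneg' w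
  have ha := h.a_pos
  have hneg : ∀ v : κ → ℝ, (-v) ⬝ᵥ (-v) = v ⬝ᵥ v := fun v => by simp
  have hzneg : (B *ᵥ fun i => (((-x) i : ℤ) : ℝ)) = -(B *ᵥ fun i => (x i : ℝ)) := by
    rw [← mulVec_neg]
    congr 1
    ext i
    simp
  have hk3 : |k| < 3 := by
    by_contra! hk
    have h1 : (3 : ℝ) ≤ |(k : ℝ)| := by exact_mod_cast hk
    have h2 : (3 * s) ^ 2 ≤ (k * s) ^ 2 := by
      rw [mul_pow, mul_pow, ← sq_abs (k : ℝ)]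
      gcongr
    have h3 : a ^ 2 < (3 * s) ^ 2 := by gcongr
    linarith
  rw [abs_lt] at hk3
  have hcases : k = 0 ∨ k = 1 ∨ k = -1 ∨ k = 2 ∨ k = -2 := by omega
  rcases hcases with rfl | rfl | rfl | rfl | rfl
  · exfalso
    have hx : x ≠ 0 := by simpa using hxk
    have := h.min x hx
    simp only [Int.cast_zero, zero_smul, add_zero, zero_mul] at hw hlt
    rw [hw] at hlt
    norm_num at hlt
    linarith
  · left
    refine ⟨-x, ?_⟩
    have : u - B *ᵥ (fun i => (((-x) i : ℤ) : ℝ)) = w := by rw [hzneg, hw]; simp [add_comm]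
    rw [this]
    norm_num at hlt
    linarith
  · left
    refine ⟨x, ?_⟩
    have : u - B *ᵥ (fun i => ((x i : ℤ) : ℝ)) = -w := by rw [hw]; simp [sub_eq_add_neg]
    rw [this, hneg]
    norm_num at hlt
    linarith
  · right
    refine ⟨-x, ?_⟩
    have : (2 : ℝ) • u - B *ᵥ (fun i => (((-x) i : ℤ) : ℝ)) = w := by
      rw [hzneg, hw]; simp [add_comm]
    rw [this]
    rw [mul_pow] at hlt
    norm_num at hlt
    linarith
  · right
    refine ⟨x, ?_⟩
    have : (2 : ℝ) • u - B *ᵥ (fun i => ((x i : ℤ) : ℝ)) = -w := by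
      rw [hw]; simp [sub_eq_add_neg]
    rw [this, hneg]
    rw [mul_pow] at hlt
    norm_num at hlt
    linarith

lemma Woods.exists_gap {m : ℕ} {B : Matrix κ κ ℝ} {a t : ℝ} (h : Woods m B a t) {v : κ → ℝ}
    (hv : ∀ x : κ → ℤ, (B *ᵥ fun i => (x i : ℝ)) ≠ v) :
    ∃ ρ > 0, ∀ x : κ → ℤ, ρ ≤ (v - B *ᵥ fun i => (x i : ℝ)) ⬝ᵥ (v - B *ᵥ fun i => (x i : ℝ)) := by
  have ha := h.a_pos
  by_cases h1 : ∀ x : κ → ℤ,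
      a ^ 2 / 4 ≤ (v - B *ᵥ fun i => (x i : ℝ)) ⬝ᵥ (v - B *ᵥ fun i => (x i : ℝ))
  · exact ⟨_, by positivity, h1⟩
  push Not at h1
  obtain ⟨y, hy⟩ := h1
  refine ⟨_, lt_of_le_of_ne (dotProduct_self_nonneg' (v - B *ᵥ fun i => (y i : ℝ))) fun h0 => ?_,
    fun x => ?_⟩
  · exact hv y (sub_eq_zero.1 (dotProduct_self_eq_zero.1 h0.symm)).symm
  · by_contra! hlt
    have hxy : x - y ≠ 0 := by
      intro h0
      rw [sub_eq_zero.1 h0] at hlt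
      exact lt_irrefl _ hlt
    have h2 := h.min _ hxy
    have h3 : (B *ᵥ fun i => (((x - y) i : ℤ) : ℝ)) =
        (v - B *ᵥ fun i => (y i : ℝ)) + -(v - B *ᵥ fun i => (x i : ℝ)) := by
      have : (fun i => (((x - y) i : ℤ) : ℝ)) = (fun i => (x i : ℝ)) - fun i => (y i : ℝ) := by
        ext i; simp
      rw [this, mulVec_sub]
      abel
    have h4 := dotProduct_add_self_le (v - B *ᵥ fun i => (y i : ℝ))
      (-(v - B *ᵥ fun i => (x i : ℝ))) one_pos
    rw [h3] at h2
    rw [neg_dotProduct_neg, inv_one] at h4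
    linarith

lemma Woods.cover_of_not_mem {m : ℕ} {B : Matrix κ κ ℝ} {a t : ℝ} (h : Woods m B a t) {u : κ → ℝ}
    (hu : ∀ x : κ → ℤ, (B *ᵥ fun i => (x i : ℝ)) ≠ (2 : ℝ) • u) {η : ℝ} (hη : 0 < η) :
    ∃ x : κ → ℤ, (u - B *ᵥ fun i => (x i : ℝ)) ⬝ᵥ (u - B *ᵥ fun i => (x i : ℝ)) <
      a ^ 2 - t ^ 2 + η := by
  obtain ⟨ρ, hρ, hgap⟩ := h.exists_gap hu
  have ha := h.a_pos
  have ht := h.t_pos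
  have hat := h.half
  have hev : ∀ᶠ s in 𝓝[<] t, 0 < s ∧ s < t ∧ a < 3 * s ∧ a ^ 2 - 4 * s ^ 2 < ρ ∧
      a ^ 2 - s ^ 2 < a ^ 2 - t ^ 2 + η := by
    have hn : 𝓝[<] t ≤ 𝓝 t := nhdsWithin_le_nhds
    have e1 : ∀ᶠ s in 𝓝[<] t, 0 < s := hn (lt_mem_nhds ht)
    have e2 : ∀ᶠ s in 𝓝[<] t, s < t := self_mem_nhdsWithin
    have e3 : ∀ᶠ s in 𝓝[<] t, a < 3 * s :=
      hn (((continuous_const.mul continuous_id).tendsto t).eventually (lt_mem_nhds (by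
        change a < 3 * t; linarith)))
    have e4 : ∀ᶠ s in 𝓝[<] t, a ^ 2 - 4 * s ^ 2 < ρ := by
      have hc : Continuous fun s : ℝ => a ^ 2 - 4 * s ^ 2 := by fun_prop
      refine hn ((hc.tendsto t).eventually (gt_mem_nhds ?_))
      nlinarith
    have e5 : ∀ᶠ s in 𝓝[<] t, a ^ 2 - s ^ 2 < a ^ 2 - t ^ 2 + η := by
      have hc : Continuous fun s : ℝ => a ^ 2 - s ^ 2 := by fun_prop
      exact hn ((hc.tendsto t).eventually (gt_mem_nhds (by linarith)))
    filter_upwards [e1, e2, e3, e4, e5] with s h1 h2 h3 h4 h5 using ⟨h1, h2, h3, h4, h5⟩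
  obtain ⟨s, h1, h2, h3, h4, h5⟩ := hev.exists
  rcases h.t_sq_le u h1 h2 h3 with ⟨x, hx⟩ | ⟨x, hx⟩
  · exact ⟨x, hx.trans h5⟩
  · exact absurd (hgap x) (not_le.2 (hx.trans h4))

/-- Woods' covering lemma. -/
lemma Woods.cover {m : ℕ} {B : Matrix κ κ ℝ} {a t : ℝ} (h : Woods m B a t) [Nonempty κ]
    (u : κ → ℝ) {η : ℝ} (hη : 0 < η) :
    ∃ x : κ → ℤ, (u - B *ᵥ fun i => (x i : ℝ)) ⬝ᵥ (u - B *ᵥ fun i => (x i : ℝ)) <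
      a ^ 2 - t ^ 2 + η := by
  by_cases hu : ∀ x : κ → ℤ, (B *ᵥ fun i => (x i : ℝ)) ≠ (2 : ℝ) • u
  · exact h.cover_of_not_mem hu hη
  push Not at hu
  obtain ⟨y, hy⟩ := hu
  obtain ⟨i₀⟩ := ‹Nonempty κ›
  set b : κ → ℝ := B *ᵥ Pi.single i₀ 1 with hb
  have hinj : Function.Injective B.mulVec :=
    mulVec_injective_of_isUnit ((isUnit_iff_isUnit_det B).2 h.det.isUnit)
  have hu' : ∀ r : ℝ, 0 < r → r < 1 / 2 → ∀ x : κ → ℤ,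
      (B *ᵥ fun i => (x i : ℝ)) ≠ (2 : ℝ) • (u + r • b) := by
    intro r hr0 hr1 x hx
    rw [smul_add, ← hy, smul_smul, hb, ← mulVec_smul, ← mulVec_add] at hx
    have h1 := congrFun (hinj hx) i₀
    simp only [Pi.add_apply, Pi.smul_apply, Pi.single_eq_same, smul_eq_mul, mul_one] at h1
    have h2 : (y i₀ : ℝ) < x i₀ := by linarith
    have h3 : (x i₀ : ℝ) < y i₀ + 1 := by linarith
    have h4 : y i₀ < x i₀ := by exact_mod_cast h2
    have h5 : x i₀ < y i₀ + 1 := by exact_mod_cast h3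
    omega
  set C := a ^ 2 - t ^ 2 + η / 4 with hC
  obtain ⟨δ, hδ, hδC⟩ : ∃ δ > 0, (1 + δ) * C < a ^ 2 - t ^ 2 + η / 2 := by
    have hc : Continuous fun δ : ℝ => (1 + δ) * C := by fun_prop
    have hn : 𝓝[>] (0 : ℝ) ≤ 𝓝 0 := nhdsWithin_le_nhds
    have e1 : ∀ᶠ δ in 𝓝[>] (0 : ℝ), (1 + δ) * C < a ^ 2 - t ^ 2 + η / 2 :=
      hn ((hc.tendsto 0).eventually (gt_mem_nhds (by rw [hC]; linarith)))
    have e2 : ∀ᶠ δ in 𝓝[>] (0 : ℝ), 0 < δ := self_mem_nhdsWithin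
    obtain ⟨δ, h1, h2⟩ := (e1.and e2).exists
    exact ⟨δ, h2, h1⟩
  obtain ⟨r, hr0, hr1, hr⟩ : ∃ r > 0, r < 1 / 2 ∧ (1 + δ⁻¹) * (r ^ 2 * (b ⬝ᵥ b)) < η / 2 := by
    have hc : Continuous fun r : ℝ => (1 + δ⁻¹) * (r ^ 2 * (b ⬝ᵥ b)) := by fun_prop
    have hn : 𝓝[>] (0 : ℝ) ≤ 𝓝 0 := nhdsWithin_le_nhds
    have e1 : ∀ᶠ r in 𝓝[>] (0 : ℝ), (1 + δ⁻¹) * (r ^ 2 * (b ⬝ᵥ b)) < η / 2 :=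
      hn ((hc.tendsto 0).eventually (gt_mem_nhds (by simpa using hη)))
    have e2 : ∀ᶠ r in 𝓝[>] (0 : ℝ), 0 < r := self_mem_nhdsWithin
    have e3 : ∀ᶠ r in 𝓝[>] (0 : ℝ), r < 1 / 2 := hn (gt_mem_nhds (by norm_num))
    obtain ⟨r, h1, h2, h3⟩ := (e1.and (e2.and e3)).exists
    exact ⟨r, h2, h3, h1⟩
  obtain ⟨x, hx⟩ := h.cover_of_not_mem (hu' r hr0 hr1) (η := η / 4) (by linarith)
  refine ⟨x, ?_⟩
  have h1 : u - (B *ᵥ fun i => (x i : ℝ)) =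
      (u + r • b - B *ᵥ fun i => (x i : ℝ)) + (-r) • b := by
    rw [neg_smul]; abel
  have h2 := dotProduct_add_self_le (u + r • b - B *ᵥ fun i => (x i : ℝ)) ((-r) • b) hδ
  rw [← h1] at h2
  have h3 : ((-r) • b) ⬝ᵥ ((-r) • b) = r ^ 2 * (b ⬝ᵥ b) := by
    rw [smul_dotProduct, dotProduct_smul, smul_eq_mul, smul_eq_mul]; ring
  rw [h3] at h2
  have h4 : (1 + δ) * ((u + r • b - B *ᵥ fun i => (x i : ℝ)) ⬝ᵥ
      (u + r • b - B *ᵥ fun i => (x i : ℝ))) ≤ (1 + δ) * C := by gcongr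
  linarith

end woods

section blocks

variable {n : ℕ}

/-- The embedding of the block `[o, o + m)` of indices. -/
def blk {o m : ℕ} (h : o + m ≤ n) (a : Fin m) : Fin n := ⟨o + a, by omega⟩

lemma blk_injective {o m : ℕ} (h : o + m ≤ n) : Function.Injective (blk h) := by
  intro a b hab
  have := congrArg Fin.val hab
  simp only [blk] at this
  exact Fin.ext (by omega)

lemma mem_range_blk {o m : ℕ} (h : o + m ≤ n) (i : Fin n) :
    i ∈ Set.range (blk h) ↔ o ≤ i ∧ (i : ℕ) < o + m := by
  constructor
  · rintro ⟨a, rfl⟩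
    simp only [blk]
    omega
  · rintro ⟨h1, h2⟩
    exact ⟨⟨i - o, by omega⟩, Fin.ext (by simp only [blk]; omega)⟩

lemma mulVec_extend {o m : ℕ} (h : o + m ≤ n) (R : Matrix (Fin n) (Fin n) ℝ) (x : Fin m → ℤ)
    (i : Fin n) : (R *ᵥ fun j => ((Function.extend (blk h) x 0 j : ℤ) : ℝ)) i =
      ∑ a, R i (blk h a) * x a := by
  rw [mulVec, dotProduct]
  refine (Fintype.sum_of_injective (blk h) (blk_injective h) _ _ (fun j hj => ?_)
    fun a => ?_).symm
  · rw [Function.extend_apply' _ _ _ hj]; simp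
  · rw [(blk_injective h).extend_apply]

lemma sum_tail_split {o m : ℕ} (h : o + m ≤ n) (F : Fin n → ℝ) :
    (∑ i : Fin n, if o ≤ (i : ℕ) then F i else 0) =
      ∑ a, F (blk h a) + ∑ i : Fin n, if o + m ≤ (i : ℕ) then F i else 0 := by
  have h1 : ∑ a, F (blk h a) = ∑ i : Fin n, if o ≤ (i : ℕ) ∧ (i : ℕ) < o + m then F i else 0 := by
    refine Fintype.sum_of_injective (blk h) (blk_injective h) _ _ (fun j hj => ?_) fun a => ?_
    · rw [mem_range_blk] at hj
      rw [if_neg hj]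
    · rw [if_pos ((mem_range_blk h _).1 ⟨a, rfl⟩)]
  rw [h1, ← Finset.sum_add_distrib]
  refine Finset.sum_congr rfl fun i _ => ?_
  split_ifs <;> first | omega | simp

lemma IsKZ.woods {A : ℕ → ℝ} {R : Matrix (Fin n) (Fin n) ℝ} (hK : IsKZ (fun i : Fin n => A i) R)
    (hA : ∀ i < n, 0 < A i) {o m : ℕ} (h : o + m ≤ n) (hm : 0 < m)
    (hH : (∏ j ∈ Finset.Ico o (o + m), A j) * hermiteConst (m + 1) ^ (((m : ℝ) + 1) / 2) ≤
      2 * A o ^ m) :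
    Woods m (R.submatrix (blk h) (blk h)) (A o) (Real.sqrt (A o ^ (2 * m + 2) /
      ((∏ j ∈ Finset.Ico o (o + m), A j) ^ 2 * hermiteConst (m + 1) ^ (m + 1)))) := by
  set d := ∏ j ∈ Finset.Ico o (o + m), A j with hd
  set γ := hermiteConst (m + 1) with hγ
  have hγ0 : 0 < γ := hermiteConst_pos (by omega)
  have hd0 : 0 < d := Finset.prod_pos fun j hj => hA j (by rw [Finset.mem_Ico] at hj; omega)
  have ha : 0 < A o := hA o (by omega)
  have hdet : (R.submatrix (blk h) (blk h)).det = d := by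
    rw [det_of_isUpperTriangular (M := R.submatrix (blk h) (blk h))
      (fun i j hij => hK.low _ _ (Fin.lt_def.2 (by
        have : (j : ℕ) < i := hij
        simp only [blk]; omega))), hd, Finset.prod_Ico_eq_prod_range, Nat.add_sub_cancel_left,
      ← Fin.prod_univ_eq_prod_range (fun i => A (o + i))]
    exact Finset.prod_congr rfl fun a _ => hK.diag _
  have hγ2 : (γ ^ (((m : ℝ) + 1) / 2)) ^ 2 = γ ^ (m + 1) := by
    rw [← Real.rpow_natCast, ← Real.rpow_mul hγ0.le, ← Real.rpow_natCast]
    congr 1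
    push_cast
    ring
  have hsq : d ^ 2 * γ ^ (m + 1) ≤ 4 * A o ^ (2 * m) := by
    have h1 : 0 < γ ^ (((m : ℝ) + 1) / 2) := Real.rpow_pos_of_pos hγ0 _
    have := pow_le_pow_left₀ (by positivity) hH 2
    rw [mul_pow, hγ2, mul_pow, ← pow_mul, mul_comm m 2] at this
    linarith
  have hDpos : 0 < d ^ 2 * γ ^ (m + 1) := by positivity
  have ht2 : (Real.sqrt (A o ^ (2 * m + 2) / (d ^ 2 * γ ^ (m + 1)))) ^ 2 =
      A o ^ (2 * m + 2) / (d ^ 2 * γ ^ (m + 1)) := Real.sq_sqrt (by positivity)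
  refine ⟨Fintype.card_fin m, by rw [hdet]; exact hd0.ne', ha, Real.sqrt_pos.2 (by positivity),
    ?_, fun x hx => ?_, ?_⟩
  · refine (pow_le_pow_iff_left₀ ha.le (by positivity) two_ne_zero).1 ?_
    rw [mul_pow, ht2, mul_div_assoc', le_div_iff₀ hDpos]
    calc A o ^ 2 * (d ^ 2 * γ ^ (m + 1)) ≤ A o ^ 2 * (4 * A o ^ (2 * m)) := by gcongr
      _ = 2 ^ 2 * A o ^ (2 * m + 2) := by rw [pow_add]; ring
  · have h0 : (⟨o, by omega⟩ : Fin n) = blk h ⟨0, hm⟩ := rfl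
    obtain ⟨a, hxa⟩ := Function.ne_iff.1 hx
    have h1 := hK.min ⟨o, by omega⟩ (Function.extend (blk h) x 0)
      ⟨blk h a, Fin.le_def.2 (by simp [blk]), by rwa [(blk_injective h).extend_apply]⟩
    refine h1.trans (le_of_eq ?_)
    have h2 := sum_tail_split h
      fun i => (R *ᵥ fun j => ((Function.extend (blk h) x 0 j : ℤ) : ℝ)) i ^ 2
    simp only [Fin.le_def]
    rw [h2, dotProduct, add_eq_left.2]
    · refine Finset.sum_congr rfl fun b _ => ?_
      rw [mulVec_extend, pow_two]
      rfl
    · refine Finset.sum_eq_zero fun i _ => ?_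
      split_ifs with hi
      · rw [mulVec_extend, Finset.sum_eq_zero, zero_pow two_ne_zero]
        intro b _
        rw [hK.low _ _ (Fin.lt_def.2 (by simp only [blk]; omega)), zero_mul]
      · rfl
  · rw [hdet, mul_pow, ht2, mul_div_assoc', mul_div_assoc', div_le_iff₀ hDpos, ← pow_mul]
    exact le_of_eq (by ring)

lemma IsKZ.cover_step {A : ℕ → ℝ} {R : Matrix (Fin n) (Fin n) ℝ}
    (hK : IsKZ (fun i : Fin n => A i) R) (hA : ∀ i < n, 0 < A i) {o m : ℕ} (h : o + m ≤ n)
    (hm : 0 < m)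
    (hH : (∏ j ∈ Finset.Ico o (o + m), A j) * hermiteConst (m + 1) ^ (((m : ℝ) + 1) / 2) ≤
      2 * A o ^ m) {η : ℝ} (hη : 0 < η) (u : Fin n → ℝ) (x : Fin n → ℤ) :
    ∃ z : Fin n → ℤ, (∑ i : Fin n, if o ≤ (i : ℕ) then (u - R *ᵥ fun j => (z j : ℝ)) i ^ 2 else 0) ≤
      A o ^ 2 - A o ^ (2 * m + 2) /
        ((∏ j ∈ Finset.Ico o (o + m), A j) ^ 2 * hermiteConst (m + 1) ^ (m + 1)) + η +
      ∑ i : Fin n, if o + m ≤ (i : ℕ) then (u - R *ᵥ fun j => (x j : ℝ)) i ^ 2 else 0 := by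
  have hW := hK.woods hA h hm hH
  have : Nonempty (Fin m) := ⟨⟨0, hm⟩⟩
  obtain ⟨y, hy⟩ := hW.cover (fun a => (u - R *ᵥ fun j => (x j : ℝ)) (blk h a)) hη
  have hγ0 : 0 < hermiteConst (m + 1) := hermiteConst_pos (by omega)
  have ha : 0 < A o := hA o (by omega)
  rw [Real.sq_sqrt (by positivity)] at hy
  have hz : (fun j => ((x j + Function.extend (blk h) y 0 j : ℤ) : ℝ)) =
      (fun j => (x j : ℝ)) + fun j => ((Function.extend (blk h) y 0 j : ℤ) : ℝ) := by
    ext j; simp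
  refine ⟨fun j => x j + Function.extend (blk h) y 0 j, ?_⟩
  rw [hz, mulVec_add, sum_tail_split h]
  refine add_le_add ?_ (le_of_eq ?_)
  · refine le_trans (le_of_eq ?_) hy.le
    rw [dotProduct]
    refine Finset.sum_congr rfl fun a _ => ?_
    rw [pow_two]
    simp only [Pi.sub_apply, Pi.add_apply, mulVec_extend]
    have : ((R.submatrix (blk h) (blk h)) *ᵥ fun i => (y i : ℝ)) a =
      ∑ b, R (blk h a) (blk h b) * y b := rfl
    rw [this]
    ring
  · refine Finset.sum_congr rfl fun i _ => ?_
    split_ifs with hi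
    · simp only [Pi.sub_apply, Pi.add_apply, mulVec_extend]
      rw [Finset.sum_eq_zero (s := Finset.univ) (f := fun a => R i (blk h a) * (y a : ℝ)), add_zero]
      intro b _
      rw [hK.low _ _ (Fin.lt_def.2 (by simp only [blk]; omega)), zero_mul]
    · rfl

/-- Partial sums of block sizes. -/
def offN {k : ℕ} (ns : Fin k → ℕ) (q : ℕ) : ℕ :=
  ∑ j ∈ Finset.univ.filter (fun j : Fin k => (j : ℕ) < q), ns j

lemma offN_succ {k : ℕ} (ns : Fin k → ℕ) (i : Fin k) :
    offN ns ((i : ℕ) + 1) = off ns i + ns i := by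
  have : Finset.univ.filter (fun j : Fin k => (j : ℕ) < i + 1) =
      insert i (Finset.univ.filter fun j : Fin k => j < i) := by
    ext j
    simp only [Finset.mem_filter, Finset.mem_univ, true_and, Finset.mem_insert, Fin.lt_def,
      Fin.ext_iff]
    omega
  rw [offN, this, Finset.sum_insert (by simp), add_comm, off]

lemma IsKZ.cover {A : ℕ → ℝ} {R : Matrix (Fin n) (Fin n) ℝ}
    (hK : IsKZ (fun i : Fin n => A i) R) (hA : ∀ i < n, 0 < A i) {k : ℕ} (ns : Fin k → ℕ)
    (hns : ∀ i, 0 < ns i) (hsum : ∑ i, ns i = n)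
    (hH : ∀ i, (∏ j ∈ Finset.Ico (off ns i) (off ns i + ns i), A j) *
      hermiteConst (ns i + 1) ^ (((ns i : ℝ) + 1) / 2) ≤ 2 * A (off ns i) ^ (ns i))
    {η : ℝ} (hη : 0 < η) (u : Fin n → ℝ) :
    ∃ x : Fin n → ℤ, (u - R *ᵥ fun j => (x j : ℝ)) ⬝ᵥ (u - R *ᵥ fun j => (x j : ℝ)) ≤
      (∑ i, (A (off ns i) ^ 2 - A (off ns i) ^ (2 * ns i + 2) /
        ((∏ j ∈ Finset.Ico (off ns i) (off ns i + ns i), A j) ^ 2 *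
          hermiteConst (ns i + 1) ^ (ns i + 1)))) + k * η := by
  set b : Fin k → ℝ := fun i => A (off ns i) ^ 2 - A (off ns i) ^ (2 * ns i + 2) /
    ((∏ j ∈ Finset.Ico (off ns i) (off ns i + ns i), A j) ^ 2 *
      hermiteConst (ns i + 1) ^ (ns i + 1)) with hb
  have key : ∀ p ≤ k, ∃ x : Fin n → ℤ,
      (∑ i : Fin n, if offN ns (k - p) ≤ (i : ℕ) then (u - R *ᵥ fun j => (x j : ℝ)) i ^ 2 else 0) ≤
      ∑ i : Fin k, if k - p ≤ (i : ℕ) then b i + η else 0 := by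
    intro p
    induction p with
    | zero =>
      intro _
      refine ⟨0, le_of_eq ?_⟩
      have h1 : offN ns k = n := by
        rw [← hsum, offN, Finset.filter_true_of_mem fun j _ => j.2]
      rw [Nat.sub_zero, h1, Finset.sum_eq_zero fun i _ => if_neg (by omega),
        Finset.sum_eq_zero fun i _ => if_neg (by omega)]
    | succ p ih =>
      intro hp
      obtain ⟨x, hx⟩ := ih (by omega)
      let q : Fin k := ⟨k - (p + 1), by omega⟩
      have hq : k - p = (q : ℕ) + 1 := by simp only [q]; omega
      have hle : off ns q + ns q ≤ n := by
        have := off_add_lt ns q ⟨ns q - 1, by have := hns q; omega⟩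
        rw [hsum] at this
        simp only at this
        have := hns q
        omega
      obtain ⟨z, hz⟩ := hK.cover_step hA hle (hns q) (hH q) hη u x
      refine ⟨z, hz.trans ?_⟩
      rw [hq, offN_succ] at hx
      have h2 : (∑ i : Fin k, if k - (p + 1) ≤ (i : ℕ) then b i + η else 0) =
          b q + η + ∑ i : Fin k, if (q : ℕ) + 1 ≤ (i : ℕ) then b i + η else 0 := by
        have h3 : b q + η = ∑ i : Fin k, if i = q then b i + η else 0 := by simp
        rw [h3, ← Finset.sum_add_distrib]
        refine Finset.sum_congr rfl fun i _ => ?_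
        simp only [Fin.ext_iff, q]
        split_ifs <;> first | omega | simp
      rw [h2]
      exact add_le_add le_rfl hx
  obtain ⟨x, hx⟩ := key k le_rfl
  refine ⟨x, ?_⟩
  have h1 : offN ns 0 = 0 := by simp [offN]
  rw [Nat.sub_self, h1] at hx
  simp only [Nat.zero_le, if_true, Finset.sum_add_distrib, Finset.sum_const, Finset.card_univ,
    Fintype.card_fin, nsmul_eq_mul] at hx
  refine le_trans (le_of_eq ?_) hx
  rw [dotProduct]
  exact Finset.sum_congr rfl fun i _ => (pow_two _).symm

end blocks

section minkowski

variable {n : ℕ}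

lemma gd_orthogonal_mul {m κ ι : Type*} [Fintype m] [Fintype κ] [DecidableEq κ] [Fintype ι]
    [DecidableEq ι] {Q : Matrix m κ ℝ} (hQ : Qᵀ * Q = 1) (M : Matrix κ ι ℝ) :
    gd (Q * M) = gd M := by
  rw [gd, gd, transpose_mul, Matrix.mul_assoc, ← Matrix.mul_assoc Qᵀ, hQ, Matrix.one_mul]

lemma IsKZ.gd_submatrix {A : Fin n → ℝ} {R : Matrix (Fin n) (Fin n) ℝ} (h : IsKZ A R) {i : ℕ}
    (hi : i ≤ n) :
    gd (R.submatrix id (Fin.castLE hi)) = (∏ a, A (Fin.castLE hi a)) ^ 2 := by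
  have h1 : gd (R.submatrix id (Fin.castLE hi)) =
      gd (R.submatrix (Fin.castLE hi) (Fin.castLE hi)) := by
    unfold gd
    congr 1
    ext a b
    simp only [mul_apply, transpose_apply, submatrix_apply, id_eq]
    symm
    refine Fintype.sum_of_injective (Fin.castLE hi) (Fin.castLE_injective hi) _ _
      (fun l hl => ?_) fun _ => rfl
    rw [h.low l _ (Fin.lt_def.2 ?_), zero_mul]
    by_contra! hlt
    exact hl ⟨⟨l, hlt.trans_lt a.2⟩, rfl⟩
  have h2 : BlockTriangular (R.submatrix (Fin.castLE hi) (Fin.castLE hi)) id :=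
    fun a b hab => h.low _ _ (by simpa using hab)
  rw [h1, gd_square, det_of_isUpperTriangular h2]
  simp only [submatrix_apply, h.diag]

lemma exists_stable_kz {G : Matrix (Fin n) (Fin n) ℝ} (hG : G.det ^ 2 = 1) {ε : ℝ} (hε : 0 < ε) :
    ∃ (t : Fin n → ℝ) (U : Matrix (Fin n) (Fin n) ℤ) (Q R : Matrix (Fin n) (Fin n) ℝ)
      (A : Fin n → ℝ), ∑ i, t i = 0 ∧ Qᵀ * Q = 1 ∧ ed t * G * zr U = Q * R ∧ IsKZ A R ∧
      (∀ i, 0 < A i) ∧ ∏ i, A i = 1 ∧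
      ∀ (i : ℕ) (hi : i ≤ n), Real.exp (-ε) ≤ (∏ a, A (Fin.castLE hi a)) ^ 2 := by
  obtain ⟨t, ht, hNS⟩ := exists_ns n (Fin n) (Fintype.card_fin n) G hG ε hε
  have hdet : (ed t * G).det ^ 2 = 1 := by rw [det_mul, mul_pow, det_ed, ht, hG]; simp
  obtain ⟨U, U', Q, A, R, hU, hU', hQ, hYU, hA, hK⟩ := exists_kz (ed t * G) (by
    rw [gd_square, hdet]; exact one_ne_zero)
  refine ⟨t, U, Q, R, A, ht, hQ, hYU, hK, hA, ?_, fun i hi => ?_⟩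
  · have h1 : (∏ i, A i) ^ 2 = 1 := by
      rw [← hK.gd_eq, ← gd_orthogonal_mul hQ, ← hYU, gd_square, det_mul, mul_pow, hdet,
        det_sq_of_inv hU, one_mul]
    exact (pow_eq_one_iff_of_nonneg (Finset.prod_nonneg fun i _ => (hA i).le) two_ne_zero).1 h1
  · rw [← hK.gd_submatrix hi, ← gd_orthogonal_mul hQ]
    have h2 : Q * R.submatrix id (Fin.castLE hi) =
        ed t * G * zr (U.submatrix id (Fin.castLE hi)) := by
      have : Q * R.submatrix id (Fin.castLE hi) = (Q * R).submatrix id (Fin.castLE hi) := rfl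
      rw [this, ← hYU]
      rfl
    rw [h2]
    refine hNS i _ fun x hx => ?_
    have h3 : U.submatrix id (Fin.castLE hi) *ᵥ x =
        U *ᵥ Function.extend (Fin.castLE hi) x 0 := by
      ext l
      refine Fintype.sum_of_injective (Fin.castLE hi) (Fin.castLE_injective hi) _ _
        (fun j hj => ?_) fun a => ?_
      · rw [Function.extend_apply' _ _ _ hj, Pi.zero_apply, mul_zero]
      · rw [(Fin.castLE_injective hi).extend_apply]
        rfl
    have h4 : Function.extend (Fin.castLE hi) x 0 = 0 := by
      have := congrArg (U' *ᵥ ·) (h3.symm.trans hx)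
      simpa only [mulVec_mulVec, hU', one_mulVec, mulVec_zero] using this
    ext a
    rw [← (Fin.castLE_injective hi).extend_apply x 0 a, h4]
    rfl

lemma IsKZ.lower_of_first {A : Fin n → ℝ} {R : Matrix (Fin n) (Fin n) ℝ} (h : IsKZ A R)
    (hn : 0 < n) {c : ℝ} (hc : 0 ≤ c) (h0 : c ^ 2 ≤ A ⟨0, hn⟩ ^ 2) (i : Fin n) :
    (3 / 4) ^ n * c ≤ A i := by
  refine (pow_le_pow_iff_left₀ (by positivity) (h.nonneg i) two_ne_zero).1 ?_
  refine le_trans ?_ (h.lower hn i)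
  have h1 : ((3 / 4 : ℝ) ^ n) ^ 2 ≤ (3 / 4) ^ n :=
    pow_le_of_le_one (by positivity) (pow_le_one₀ (by norm_num) (by norm_num)) two_ne_zero
  rw [mul_pow]
  exact mul_le_mul h1 h0 (sq_nonneg c) (by positivity)

lemma le_inv_pow_of_prod_eq_one {A : Fin n → ℝ} {c : ℝ} (hc : 0 < c) (hc1 : c ≤ 1)
    (hA : ∀ i, c ≤ A i) (hprod : ∏ i, A i = 1) (i : Fin n) : A i ≤ (c ^ n)⁻¹ := by
  have h1 : c ^ n ≤ ∏ j ∈ Finset.univ.erase i, A j := by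
    calc c ^ n ≤ c ^ (Finset.univ.erase i).card :=
          pow_le_pow_of_le_one hc.le hc1 (by simp [Finset.card_erase_of_mem])
      _ = ∏ _j ∈ Finset.univ.erase i, c := by rw [Finset.prod_const]
      _ ≤ _ := Finset.prod_le_prod (fun _ _ => hc.le) fun j _ => hA j
  rw [le_inv_comm₀ (hc.trans_le (hA i)) (by positivity)]
  refine h1.trans (le_of_eq ?_)
  rw [← Finset.mul_prod_erase _ _ (Finset.mem_univ i)] at hprod
  exact eq_inv_of_mul_eq_one_right hprod

lemma IsKZ.of_tendsto {α : Type*} {l : Filter α} [l.NeBot] {A : α → Fin n → ℝ}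
    {R : α → Matrix (Fin n) (Fin n) ℝ} {A' : Fin n → ℝ} {R' : Matrix (Fin n) (Fin n) ℝ}
    (hA : Tendsto A l (𝓝 A')) (hR : Tendsto R l (𝓝 R')) (h : ∀ j, IsKZ (A j) (R j)) :
    IsKZ A' R' := by
  have hA1 : ∀ i, Tendsto (fun j => A j i) l (𝓝 (A' i)) := fun i => (tendsto_pi_nhds.1 hA) i
  have hR1 : ∀ i k, Tendsto (fun j => R j i k) l (𝓝 (R' i k)) := fun i k =>
    ((continuous_id.matrix_elem i k).tendsto R').comp hR
  refine ⟨fun i => ge_of_tendsto' (hA1 i) fun j => (h j).nonneg i, fun i => ?_, fun i k hik => ?_,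
    fun i k hik => ?_, fun i x hx => ?_⟩
  · exact tendsto_nhds_unique (hR1 i i) ((hA1 i).congr fun j => ((h j).diag i).symm)
  · exact tendsto_nhds_unique (hR1 i k)
      (tendsto_const_nhds.congr fun j => ((h j).low i k hik).symm)
  · exact le_of_tendsto_of_tendsto' (hR1 i k).abs ((hA1 i).div_const 2) fun j => (h j).half i k hik
  · refine le_of_tendsto_of_tendsto' ((hA1 i).pow 2) (tendsto_finsetSum _ fun k _ => ?_)
      fun j => (h j).min i x hx
    split_ifs
    · refine Tendsto.pow ?_ 2
      exact tendsto_finsetSum Finset.univ fun a _ => (hR1 k a).mul_const (x a : ℝ)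
    · exact tendsto_const_nhds

lemma IsKZ.abs_le {A : Fin n → ℝ} {R : Matrix (Fin n) (Fin n) ℝ} (h : IsKZ A R) {B : ℝ}
    (hB : ∀ i, A i ≤ B) (i j : Fin n) : |R i j| ≤ B := by
  have h0 := h.nonneg i
  have h1 := hB i
  rcases lt_trichotomy i j with hij | rfl | hij
  · have := h.half i j hij
    linarith
  · rwa [h.diag, abs_of_nonneg h0]
  · rw [h.low i j hij, abs_zero]
    exact h0.trans h1

lemma exists_stable_limit (hn : 0 < n) {G : Matrix (Fin n) (Fin n) ℝ} (hG : G.det ^ 2 = 1) :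
    ∃ (t : ℕ → Fin n → ℝ) (U : ℕ → Matrix (Fin n) (Fin n) ℤ)
      (Q R : ℕ → Matrix (Fin n) (Fin n) ℝ) (R' : Matrix (Fin n) (Fin n) ℝ) (A' : Fin n → ℝ),
      (∀ j, ∑ i, t j i = 0) ∧ (∀ j, (Q j)ᵀ * Q j = 1) ∧
      (∀ j, ed (t j) * G * zr (U j) = Q j * R j) ∧ Tendsto R atTop (𝓝 R') ∧ IsKZ A' R' ∧
      (∀ i, 0 < A' i) ∧ ∏ i, A' i = 1 ∧
      ∀ (i : ℕ) (hi : i ≤ n), 1 ≤ ∏ a, A' (Fin.castLE hi a) := by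
  choose t U Q R A ht hQ hYU hK hA hprod hst using fun j : ℕ =>
    exists_stable_kz hG (ε := 1 / ((j : ℝ) + 1)) (by positivity)
  set c : ℝ := (3 / 4) ^ n * Real.exp (-1) with hc
  have hc0 : 0 < c := by positivity
  have hc1 : c ≤ 1 := mul_le_one₀ (pow_le_one₀ (by norm_num) (by norm_num)) (by positivity)
    (Real.exp_le_one_iff.2 (by norm_num))
  have hlow : ∀ j i, c ≤ A j i := by
    intro j i
    refine (hK j).lower_of_first hn (Real.exp_pos _).le ?_ i
    have h1 := hst j 1 hn
    have h2 : (1 : ℝ) / ((j : ℝ) + 1) ≤ 1 := by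
      rw [div_le_one (by positivity)]
      linarith [(Nat.cast_nonneg j : (0 : ℝ) ≤ j)]
    rw [Fin.prod_univ_one] at h1
    refine le_trans ?_ h1
    rw [← Real.exp_nat_mul]
    refine Real.exp_le_exp.2 ?_
    push_cast
    linarith
  have hup : ∀ j i, A j i ≤ (c ^ n)⁻¹ := fun j =>
    le_inv_pow_of_prod_eq_one hc0 hc1 (hlow j) (hprod j)
  have hcomp : IsCompact (Set.univ.pi fun _ : Fin n => Set.univ.pi fun _ : Fin n =>
      Set.Icc (-(c ^ n)⁻¹) (c ^ n)⁻¹) :=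
    isCompact_univ_pi fun _ => isCompact_univ_pi fun _ => isCompact_Icc
  obtain ⟨R', -, φ, hφ, hlim⟩ := hcomp.tendsto_subseq (X := Fin n → Fin n → ℝ) (x := R)
    fun j i _ k _ => abs_le.1 ((hK j).abs_le (hup j) i k)
  have hlim' : Tendsto (fun j => R (φ j)) atTop (𝓝 (R' : Matrix (Fin n) (Fin n) ℝ)) := hlim
  have hAi : ∀ i, Tendsto (fun j => A (φ j) i) atTop (𝓝 (R' i i)) := fun i =>
    (((continuous_id.matrix_elem i i).tendsto (R' : Matrix (Fin n) (Fin n) ℝ)).comp hlim').congr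
      fun j => (hK (φ j)).diag i
  have hR'0 : ∀ i, 0 < R' i i := fun i => hc0.trans_le (ge_of_tendsto' (hAi i) fun j => hlow _ i)
  refine ⟨fun j => t (φ j), fun j => U (φ j), fun j => Q (φ j), fun j => R (φ j), R',
    fun i => R' i i, fun j => ht _, fun j => hQ _, fun j => hYU _, hlim',
    IsKZ.of_tendsto (tendsto_pi_nhds.2 hAi) hlim' fun j => hK (φ j), hR'0, ?_, fun i hi => ?_⟩
  · exact tendsto_nhds_unique (tendsto_finsetProd _ fun i _ => hAi i)
      (tendsto_const_nhds.congr fun j => (hprod (φ j)).symm)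
  · have h1 : Tendsto (fun j => Real.exp (-(1 / ((φ j : ℝ) + 1)))) atTop (𝓝 (Real.exp (-0))) :=
      (Real.continuous_exp.tendsto _).comp
        (tendsto_one_div_add_atTop_nhds_zero_nat.comp hφ.tendsto_atTop).neg
    have h2 := le_of_tendsto_of_tendsto' h1
      ((tendsto_finsetProd Finset.univ fun a _ => hAi (Fin.castLE hi a)).pow 2)
      fun j => hst (φ j) i hi
    rw [neg_zero, Real.exp_zero] at h2
    exact (one_le_pow_iff_of_nonneg (Finset.prod_nonneg fun a _ => (hR'0 _).le) two_ne_zero).1 h2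

lemma abs_prod_le_of_dotProduct_le {w : Fin n → ℝ} {s : ℝ} (hs : 0 < s)
    (hw : w ⬝ᵥ w ≤ n * s ^ 2) : |∏ i, w i| ≤ s ^ n := by
  refine abs_le_of_sq_le_sq ?_ (by positivity)
  rw [← Finset.prod_pow]
  calc ∏ i, w i ^ 2 ≤ ∏ i, s ^ 2 * Real.exp (w i ^ 2 / s ^ 2 - 1) := by
        refine Finset.prod_le_prod (fun i _ => sq_nonneg _) fun i _ => ?_
        have h1 := Real.add_one_le_exp (w i ^ 2 / s ^ 2 - 1)
        rw [sub_add_cancel, div_le_iff₀' (by positivity)] at h1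
        exact h1
    _ = (s ^ n) ^ 2 * Real.exp (∑ i, (w i ^ 2 / s ^ 2 - 1)) := by
        rw [Finset.prod_mul_distrib, Real.exp_sum, Finset.prod_const, Finset.card_univ,
          Fintype.card_fin, ← pow_mul, ← pow_mul, mul_comm 2 n]
    _ ≤ (s ^ n) ^ 2 := by
        refine mul_le_of_le_one_right (by positivity) (Real.exp_le_one_iff.2 ?_)
        have h1 : w ⬝ᵥ w = ∑ i, w i ^ 2 := by simp only [dotProduct, pow_two]
        rw [Finset.sum_sub_distrib, ← Finset.sum_div, ← h1]
        simp only [Finset.sum_const, Finset.card_univ, Fintype.card_fin, nsmul_eq_mul, mul_one,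
          sub_nonpos]
        rwa [div_le_iff₀ (by positivity)]

lemma exists_abs_prod_le {G R' : Matrix (Fin n) (Fin n) ℝ} {t : ℕ → Fin n → ℝ}
    {U : ℕ → Matrix (Fin n) (Fin n) ℤ} {Q R : ℕ → Matrix (Fin n) (Fin n) ℝ} (hn : 0 < n)
    (ht : ∀ j, ∑ i, t j i = 0) (hQ : ∀ j, (Q j)ᵀ * Q j = 1)
    (hYU : ∀ j, ed (t j) * G * zr (U j) = Q j * R j) (hR : Tendsto R atTop (𝓝 R'))
    (hR' : R'.det ≠ 0)
    (hcov : ∀ η : ℝ, 0 < η → ∀ u : Fin n → ℝ, ∃ x : Fin n → ℤ,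
      (u - R' *ᵥ fun i => (x i : ℝ)) ⬝ᵥ (u - R' *ᵥ fun i => (x i : ℝ)) ≤ n / 4 + η)
    (u : Fin n → ℝ) {s : ℝ} (hs : 1 / 2 < s) :
    ∃ x : Fin n → ℤ, |∏ i, (u - G *ᵥ fun i => (x i : ℝ)) i| ≤ s ^ n := by
  have hn' : (0 : ℝ) < n := Nat.cast_pos.2 hn
  have hT : Tendsto (fun j => R j * R'⁻¹) atTop (𝓝 1) := by
    have h1 : Continuous fun M : Matrix (Fin n) (Fin n) ℝ => M * R'⁻¹ :=
      continuous_id.matrix_mul continuous_const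
    have h2 := (h1.tendsto R').comp hR
    rwa [mul_nonsing_inv _ (isUnit_iff_ne_zero.2 hR')] at h2
  have hdet : ∀ᶠ j in atTop, (R j * R'⁻¹).det ≠ 0 := by
    have := (continuous_id.matrix_det.tendsto (1 : Matrix (Fin n) (Fin n) ℝ)).comp hT
    rw [id, det_one] at this
    exact this.eventually_ne one_ne_zero
  obtain ⟨j, hj, hc⟩ := (hdet.and (eventually_mulVec_le hT (c := 2 * s) (by linarith))).exists
  set T := R j * R'⁻¹ with hTdef
  obtain ⟨x, hx⟩ := hcov (n * (s / 2 - 1 / 4)) (mul_pos hn' (by linarith))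
    (T⁻¹ *ᵥ ((Q j)ᵀ *ᵥ (ed (t j) *ᵥ u)))
  refine ⟨U j *ᵥ x, ?_⟩
  have hQ' : Q j * (Q j)ᵀ = 1 := mul_eq_one_comm.1 (hQ j)
  have hTR : T * R' = R j := by
    rw [hTdef, Matrix.mul_assoc, nonsing_inv_mul _ (isUnit_iff_ne_zero.2 hR'), Matrix.mul_one]
  have h1 : ed (t j) *ᵥ (u - G *ᵥ fun i => ((U j *ᵥ x) i : ℝ)) =
      Q j *ᵥ (T *ᵥ (T⁻¹ *ᵥ ((Q j)ᵀ *ᵥ (ed (t j) *ᵥ u)) - R' *ᵥ fun i => (x i : ℝ))) := by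
    rw [← zr_mulVec, mulVec_sub, mulVec_sub, mulVec_sub, mulVec_mulVec _ T T⁻¹,
      mul_nonsing_inv _ (isUnit_iff_ne_zero.2 hj), one_mulVec, mulVec_mulVec _ (Q j) (Q j)ᵀ, hQ',
      one_mulVec, mulVec_mulVec _ T R', hTR, mulVec_mulVec _ (Q j), ← hYU]
    simp only [mulVec_mulVec, Matrix.mul_assoc]
  have h2 := prod_ed_mulVec (ht j) 1 (u - G *ᵥ fun i => ((U j *ᵥ x) i : ℝ))
  rw [Matrix.mul_one, one_mulVec, h1] at h2
  rw [← h2]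
  refine abs_prod_le_of_dotProduct_le (by linarith) ?_
  rw [mulVec_dotProduct_of_orthogonal (hQ j)]
  refine (hc _).trans ((mul_le_mul_of_nonneg_left hx (by linarith)).trans (le_of_eq ?_))
  ring

end minkowski

end SW.Mink

/-- **Theorem 5.8.** If every KZ stable tuple `(A 0, …, A (n-1))` (positive, product one,
satisfying the Korkine–Zolotarev inequalities and the stability inequalities) lies in
`𝒲(𝓘)` for some composition `𝓘` of `n`, then Minkowski's conjecture holds in dimension `n`. -/
theorem SW.minkowski_of_KZS_cover (n : ℕ) (hn : 2 ≤ n)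
    (H : ∀ A : ℕ → ℝ, (∀ i, i < n → 0 < A i) →
      (∏ i ∈ Finset.range n, A i) = 1 →
      (∀ i : ℕ, i + 1 < n → (3 / 4) * A i ^ 2 ≤ A (i + 1) ^ 2) →
      (∀ i : ℕ, i + 2 < n → (2 / 3) * A i ^ 2 ≤ A (i + 2) ^ 2) →
      (∀ i : ℕ, 1 ≤ i → i ≤ n - 1 → 1 ≤ ∏ j ∈ Finset.range i, A j) →
      ∃ (k : ℕ) (ns : Fin k → ℕ), 0 < k ∧ (∀ i, 0 < ns i) ∧ (∑ j, ns j) = n ∧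
        (∀ i : Fin k,
          (∏ j ∈ Finset.Ico (SW.off ns i) (SW.off ns i + ns i), A j) *
              SW.hermiteConst (ns i + 1) ^ (((ns i : ℝ) + 1) / 2) ≤
            2 * A (SW.off ns i) ^ (ns i)) ∧
        (∑ i : Fin k,
          (A (SW.off ns i) ^ 2 - A (SW.off ns i) ^ (2 * ns i + 2) /
            ((∏ j ∈ Finset.Ico (SW.off ns i) (SW.off ns i + ns i), A j) ^ 2 *
              SW.hermiteConst (ns i + 1) ^ (ns i + 1)))) ≤ (n : ℝ) / 4) :
    ∀ L : AddSubgroup (Fin n → ℝ), SW.IsUnimodularLattice L →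
      ∀ u : Fin n → ℝ, (⨅ v : L, |∏ i, (u i - (v : Fin n → ℝ) i)|) ≤ 1 / 2 ^ n := by
  intro L hL u
  obtain ⟨G, hG, hGL⟩ := SW.Mink.exists_matrix_of_isUnimodularLattice hL
  obtain ⟨t, U, Q, R, R', A', ht, hQ, hYU, hR, hK, hA', hprod, hst⟩ :=
    SW.Mink.exists_stable_limit (by omega) hG
  set A : ℕ → ℝ := fun i => if h : i < n then A' ⟨i, h⟩ else 1 with hAdef
  have hAA' : (fun i : Fin n => A i) = A' := by
    ext i
    simp [hAdef]
  have hA : ∀ (i : ℕ) (h : i < n), A i = A' ⟨i, h⟩ := fun i h => dif_pos h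
  have hApos : ∀ i, i < n → 0 < A i := fun i hi => by rw [hA i hi]; exact hA' _
  obtain ⟨k, ns, hk, hns, hsum, hW, hle⟩ := H A hApos
    (by rw [Finset.prod_range, hAA', hprod])
    (fun i hi => by
      rw [hA i (by omega), hA (i + 1) hi]
      exact hK.three_quarters rfl)
    (fun i hi => by
      rw [hA i (by omega), hA (i + 2) hi]
      exact hK.two_thirds (j := ⟨i + 1, by omega⟩) (hA' _) (hA' _) rfl rfl)
    (fun i _ hi => by
      rw [Finset.prod_range]
      refine (hst i (by omega)).trans (le_of_eq (Finset.prod_congr rfl fun a _ => ?_))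
      rw [hA a (by omega)]
      rfl)
  have hdet : R'.det ≠ 0 := by
    have h1 := hK.gd_eq
    rw [hprod, SW.Mink.gd_square, one_pow] at h1
    rintro h0
    simp [h0] at h1
  have hcov : ∀ η : ℝ, 0 < η → ∀ u : Fin n → ℝ, ∃ x : Fin n → ℤ,
      dotProduct (u - R'.mulVec fun i => (x i : ℝ)) (u - R'.mulVec fun i => (x i : ℝ)) ≤
        n / 4 + η := by
    intro η hη u
    have hk' : (0 : ℝ) < k := Nat.cast_pos.2 hk
    obtain ⟨x, hx⟩ := SW.Mink.IsKZ.cover (A := A) (hAA' ▸ hK) hApos ns hns hsum hW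
      (div_pos hη hk') u
    refine ⟨x, hx.trans ?_⟩
    rw [mul_div_cancel₀ _ hk'.ne']
    exact add_le_add_left hle η
  have hbound : ∀ s : ℝ, 1 / 2 < s → (⨅ v : L, |∏ i, (u i - (v : Fin n → ℝ) i)|) ≤ s ^ n := by
    intro s hs
    obtain ⟨x, hx⟩ := SW.Mink.exists_abs_prod_le (by omega) ht hQ hYU hR hdet hcov u hs
    exact (ciInf_le ⟨0, by rintro _ ⟨v, rfl⟩; exact abs_nonneg _⟩
      (⟨_, (hGL _).2 ⟨x, rfl⟩⟩ : L)).trans hx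
  have hlim : Filter.Tendsto (fun s : ℝ => s ^ n) (nhdsWithin (1 / 2) (Set.Ioi (1 / 2)))
      (nhds ((1 / 2) ^ n)) := ((continuous_pow n).tendsto _).mono_left nhdsWithin_le_nhds
  rw [← _root_.one_div_pow]
  exact ge_of_tendsto hlim (Filter.eventually_of_mem self_mem_nhdsWithin hbound)
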